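/- Let (u, p, v) be a C^∞ solution of the stationary simplified Ericksen–Leslie system on ℝ³ with |v(x)| = 1 for all x, and assume sup_{R ≥ 1} ∫_{C(R/2,R)} |∇v|² dx < +∞. Let 0 < γ < 3 ≤ p < +∞ be such that η(γ,p) = γ/p − 3/p + 2/3 ≤ 0. If u belongs to M^p_{γ,0}(ℝ³) and each component of ∇v belongs to M^p_γ(ℝ³), then u ≡ 0, ∇v ≡ 0 (so v is a constant unit vector) and p is a constant function. -/

import Mathlib

open MeasureTheory Filter Metric Real

noncomputable section

/-- Three-dimensional Euclidean space. -/
abbrev E3 : Type := EuclideanSpace ℝ (Fin 3)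

/-- Partial derivative `∂_j f` of a scalar field. -/
def pd (j : Fin 3) (f : E3 → ℝ) (x : E3) : ℝ :=
  fderiv ℝ f x (EuclideanSpace.single j 1)

/-- Laplacian of a scalar field. -/
def lap (f : E3 → ℝ) (x : E3) : ℝ := ∑ j, pd j (pd j f) x

/-- The annulus `C(R/2, R)`. -/
def ann (R : ℝ) : Set E3 := {x : E3 | R / 2 < ‖x‖ ∧ ‖x‖ < R}

/-- Euclidean length `|u(x)|` of a vector field. -/
def vecNorm (u : E3 → Fin 3 → ℝ) (x : E3) : ℝ := Real.sqrt (∑ i, (u x i) ^ 2)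

/-- `|∇v|² = Σ_{i,k} (∂_i v_k)²`. -/
def gradSq (v : E3 → Fin 3 → ℝ) (x : E3) : ℝ :=
  ∑ i, ∑ k, (pd i (fun y => v y k) x) ^ 2

/-- The stationary simplified Ericksen–Leslie system:
`−Δu + (u·∇)u + div(∇v ⊙ ∇v) + ∇p = 0`, `−Δv + (u·∇)v − |∇v|² v = 0`, `div u = 0`. -/
def StatEL (u : E3 → Fin 3 → ℝ) (P : E3 → ℝ) (v : E3 → Fin 3 → ℝ) : Prop :=
  (∀ x : E3, ∀ i : Fin 3,
    -(lap (fun y => u y i) x) + (∑ j, u x j * pd j (fun y => u y i) x)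
      + (∑ j, ∑ k, pd j (fun y => pd i (fun z => v z k) y * pd j (fun z => v z k) y) x)
      + pd i P x = 0) ∧
  (∀ x : E3, ∀ i : Fin 3,
    -(lap (fun y => v y i) x) + (∑ j, u x j * pd j (fun y => v y i) x)
      - gradSq v x * v x i = 0) ∧
  (∀ x : E3, ∑ j, pd j (fun y => u y j) x = 0)

/-- Membership in the local Morrey space `M^p_γ(ℝ³)`. -/
def MemMorrey (p γ : ℝ) (f : E3 → ℝ) : Prop :=
  LocallyIntegrable (fun x => |f x| ^ p) volume ∧
  ∃ C : ℝ, ∀ R : ℝ, 1 ≤ R → R ^ (-γ) * ∫ x in ball (0 : E3) R, |f x| ^ p ≤ C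

/-- Membership in `M^p_{γ,0}(ℝ³)`. -/
def MemMorrey0 (p γ : ℝ) (f : E3 → ℝ) : Prop :=
  MemMorrey p γ f ∧
  Tendsto (fun R : ℝ => R ^ (-γ) * ∫ x in ann R, |f x| ^ p) atTop (nhds 0)

section

open scoped FourierTransform ENNReal NNReal

/-- The inverse Fourier integral is symmetric for the bilinear pairing. -/
theorem integral_fourierInv_mul_eq_flip {f g : E3 → ℂ} (hf : Integrable f) (hg : Integrable g) :
    ∫ x, (𝓕⁻ f) x * g x = ∫ x, f x * (𝓕⁻ g) x := by
  have h := VectorFourier.integral_fourierIntegral_smul_eq_flip (μ := volume) (ν := volume)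
    (L := innerₗ E3) (f := f) (g := fun x => g (-x)) Real.continuous_fourierChar
    continuous_inner hf hg.comp_neg
  have hflip : (innerₗ E3).flip = innerₗ E3 := flip_innerₗ E3
  rw [hflip] at h
  rw [Real.fourierInv_eq_fourier_comp_neg g, ← integral_neg_eq_self]
  simp only [Real.fourierInv_eq_fourier_neg, neg_neg]
  exact h

theorem continuous_fourierInv {f : E3 → ℂ} (hf : Integrable f) : Continuous (𝓕⁻ f) := by
  have h : Continuous (𝓕 f) :=
    VectorFourier.fourierIntegral_continuous Real.continuous_fourierChar
      (by exact continuous_inner) hf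
  rw [show 𝓕⁻ f = fun w => 𝓕 f (-w) from funext fun w => Real.fourierInv_eq_fourier_neg f w]
  exact h.comp continuous_neg

theorem norm_fourierInv_le (f : E3 → ℂ) (x : E3) : ‖(𝓕⁻ f) x‖ ≤ ∫ y, ‖f y‖ := by
  rw [Real.fourierInv_eq_fourier_neg]
  exact VectorFourier.norm_fourierIntegral_le_integral_norm _ _ _ _ _

/-- On `L¹ ∩ L²` the inverse Fourier integral is the `L²` inverse Fourier transform. -/
theorem fourierInv_toLp_ae_eq {f : E3 → ℂ} (hf : Integrable f) (h2 : MemLp f 2) :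
    ((𝓕⁻ (h2.toLp f) : Lp ℂ 2 (volume : Measure E3)) : E3 → ℂ) =ᵐ[volume] 𝓕⁻ f := by
  have hL : LocallyIntegrable
      ((𝓕⁻ (h2.toLp f) : Lp ℂ 2 (volume : Measure E3)) : E3 → ℂ) volume :=
    (Lp.memLp _).locallyIntegrable (by norm_num)
  refine ae_eq_of_integral_contDiff_smul_eq hL
    (continuous_fourierInv hf).locallyIntegrable ?_
  intro g hg hgs
  have hgc : ContDiff ℝ (⊤ : ℕ∞) (fun x => (g x : ℂ)) := Complex.ofRealCLM.contDiff.comp hg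
  have hgcs : HasCompactSupport (fun x => (g x : ℂ)) := hgs.comp_left (g := Complex.ofReal) rfl
  set φ : SchwartzMap E3 ℂ := hgcs.toSchwartzMap hgc with hφ
  have hφg : ∀ x, φ x = (g x : ℂ) := fun x => rfl
  have key := congrArg (fun T => T φ) (Lp.fourierInv_toTemperedDistribution_eq (h2.toLp f))
  simp only [TemperedDistribution.fourierInv_apply, Lp.toTemperedDistribution_apply] at key
  have e1 : ∫ x, g x • ((𝓕⁻ (h2.toLp f) : Lp ℂ 2 (volume : Measure E3)) : E3 → ℂ) x
      = ∫ x, φ x • ((𝓕⁻ (h2.toLp f) : Lp ℂ 2 (volume : Measure E3)) : E3 → ℂ) x := by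
    congr 1
  rw [e1, ← key]
  have e2 : ∫ x, (𝓕⁻ φ) x • (h2.toLp f : E3 → ℂ) x = ∫ x, (𝓕⁻ (φ : E3 → ℂ)) x * f x := by
    refine integral_congr_ae ?_
    filter_upwards [h2.coeFn_toLp] with x hx
    rw [hx, SchwartzMap.fourierInv_coe, smul_eq_mul]
  rw [e2, integral_fourierInv_mul_eq_flip φ.integrable hf]
  rfl

theorem memLp_fourierInv {f : E3 → ℂ} (hf : Integrable f) (h2 : MemLp f 2) :
    MemLp (𝓕⁻ f) 2 :=
  (memLp_congr_ae (fourierInv_toLp_ae_eq hf h2)).1 (Lp.memLp _)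

theorem eLpNorm_fourierInv {f : E3 → ℂ} (hf : Integrable f) (h2 : MemLp f 2) :
    eLpNorm (𝓕⁻ f) 2 = eLpNorm f 2 := by
  rw [← eLpNorm_congr_ae (fourierInv_toLp_ae_eq hf h2), ← eLpNorm_congr_ae h2.coeFn_toLp]
  have h := (MeasureTheory.Lp.fourierTransformₗᵢ E3 ℂ).symm.norm_map (h2.toLp f)
  rw [Lp.norm_def, Lp.norm_def] at h
  exact (ENNReal.toReal_eq_toReal_iff' (Lp.eLpNorm_ne_top _) (Lp.eLpNorm_ne_top _)).1 h

theorem conj_fourierInv (f : E3 → ℂ) (x : E3) :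
    starRingEnd ℂ ((𝓕⁻ f) x) = (𝓕⁻ (fun ξ => starRingEnd ℂ (f (-ξ)))) x := by
  rw [Real.fourierInv_eq, Real.fourierInv_eq, ← integral_conj, ← integral_neg_eq_self]
  congr 1; ext ξ
  simp [Circle.smul_def, inner_neg_left, AddChar.map_neg_eq_inv]

/-- Parseval's identity in bilinear form. -/
theorem integral_fourierInv_mul_fourierInv {f g : E3 → ℂ} (hf : Integrable f) (h2 : MemLp f 2)
    (hg : Integrable g) (hg2 : MemLp g 2) :
    ∫ x, (𝓕⁻ f) x * (𝓕⁻ g) x = ∫ ξ, f ξ * g (-ξ) := by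
  set f' : E3 → ℂ := fun ξ => starRingEnd ℂ (f (-ξ)) with hf'
  have hf'1 : Integrable f' := by
    have := hf.comp_neg
    exact (Complex.conjLIE.toContinuousLinearEquiv.toContinuousLinearMap).integrable_comp this
  have hf'2 : MemLp f' 2 := by
    have h3 : MemLp (fun ξ => f (-ξ)) 2 := h2.comp_measurePreserving
      (Measure.measurePreserving_neg volume)
    exact (Complex.conjLIE.toContinuousLinearEquiv.toContinuousLinearMap).comp_memLp' h3
  have h := (MeasureTheory.Lp.fourierTransformₗᵢ E3 ℂ).symm.inner_map_map
    (hf'2.toLp f') (hg2.toLp g)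
  rw [L2.inner_def, L2.inner_def] at h
  have e1 : ∫ x, inner ℂ ((𝓕⁻ f') x) ((𝓕⁻ g) x) = ∫ ξ, inner ℂ (f' ξ) (g ξ) := by
    calc _ = _ := ?_
      _ = _ := h
      _ = _ := ?_
    · refine integral_congr_ae ?_
      filter_upwards [fourierInv_toLp_ae_eq hf'1 hf'2, fourierInv_toLp_ae_eq hg hg2] with x h1 h2
      rw [← h1, ← h2]; rfl
    · refine integral_congr_ae ?_
      filter_upwards [hf'2.coeFn_toLp, hg2.coeFn_toLp] with x h1 h2
      rw [h1, h2]
  have e2 : ∀ x, inner ℂ ((𝓕⁻ f') x) ((𝓕⁻ g) x) = (𝓕⁻ f) x * (𝓕⁻ g) x := by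
    intro x
    rw [RCLike.inner_apply, hf', ← conj_fourierInv, RingHomCompTriple.comp_apply,
      RingHom.id_apply, mul_comm]
  simp only [e2] at e1
  rw [e1, ← integral_neg_eq_self]
  congr 1; ext ξ
  simp [hf', mul_comm]

theorem fourierInv_char_mul (k : E3 → ℂ) (ξ η : E3) :
    (𝓕⁻ (fun x => (𝐞 (inner ℝ x ξ) : ℂ) * k x)) η = (𝓕⁻ k) (ξ + η) := by
  rw [Real.fourierInv_eq, Real.fourierInv_eq]
  congr 1; ext x
  simp only [Circle.smul_def, smul_eq_mul, inner_add_right, AddChar.map_add_eq_mul, Circle.coe_mul]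
  ring

theorem fourierInv_shift (f : E3 → ℂ) (ζ x : E3) :
    (𝓕⁻ (fun η => f (η - ζ))) x = (𝐞 (inner ℝ x ζ) : ℂ) * (𝓕⁻ f) x := by
  rw [Real.fourierInv_eq, Real.fourierInv_eq,
    ← integral_add_right_eq_self (fun v => 𝐞 (inner ℝ v x) • f (v - ζ)) ζ, ← integral_const_mul]
  congr 1; ext y
  simp only [Circle.smul_def, smul_eq_mul, inner_add_left, AddChar.map_add_eq_mul, Circle.coe_mul,
    add_sub_cancel_right, real_inner_comm x ζ]
  ring

theorem integrable_char_mul {k : E3 → ℂ} (hk : Integrable k) (ξ : E3) :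
    Integrable (fun x => (𝐞 (inner ℝ x ξ) : ℂ) * k x) := by
  have h := (Real.fourierIntegral_convergent_iff (-ξ)).2 hk
  simpa [Circle.smul_def] using h

theorem volume_inner_eq_zero {θ : E3} (hθ : θ ≠ 0) :
    volume {ξ : E3 | inner ℝ ξ θ = (0 : ℝ)} = 0 := by
  have h : {ξ : E3 | inner ℝ ξ θ = (0 : ℝ)} = ((ℝ ∙ θ)ᗮ : Submodule ℝ E3) := by
    ext ξ
    simp [Submodule.mem_orthogonal_singleton_iff_inner_left]
  rw [h]
  refine Measure.addHaar_submodule _ _ fun htop => hθ ?_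
  have : θ ∈ ((ℝ ∙ θ)ᗮ : Submodule ℝ E3) := htop ▸ Submodule.mem_top
  rwa [Submodule.mem_orthogonal_singleton_iff_inner_left, inner_self_eq_zero] at this

theorem integrable_fourierInv_mul {f k : E3 → ℂ} (hf : Integrable f) (hk : Integrable k) :
    Integrable (fun x => (𝓕⁻ f) x * k x) :=
  hk.bdd_mul (continuous_fourierInv hf).aestronglyMeasurable
    (Eventually.of_forall (norm_fourierInv_le f))

theorem fourierInv_mul_eq_zero {f k : E3 → ℂ} {θ : E3} (hf : Integrable f)
    (hs : ∀ ξ, inner ℝ ξ θ < (0 : ℝ) → f ξ = 0) (hk : Integrable k)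
    (hk0 : ∀ ξ, 0 ≤ (inner ℝ ξ θ : ℝ) → (𝓕⁻ k) ξ = 0) {ξ : E3} (hξ : 0 ≤ (inner ℝ ξ θ : ℝ)) :
    (𝓕⁻ (fun x => (𝓕⁻ f) x * k x)) ξ = 0 := by
  have h1 : (𝓕⁻ (fun x => (𝓕⁻ f) x * k x)) ξ
      = ∫ x, (𝓕⁻ f) x * ((𝐞 (inner ℝ x ξ) : ℂ) * k x) := by
    rw [Real.fourierInv_eq]
    congr 1; ext x
    simp only [Circle.smul_def, smul_eq_mul]
    ring
  rw [h1, integral_fourierInv_mul_eq_flip hf (integrable_char_mul hk ξ)]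
  refine integral_eq_zero_of_ae (Eventually.of_forall fun η => ?_)
  simp only [fourierInv_char_mul, Pi.zero_apply]
  rcases lt_or_ge (inner ℝ η θ) (0 : ℝ) with h | h
  · rw [hs η h, zero_mul]
  · rw [hk0 _ (by rw [inner_add_left]; positivity), mul_zero]

theorem integral_fourierInv_pow_four {f : E3 → ℂ} {θ : E3} (hθ : θ ≠ 0) (hf : Integrable f)
    (h2 : MemLp f 2) (hs : ∀ ξ, inner ℝ ξ θ < (0 : ℝ) → f ξ = 0) :
    ∫ x, (𝓕⁻ f) x ^ 4 = 0 := by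
  have hF := memLp_fourierInv hf h2
  have hF2 : Integrable (fun x => (𝓕⁻ f) x * (𝓕⁻ f) x) := hF.integrable_mul hF
  have sq_zero : ∀ ξ, 0 ≤ (inner ℝ ξ θ : ℝ) → (𝓕⁻ (fun x => (𝓕⁻ f) x * (𝓕⁻ f) x)) ξ = 0 := by
    intro ξ hξ
    have h1 : (𝓕⁻ (fun x => (𝓕⁻ f) x * (𝓕⁻ f) x)) ξ
        = ∫ x, (𝓕⁻ f) x * (𝓕⁻ (fun η => f (η - ξ))) x := by
      rw [Real.fourierInv_eq]
      congr 1; ext x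
      simp only [Circle.smul_def, smul_eq_mul, fourierInv_shift]
      ring
    rw [h1, integral_fourierInv_mul_fourierInv hf h2 (hf.comp_sub_right ξ)
      (h2.comp_measurePreserving (measurePreserving_sub_right volume ξ))]
    refine integral_eq_zero_of_ae ?_
    have h0 : ∀ᵐ η : E3, (inner ℝ η θ : ℝ) ≠ 0 := by
      rw [ae_iff]; simpa using volume_inner_eq_zero hθ
    filter_upwards [h0] with η hη
    rcases lt_or_gt_of_ne hη with h | h
    · simp [hs η h]
    · simp only [Pi.zero_apply]
      rw [hs (-η - ξ) (by rw [inner_sub_left, inner_neg_left]; linarith), mul_zero]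
  have cube_zero := fun ξ hξ => fourierInv_mul_eq_zero (ξ := ξ) hf hs hF2 sq_zero hξ
  have hF3 := integrable_fourierInv_mul hf hF2
  have four_zero := fourierInv_mul_eq_zero (ξ := 0) hf hs hF3 cube_zero (by simp)
  rw [Real.fourierInv_eq] at four_zero
  rw [← four_zero]
  congr 1; ext x
  simp
  ring

/-- The sign of `ξ · θ`, the symbol (up to `-i`) of the directional Hilbert transform. -/
def dirSign (θ ξ : E3) : ℝ := Real.sign (inner ℝ ξ θ)

theorem measurable_realSign : Measurable Real.sign := by
  unfold Real.sign
  exact Measurable.ite measurableSet_Iio measurable_const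
    (Measurable.ite measurableSet_Ioi measurable_const measurable_const)

theorem measurable_dirSign (θ : E3) : Measurable (dirSign θ) :=
  measurable_realSign.comp (by fun_prop)

theorem dirSign_neg (θ ξ : E3) : dirSign θ (-ξ) = -dirSign θ ξ := by
  simp [dirSign, inner_neg_left, Real.sign_neg]

theorem abs_realSign_le (r : ℝ) : |Real.sign r| ≤ 1 := by
  rcases Real.sign_apply_eq r with h | h | h <;> simp [h]

theorem abs_dirSign_le (θ ξ : E3) : |dirSign θ ξ| ≤ 1 := abs_realSign_le _

/-- Hermitian functions in `L¹ ∩ L²`. -/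
structure HermNice (f : E3 → ℂ) : Prop where
  int : Integrable f
  sq : MemLp f 2
  herm : ∀ ξ, starRingEnd ℂ (f (-ξ)) = f ξ

theorem HermNice.real {f : E3 → ℂ} (hf : HermNice f) (x : E3) :
    (((𝓕⁻ f) x).re : ℂ) = (𝓕⁻ f) x := by
  rw [← Complex.conj_eq_iff_re, conj_fourierInv]
  simp only [hf.herm]

theorem HermNice.bdd_mul {f m : E3 → ℂ} (hf : HermNice f) (hm : Measurable m) {C : ℝ}
    (hb : ∀ ξ, ‖m ξ‖ ≤ C) (hh : ∀ ξ, starRingEnd ℂ (m (-ξ)) = m ξ) :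
    HermNice (fun ξ => m ξ * f ξ) where
  int := hf.int.bdd_mul hm.aestronglyMeasurable (Eventually.of_forall hb)
  sq := by
    refine hf.sq.of_le_mul (c := C) (hm.aestronglyMeasurable.mul hf.sq.1) ?_
    refine Eventually.of_forall fun ξ => ?_
    rw [norm_mul]
    exact mul_le_mul_of_nonneg_right (hb ξ) (norm_nonneg _)
  herm ξ := by rw [map_mul, hh, hf.herm]

theorem HermNice.hilbert {f : E3 → ℂ} (hf : HermNice f) (θ : E3) :
    HermNice (fun ξ => (-Complex.I * dirSign θ ξ) * f ξ) := by
  refine hf.bdd_mul (C := 1) ?_ ?_ ?_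
  · exact measurable_const.mul (Complex.measurable_ofReal.comp (measurable_dirSign θ))
  · intro ξ; simpa using abs_dirSign_le θ ξ
  · intro ξ; simp [dirSign_neg]

theorem HermNice.integrable_pow_four {f : E3 → ℂ} (hf : HermNice f) :
    Integrable (fun x => ((𝓕⁻ f) x).re ^ 4) := by
  have hF := memLp_fourierInv hf.int hf.sq
  have h := (integrable_fourierInv_mul hf.int
    (integrable_fourierInv_mul hf.int (hF.integrable_mul hF))).re
  refine h.congr (Eventually.of_forall fun x => ?_)
  have hr := hf.real x
  simp only [Pi.mul_apply]
  rw [← hr]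
  simp only [← Complex.ofReal_mul]
  simp
  ring

/-- `L⁴` bound for the directional Hilbert transform, by M. Riesz's argument. -/
theorem HermNice.hilbert_four {f : E3 → ℂ} (hf : HermNice f) {θ : E3} (hθ : θ ≠ 0) :
    ∫ x, ((𝓕⁻ (fun ξ => (-Complex.I * dirSign θ ξ) * f ξ)) x).re ^ 4
      ≤ 36 * ∫ x, ((𝓕⁻ f) x).re ^ 4 := by
  have hk := hf.hilbert θ
  set k : E3 → ℂ := fun ξ => (-Complex.I * dirSign θ ξ) * f ξ with hkdef
  set g : E3 → ℂ := fun ξ => f ξ + Complex.I * k ξ with hg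
  have hg1 : Integrable g := hf.int.add (hk.int.const_mul _)
  have hg2 : MemLp g 2 := hf.sq.add (hk.sq.const_mul _)
  have hgs : ∀ ξ, inner ℝ ξ θ < (0 : ℝ) → g ξ = 0 := by
    intro ξ hξ
    have : dirSign θ ξ = -1 := Real.sign_of_neg hξ
    simp only [hg, hkdef, this]
    push_cast
    linear_combination (f ξ) * Complex.I_mul_I
  have h0 := integral_fourierInv_pow_four hθ hg1 hg2 hgs
  have hsum : ∀ x, (𝓕⁻ g) x = (𝓕⁻ f) x + Complex.I * (𝓕⁻ k) x := by
    intro x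
    simp only [Real.fourierInv_eq, hg, Circle.smul_def, smul_eq_mul, mul_add]
    have i1 := integrable_char_mul hf.int x
    have i2 := integrable_char_mul hk.int x
    simp only [real_inner_comm] at i1 i2
    rw [integral_add (by simpa [real_inner_comm] using i1)
      (by simpa [mul_left_comm, real_inner_comm] using i2.const_mul Complex.I),
      ← integral_const_mul]
    congr 2; ext y; ring
  have hgi : Integrable (fun x => (𝓕⁻ g) x ^ 4) := by
    have hF := memLp_fourierInv hg1 hg2
    refine (integrable_fourierInv_mul hg1
      (integrable_fourierInv_mul hg1 (hF.integrable_mul hF))).congr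
      (Eventually.of_forall fun x => ?_)
    simp only [Pi.mul_apply]; ring
  set a : E3 → ℝ := fun x => ((𝓕⁻ f) x).re with ha
  set b : E3 → ℝ := fun x => ((𝓕⁻ k) x).re with hb
  have hre : ∀ x, ((𝓕⁻ g) x ^ 4).re = a x ^ 4 - 6 * a x ^ 2 * b x ^ 2 + b x ^ 4 := by
    intro x
    rw [hsum, ← hf.real x, ← hk.real x]
    have : (((a x : ℝ) : ℂ) + Complex.I * ((b x : ℝ) : ℂ)) ^ 4
        = ((a x ^ 4 - 6 * a x ^ 2 * b x ^ 2 + b x ^ 4 : ℝ) : ℂ)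
          + ((4 * a x ^ 3 * b x - 4 * a x * b x ^ 3 : ℝ) : ℂ) * Complex.I := by
      push_cast
      linear_combination (6 * (a x : ℂ) ^ 2 * b x ^ 2 + 4 * a x * b x ^ 3 * Complex.I
        + (b x : ℂ) ^ 4 * (Complex.I * Complex.I - 1)) * Complex.I_mul_I
    rw [this, Complex.add_re, Complex.re_ofReal_mul, Complex.I_re, Complex.ofReal_re]; ring
  have h0' : ∫ x, (a x ^ 4 - 6 * a x ^ 2 * b x ^ 2 + b x ^ 4) = 0 := by
    have h1 := integral_re hgi
    simp only [RCLike.re_to_complex, hre] at h1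
    rw [h1, h0]; simp
  have ia := hf.integrable_pow_four
  have ib := hk.integrable_pow_four
  have hle : ∫ x, (b x ^ 4 / 2 - 18 * a x ^ 4 + 0)
      ≤ ∫ x, (a x ^ 4 - 6 * a x ^ 2 * b x ^ 2 + b x ^ 4) := by
    refine integral_mono_ae (((ib.div_const 2).sub (ia.const_mul 18)).add (integrable_zero _ _ _))
      ?_ (Eventually.of_forall fun x => ?_)
    · simpa only [RCLike.re_to_complex, hre] using hgi.re
    · simp only
      nlinarith [sq_nonneg (b x ^ 2 - 6 * a x ^ 2), sq_nonneg (a x ^ 2)]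
  rw [h0'] at hle
  simp only [add_zero] at hle
  rw [integral_sub (ib.div_const 2) (ia.const_mul 18), integral_div, integral_const_mul] at hle
  linarith

/-- `∫_{|θ|<1} (θ·y) sign(θ·ξ) dθ`. -/
def signMoment (ξ y : E3) : ℝ := ∫ θ in ball (0 : E3) 1, inner ℝ θ y * dirSign θ ξ

theorem measurable_dirSign_left (ξ : E3) : Measurable (fun θ => dirSign θ ξ) :=
  measurable_realSign.comp (by fun_prop)

theorem integrable_signMoment (ξ y : E3) :
    IntegrableOn (fun θ : E3 => inner ℝ θ y * dirSign θ ξ) (ball (0 : E3) 1) := by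
  refine Measure.integrableOn_of_bounded (M := ‖y‖) measure_ball_lt_top.ne ?_ ?_
  · exact ((by fun_prop : Measurable fun θ : E3 => inner ℝ θ y).mul
      (measurable_dirSign_left ξ)).aestronglyMeasurable
  · refine (ae_restrict_iff' measurableSet_ball).2 (Eventually.of_forall fun θ hθ => ?_)
    rw [norm_mul, Real.norm_eq_abs, Real.norm_eq_abs]
    have h1 : |inner ℝ θ y| ≤ ‖y‖ := by
      refine (abs_real_inner_le_norm θ y).trans ?_
      have : ‖θ‖ ≤ 1 := by simpa using (mem_ball_zero_iff.1 hθ).le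
      nlinarith [norm_nonneg y]
    nlinarith [abs_dirSign_le θ ξ, abs_nonneg (inner ℝ θ y), abs_nonneg (dirSign θ ξ)]

theorem signMoment_map (O : E3 ≃ₗᵢ[ℝ] E3) (ξ y : E3) :
    signMoment (O ξ) (O y) = signMoment ξ y := by
  unfold signMoment
  have hp := O.measurePreserving
  have h := hp.setIntegral_preimage_emb O.toHomeomorph.measurableEmbedding
    (fun θ : E3 => inner ℝ θ (O y) * dirSign θ (O ξ)) (ball (0 : E3) 1)
  rw [← h]
  have hpre : O ⁻¹' ball (0 : E3) 1 = ball (0 : E3) 1 := by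
    ext θ; simp
  rw [hpre]
  simp [dirSign]

theorem signMoment_smul (ξ y : E3) {t : ℝ} (ht : 0 < t) :
    signMoment (t • ξ) y = signMoment ξ y := by
  unfold signMoment
  congr 1; ext θ
  simp only [dirSign, inner_smul_left, RCLike.conj_to_real]
  congr 1
  rcases lt_trichotomy (inner ℝ ξ θ) (0 : ℝ) with h | h | h
  · rw [Real.sign_of_neg h, Real.sign_of_neg (mul_neg_of_pos_of_neg ht h)]
  · rw [h, mul_zero]
  · rw [Real.sign_of_pos h, Real.sign_of_pos (mul_pos ht h)]

theorem signMoment_add (ξ y z : E3) : signMoment ξ (y + z) = signMoment ξ y + signMoment ξ z := by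
  unfold signMoment
  rw [← integral_add (integrable_signMoment ξ y) (integrable_signMoment ξ z)]
  congr 1; ext θ; rw [inner_add_right]; ring

theorem signMoment_smul_right (ξ y : E3) (t : ℝ) : signMoment ξ (t • y) = t * signMoment ξ y := by
  unfold signMoment
  rw [← integral_const_mul]
  congr 1; ext θ; rw [real_inner_smul_right]; ring

theorem signMoment_orthogonal {ξ y : E3} (h : inner ℝ ξ y = (0 : ℝ)) : signMoment ξ y = 0 := by
  have h1 := signMoment_map ((ℝ ∙ y)ᗮ : Submodule ℝ E3).reflection ξ y
  rw [Submodule.reflection_mem_subspace_eq_self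
    (Submodule.mem_orthogonal_singleton_iff_inner_left.2 h),
    Submodule.reflection_orthogonalComplement_singleton_eq_neg] at h1
  have h2 := signMoment_smul_right ξ y (-1)
  rw [neg_one_smul] at h2
  linarith

theorem signMoment_pos :
    0 < signMoment (EuclideanSpace.single 0 1) (EuclideanSpace.single 0 1) := by
  unfold signMoment
  set e : E3 := EuclideanSpace.single 0 1 with he
  have heq : ∀ θ : E3, inner ℝ θ e * dirSign θ e = |inner ℝ θ e| := by
    intro θ
    rw [dirSign, real_inner_comm θ e, mul_comm]
    rcases lt_trichotomy (inner ℝ θ e) (0 : ℝ) with h | h | h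
    · rw [Real.sign_of_neg h, abs_of_neg h]; ring
    · simp [h]
    · rw [Real.sign_of_pos h, abs_of_pos h]; ring
  rw [setIntegral_pos_iff_support_of_nonneg_ae
    (Eventually.of_forall fun θ => by rw [heq]; exact abs_nonneg _) (integrable_signMoment e e)]
  have h0 : ∀ᵐ θ : E3, (inner ℝ θ e : ℝ) ≠ 0 := by
    rw [ae_iff]
    simpa using volume_inner_eq_zero (θ := e) (by simp [he])
  have : volume (Function.support (fun θ : E3 => inner ℝ θ e * dirSign θ e) ∩ ball (0 : E3) 1)
      = volume (ball (0 : E3) 1) := by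
    refine measure_congr ?_
    filter_upwards [h0] with θ hθ
    have : θ ∈ Function.support (fun θ : E3 => inner ℝ θ e * dirSign θ e) := by
      rw [Function.mem_support, heq]; exact abs_ne_zero.2 hθ
    exact propext ⟨fun h => h.2, fun h => ⟨this, h⟩⟩
  rw [this]
  exact measure_ball_pos _ _ one_pos

theorem exists_signMoment_eq :
    ∃ c : ℝ, 0 < c ∧ ∀ ξ y : E3, signMoment ξ y = c * (inner ℝ y ξ / ‖ξ‖) := by
  refine ⟨_, signMoment_pos, fun ξ y => ?_⟩
  set e : E3 := EuclideanSpace.single 0 1 with he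
  have hen : ‖e‖ = 1 := by simp [he]
  by_cases hξ : ξ = 0
  · subst hξ; simp [signMoment, dirSign]
  have hn : 0 < ‖ξ‖ := norm_pos_iff.2 hξ
  set ξ' : E3 := ‖ξ‖⁻¹ • ξ with hξ'
  have hξ'n : ‖ξ'‖ = 1 := by rw [hξ', norm_smul, norm_inv, norm_norm, inv_mul_cancel₀ hn.ne']
  have h1 : signMoment ξ y = signMoment ξ' y := (signMoment_smul ξ y (inv_pos.2 hn)).symm
  have h2 : signMoment ξ' ξ' = signMoment e e := by
    have := signMoment_map ((ℝ ∙ (ξ' - e))ᗮ : Submodule ℝ E3).reflection ξ' ξ'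
    rw [Submodule.reflection_sub (hξ'n.trans hen.symm)] at this
    exact this.symm
  have h3 : y = (inner ℝ y ξ' : ℝ) • ξ' + (y - (inner ℝ y ξ' : ℝ) • ξ') := by abel
  have h4 : inner ℝ ξ' (y - (inner ℝ y ξ' : ℝ) • ξ') = (0 : ℝ) := by
    rw [inner_sub_right, real_inner_smul_right, real_inner_self_eq_norm_sq, hξ'n,
      real_inner_comm]
    ring
  rw [h1]
  conv_lhs => rw [h3]
  rw [signMoment_add, signMoment_orthogonal h4, signMoment_smul_right, h2, hξ',
    real_inner_smul_right]
  rw [div_eq_inv_mul]; ring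

/-- The symbol `ξ_i ξ_k / |ξ|²` of a double Riesz transform. -/
def rieszSymbol (i k : Fin 3) (ξ : E3) : ℝ := ξ i * ξ k / ‖ξ‖ ^ 2

theorem measurable_rieszSymbol (i k : Fin 3) : Measurable (rieszSymbol i k) := by
  unfold rieszSymbol; fun_prop

theorem abs_coord_le (ξ : E3) (i : Fin 3) : |ξ i| ≤ ‖ξ‖ := PiLp.norm_apply_le ξ i

theorem abs_rieszSymbol_le (i k : Fin 3) (ξ : E3) : |rieszSymbol i k ξ| ≤ 1 := by
  unfold rieszSymbol
  rw [abs_div, abs_mul, abs_of_nonneg (sq_nonneg ‖ξ‖)]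
  refine div_le_one_of_le₀ ?_ (sq_nonneg _)
  nlinarith [abs_coord_le ξ i, abs_coord_le ξ k, abs_nonneg (ξ i), abs_nonneg (ξ k)]

theorem rieszSymbol_neg (i k : Fin 3) (ξ : E3) : rieszSymbol i k (-ξ) = rieszSymbol i k ξ := by
  simp [rieszSymbol]

theorem HermNice.riesz {f : E3 → ℂ} (hf : HermNice f) (i k : Fin 3) :
    HermNice (fun ξ => (rieszSymbol i k ξ : ℂ) * f ξ) := by
  refine hf.bdd_mul (C := 1) (Complex.measurable_ofReal.comp (measurable_rieszSymbol i k)) ?_ ?_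
  · intro ξ; simpa using abs_rieszSymbol_le i k ξ
  · intro ξ; simp [rieszSymbol_neg]

/-- The measure used to average directional Hilbert transforms. -/
def pairMeasure : Measure (E3 × E3) :=
  (volume.restrict (ball (0 : E3) 1)).prod (volume.restrict (ball (0 : E3) 1))

instance : IsFiniteMeasure (volume.restrict (ball (0 : E3) 1)) :=
  ⟨by rw [Measure.restrict_apply_univ]; exact measure_ball_lt_top⟩

instance : IsFiniteMeasure pairMeasure := by unfold pairMeasure; infer_instance

theorem exists_rieszSymbol_eq_average : ∃ c : ℝ, ∀ (i k : Fin 3) (ξ : E3),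
    rieszSymbol i k ξ
      = c * ∫ ω, (ω.1 i * dirSign ω.1 ξ) * (ω.2 k * dirSign ω.2 ξ) ∂pairMeasure := by
  obtain ⟨c, hc, h⟩ := exists_signMoment_eq
  refine ⟨(c ^ 2)⁻¹, fun i k ξ => ?_⟩
  have hj : ∀ j : Fin 3, ∫ θ in ball (0 : E3) 1, θ j * dirSign θ ξ = c * (ξ j / ‖ξ‖) := by
    intro j
    have := h ξ (EuclideanSpace.single j 1)
    simpa [signMoment, EuclideanSpace.inner_single_left, EuclideanSpace.inner_single_right] using this
  rw [pairMeasure, integral_prod_mul (fun θ : E3 => θ i * dirSign θ ξ)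
    (fun θ : E3 => θ k * dirSign θ ξ), hj, hj, rieszSymbol]
  field_simp

theorem ae_pairMeasure_bound (i k : Fin 3) :
    ∀ᵐ ω ∂pairMeasure, |ω.1 i| ≤ 1 ∧ |ω.2 k| ≤ 1 := by
  unfold pairMeasure
  rw [Measure.prod_restrict]
  refine (ae_restrict_iff' (measurableSet_ball.prod measurableSet_ball)).2
    (Eventually.of_forall fun ω hω => ?_)
  exact ⟨(abs_coord_le _ _).trans (by simpa using (mem_ball_zero_iff.1 hω.1).le),
    (abs_coord_le _ _).trans (by simpa using (mem_ball_zero_iff.1 hω.2).le)⟩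

theorem HermNice.lintegral_pow_four {f : E3 → ℂ} (hf : HermNice f) :
    ∫⁻ x, ‖(𝓕⁻ f) x‖ₑ ^ 4 = ENNReal.ofReal (∫ x, ((𝓕⁻ f) x).re ^ 4) := by
  rw [ofReal_integral_eq_lintegral_ofReal hf.integrable_pow_four
    (Eventually.of_forall fun x => by positivity)]
  congr 1; ext x
  rw [← hf.real x, Complex.ofReal_re, ← ofReal_norm, ← ENNReal.ofReal_pow (norm_nonneg _),
    Complex.norm_real, Real.norm_eq_abs]
  congr 1
  exact (Even.pow_abs ⟨2, rfl⟩ _)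

theorem HermNice.hilbert_four_lintegral {f : E3 → ℂ} (hf : HermNice f) (θ : E3) :
    ∫⁻ x, ‖(𝓕⁻ (fun ξ => (-Complex.I * dirSign θ ξ) * f ξ)) x‖ₑ ^ 4
      ≤ 36 * ∫⁻ x, ‖(𝓕⁻ f) x‖ₑ ^ 4 := by
  by_cases hθ : θ = 0
  · subst hθ
    simp [dirSign, Real.fourierInv_eq]
  · rw [(hf.hilbert θ).lintegral_pow_four, hf.lintegral_pow_four,
      show (36 : ℝ≥0∞) = ENNReal.ofReal 36 by norm_num, ← ENNReal.ofReal_mul (by norm_num)]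
    exact ENNReal.ofReal_le_ofReal (hf.hilbert_four hθ)

/-- Product of the symbols of two directional Hilbert transforms. -/
def pairSign (ω : E3 × E3) (ξ : E3) : ℝ := dirSign ω.1 ξ * dirSign ω.2 ξ

theorem measurable_pairSign : Measurable (fun p : E3 × (E3 × E3) => pairSign p.2 p.1) := by
  unfold pairSign dirSign
  exact (measurable_realSign.comp (by fun_prop)).mul (measurable_realSign.comp (by fun_prop))

theorem abs_pairSign_le (ω : E3 × E3) (ξ : E3) : |pairSign ω ξ| ≤ 1 := by
  rw [pairSign, abs_mul]
  exact mul_le_one₀ (abs_dirSign_le _ _) (abs_nonneg _) (abs_dirSign_le _ _)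

theorem HermNice.pairSign_four {f : E3 → ℂ} (hf : HermNice f) (ω : E3 × E3) :
    ∫⁻ x, ‖(𝓕⁻ (fun ξ => (pairSign ω ξ : ℂ) * f ξ)) x‖ₑ ^ 4
      ≤ 1296 * ∫⁻ x, ‖(𝓕⁻ f) x‖ₑ ^ 4 := by
  have h1 := hf.hilbert_four_lintegral ω.1
  have h2 := (hf.hilbert ω.1).hilbert_four_lintegral ω.2
  have heq : ∀ x, ‖(𝓕⁻ (fun ξ => (pairSign ω ξ : ℂ) * f ξ)) x‖ₑ
      = ‖(𝓕⁻ (fun ξ => (-Complex.I * dirSign ω.2 ξ) * ((-Complex.I * dirSign ω.1 ξ) * f ξ))) x‖ₑ := by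
    intro x
    rw [← enorm_neg, Real.fourierInv_eq, Real.fourierInv_eq, ← integral_neg]
    congr 2; ext ξ
    simp only [Circle.smul_def, smul_eq_mul, pairSign]
    push_cast
    linear_combination (-(𝐞 (inner ℝ ξ x) : ℂ)) * dirSign ω.1 ξ * dirSign ω.2 ξ * f ξ
      * Complex.I_mul_I
  simp only [heq]
  calc _ ≤ _ := h2
    _ ≤ 36 * (36 * ∫⁻ x, ‖(𝓕⁻ f) x‖ₑ ^ 4) := by gcongr
    _ = _ := by rw [← mul_assoc]; norm_num

theorem integrable_pairSign_mul {f : E3 → ℂ} (hf : Integrable f) (i k : Fin 3) (x : E3) :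
    Integrable (fun p : E3 × (E3 × E3) =>
      ((p.2.1 i * p.2.2 k * pairSign p.2 p.1 : ℝ) : ℂ) * ((𝐞 (inner ℝ p.1 x) : ℂ) * f p.1))
      (volume.prod pairMeasure) := by
  refine ((integrable_char_mul hf x).comp_fst pairMeasure).bdd_mul (c := 1) ?_ ?_
  · refine (Complex.measurable_ofReal.comp ?_).aestronglyMeasurable
    exact (by fun_prop : Measurable fun p : E3 × (E3 × E3) => p.2.1 i * p.2.2 k).mul
      measurable_pairSign
  · have h := (Measure.quasiMeasurePreserving_snd (μ := (volume : Measure E3))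
      (ν := pairMeasure)).ae (ae_pairMeasure_bound i k)
    filter_upwards [h] with p hp
    rw [Complex.norm_real, Real.norm_eq_abs, abs_mul, abs_mul]
    exact mul_le_one₀ (mul_le_one₀ hp.1 (abs_nonneg _) hp.2) (abs_nonneg _) (abs_pairSign_le _ _)

theorem exists_fourierInv_riesz_eq_average : ∃ c : ℝ, ∀ (i k : Fin 3) (f : E3 → ℂ),
    Integrable f → ∀ x, (𝓕⁻ (fun ξ => (rieszSymbol i k ξ : ℂ) * f ξ)) x
      = c * ∫ ω, ((ω.1 i * ω.2 k : ℝ) : ℂ) * (𝓕⁻ (fun ξ => (pairSign ω ξ : ℂ) * f ξ)) x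
        ∂pairMeasure := by
  obtain ⟨c, hc⟩ := exists_rieszSymbol_eq_average
  refine ⟨c, fun i k f hf x => ?_⟩
  have hsw := integral_integral_swap (f := fun (ξ : E3) (ω : E3 × E3) =>
    ((ω.1 i * ω.2 k * pairSign ω ξ : ℝ) : ℂ) * ((𝐞 (inner ℝ ξ x) : ℂ) * f ξ))
    (integrable_pairSign_mul hf i k x)
  calc (𝓕⁻ (fun ξ => (rieszSymbol i k ξ : ℂ) * f ξ)) x
      = ∫ ξ, (c : ℂ) * ∫ ω, ((ω.1 i * ω.2 k * pairSign ω ξ : ℝ) : ℂ)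
          * ((𝐞 (inner ℝ ξ x) : ℂ) * f ξ) ∂pairMeasure := by
        rw [Real.fourierInv_eq]
        congr 1; ext ξ
        rw [integral_mul_const, integral_complex_ofReal, hc, Circle.smul_def, smul_eq_mul]
        have : (fun ω : E3 × E3 => ω.1 i * dirSign ω.1 ξ * (ω.2 k * dirSign ω.2 ξ))
            = fun ω => ω.1 i * ω.2 k * pairSign ω ξ := by
          ext ω; rw [pairSign]; ring
        rw [this]; push_cast; ring
    _ = c * ∫ ω, ∫ ξ, ((ω.1 i * ω.2 k * pairSign ω ξ : ℝ) : ℂ)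
          * ((𝐞 (inner ℝ ξ x) : ℂ) * f ξ) ∂volume ∂pairMeasure := by
        rw [integral_const_mul, hsw]
    _ = _ := by
        congr 2; ext ω
        rw [Real.fourierInv_eq, ← integral_const_mul]
        congr 1; ext ξ
        simp only [Circle.smul_def, smul_eq_mul]
        push_cast; ring

theorem lintegral_pow_four_le {α : Type*} [MeasurableSpace α] (μ : Measure α) {f : α → ℝ≥0∞}
    (hf : AEMeasurable f μ) :
    (∫⁻ a, f a ∂μ) ^ 4 ≤ μ Set.univ ^ 3 * ∫⁻ a, f a ^ 4 ∂μ := by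
  have h := ENNReal.lintegral_mul_le_Lp_mul_Lq μ (p := 4) (q := 4 / 3)
    (by constructor <;> norm_num) hf (aemeasurable_const (b := (1 : ℝ≥0∞)))
  simp only [Pi.mul_apply, mul_one, ENNReal.one_rpow, lintegral_const, one_mul] at h
  have h4 := pow_le_pow_left₀ bot_le h 4
  refine h4.trans_eq ?_
  rw [mul_pow, mul_comm]
  congr 1
  · rw [← ENNReal.rpow_natCast, ← ENNReal.rpow_mul, ← ENNReal.rpow_natCast]; norm_num
  · rw [← ENNReal.rpow_natCast, ← ENNReal.rpow_mul]; norm_num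

/-- `L⁴` bound for double Riesz transforms. -/
theorem exists_riesz_four : ∃ C : ℝ≥0, ∀ (i k : Fin 3) (f : E3 → ℂ), HermNice f → Continuous f →
    ∫⁻ x, ‖(𝓕⁻ (fun ξ => (rieszSymbol i k ξ : ℂ) * f ξ)) x‖ₑ ^ 4
      ≤ C * ∫⁻ x, ‖(𝓕⁻ f) x‖ₑ ^ 4 := by
  obtain ⟨c, hc⟩ := exists_fourierInv_riesz_eq_average
  set V : ℝ≥0∞ := pairMeasure Set.univ with hV
  have hVt : V ≠ ∞ := measure_ne_top _ _
  refine ⟨(‖(c : ℂ)‖ₑ ^ 4 * V ^ 3 * (1296 * V)).toNNReal, fun i k f hf hfc => ?_⟩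
  have hfin : ‖(c : ℂ)‖ₑ ^ 4 * V ^ 3 * (1296 * V) ≠ ∞ := by
    refine ENNReal.mul_ne_top (ENNReal.mul_ne_top (ENNReal.pow_ne_top enorm_ne_top)
      (ENNReal.pow_ne_top hVt)) (ENNReal.mul_ne_top (by norm_num) hVt)
  rw [ENNReal.coe_toNNReal hfin]
  have hmeas : Measurable (fun p : E3 × (E3 × E3) =>
      (𝓕⁻ (fun ξ => (pairSign p.2 ξ : ℂ) * f ξ)) p.1) := by
    simp only [Real.fourierInv_eq]
    refine (StronglyMeasurable.integral_prod_right
      (f := fun (p : E3 × (E3 × E3)) ξ => 𝐞 (inner ℝ ξ p.1) • ((pairSign p.2 ξ : ℂ) * f ξ))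
      (Measurable.stronglyMeasurable ?_)).measurable
    simp only [Function.uncurry_def, Circle.smul_def, smul_eq_mul]
    have h1 : Measurable (fun q : (E3 × (E3 × E3)) × E3 => pairSign q.1.2 q.2) :=
      measurable_pairSign.comp (f := fun q : (E3 × (E3 × E3)) × E3 => (q.2, q.1.2)) (by fun_prop)
    have h2 : Continuous (fun q : (E3 × (E3 × E3)) × E3 => ((𝐞 (inner ℝ q.2 q.1.1) : Circle) : ℂ)) :=
      continuous_subtype_val.comp (Real.continuous_fourierChar.comp (by fun_prop))
    exact h2.measurable.mul ((Complex.measurable_ofReal.comp h1).mul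
      (hfc.measurable.comp measurable_snd))
  have hpt : ∀ x, ‖(𝓕⁻ (fun ξ => (rieszSymbol i k ξ : ℂ) * f ξ)) x‖ₑ ^ 4
      ≤ ‖(c : ℂ)‖ₑ ^ 4 * V ^ 3 *
        ∫⁻ ω, ‖(𝓕⁻ (fun ξ => (pairSign ω ξ : ℂ) * f ξ)) x‖ₑ ^ 4 ∂pairMeasure := by
    intro x
    rw [hc i k f hf.int x, enorm_mul, mul_pow, mul_assoc]
    gcongr
    have hm1 : AEMeasurable (fun ω => ‖(𝓕⁻ (fun ξ => (pairSign ω ξ : ℂ) * f ξ)) x‖ₑ) pairMeasure :=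
      ((hmeas.comp (measurable_prodMk_left (x := x))).enorm).aemeasurable
    refine le_trans ?_ (lintegral_pow_four_le pairMeasure hm1)
    gcongr
    refine (enorm_integral_le_lintegral_enorm _).trans (lintegral_mono_ae ?_)
    filter_upwards [ae_pairMeasure_bound i k] with ω hω
    rw [enorm_mul]
    refine mul_le_of_le_one_left bot_le ?_
    rw [← ofReal_norm, Complex.norm_real, Real.norm_eq_abs, abs_mul]
    exact ENNReal.ofReal_le_one.2 (mul_le_one₀ hω.1 (abs_nonneg _) hω.2)
  calc _ ≤ ∫⁻ x, ‖(c : ℂ)‖ₑ ^ 4 * V ^ 3 *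
        ∫⁻ ω, ‖(𝓕⁻ (fun ξ => (pairSign ω ξ : ℂ) * f ξ)) x‖ₑ ^ 4 ∂pairMeasure := lintegral_mono hpt
    _ = ‖(c : ℂ)‖ₑ ^ 4 * V ^ 3 * ∫⁻ x,
        ∫⁻ ω, ‖(𝓕⁻ (fun ξ => (pairSign ω ξ : ℂ) * f ξ)) x‖ₑ ^ 4 ∂pairMeasure := by
        rw [lintegral_const_mul' _ _ (ENNReal.mul_ne_top (ENNReal.pow_ne_top enorm_ne_top)
          (ENNReal.pow_ne_top hVt))]
    _ = ‖(c : ℂ)‖ₑ ^ 4 * V ^ 3 * ∫⁻ ω,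
        ∫⁻ x, ‖(𝓕⁻ (fun ξ => (pairSign ω ξ : ℂ) * f ξ)) x‖ₑ ^ 4 ∂volume ∂pairMeasure := by
        rw [lintegral_lintegral_swap]
        exact (hmeas.enorm.pow_const 4).aemeasurable
    _ ≤ ‖(c : ℂ)‖ₑ ^ 4 * V ^ 3 * ∫⁻ _, 1296 * ∫⁻ x, ‖(𝓕⁻ f) x‖ₑ ^ 4 ∂volume ∂pairMeasure := by
        gcongr with ω
        exact hf.pairSign_four ω
    _ = _ := by rw [lintegral_const, ← hV]; ring

theorem lintegral_Ioi_indicator_lt (a : ℝ) (c : ℝ≥0∞) :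
    ∫⁻ t in Set.Ioi (0 : ℝ), (if t < a then c else 0) = c * ENNReal.ofReal a := by
  have : (fun t : ℝ => if t < a then c else 0) = (Set.Iio a).indicator (fun _ => c) := by
    ext t; simp [Set.indicator_apply]
  rw [this, lintegral_indicator measurableSet_Iio, lintegral_const,
    Measure.restrict_restrict measurableSet_Iio, Measure.restrict_apply_univ, Set.inter_comm,
    Set.Ioi_inter_Iio, Real.volume_Ioo, sub_zero]

theorem lintegral_Ioi_rpow_neg_two {a : ℝ} (ha : 0 < a) :
    ∫⁻ t in Set.Ioi a, ENNReal.ofReal (t ^ (-2 : ℝ)) = ENNReal.ofReal a⁻¹ := by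
  rw [← ofReal_integral_eq_lintegral_ofReal (integrableOn_Ioi_rpow_of_lt (by norm_num) ha),
    integral_Ioi_rpow_of_lt (by norm_num) ha]
  · congr 1
    rw [show (-2 : ℝ) + 1 = -1 by norm_num, Real.rpow_neg_one]; field_simp
  · filter_upwards [ae_restrict_mem measurableSet_Ioi] with t ht
    exact Real.rpow_nonneg (ha.trans ht).le _

theorem lintegral_Ioi_tail (a : ℝ) :
    ∫⁻ t in Set.Ioi (0 : ℝ), (if |a| < 2 * t then ‖a‖ₑ ^ 4 * ENNReal.ofReal (t ^ (-2 : ℝ)) else 0)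
      ≤ 2 * ‖a‖ₑ ^ 3 := by
  rcases eq_or_ne a 0 with rfl | ha
  · simp
  have hpos : 0 < |a| / 2 := by positivity
  have : (fun t : ℝ => if |a| < 2 * t then ‖a‖ₑ ^ 4 * ENNReal.ofReal (t ^ (-2 : ℝ)) else 0)
      = (Set.Ioi (|a| / 2)).indicator
        (fun t => ‖a‖ₑ ^ 4 * ENNReal.ofReal (t ^ (-2 : ℝ))) := by
    ext t
    simp only [Set.indicator_apply, Set.mem_Ioi, div_lt_iff₀ (two_pos : (0 : ℝ) < 2), mul_comm t]
  rw [this, lintegral_indicator measurableSet_Ioi, Measure.restrict_restrict measurableSet_Ioi,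
    Set.inter_eq_left.2 (Set.Ioi_subset_Ioi hpos.le),
    lintegral_const_mul' _ _ (ENNReal.pow_ne_top enorm_ne_top), lintegral_Ioi_rpow_neg_two hpos,
    Real.enorm_eq_ofReal_abs, ← ENNReal.ofReal_pow (abs_nonneg _), ← ENNReal.ofReal_pow
      (abs_nonneg _), ← ENNReal.ofReal_mul (by positivity), show (2 : ℝ≥0∞) = ENNReal.ofReal 2 by
      simp, ← ENNReal.ofReal_mul (by positivity)]
  apply le_of_eq; congr 1
  field_simp

/-- Integration of truncated weak-type estimates between exponents two and four. -/
theorem lintegral_cube_le_of_weak {f g : E3 → ℝ} (hf : Measurable f) (hg : Measurable g)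
    (A B : ℝ≥0∞) (hA : A ≠ ∞) (hB : B ≠ ∞)
    (h : ∀ t : ℝ, 0 < t → volume {x | t < |f x|} * ENNReal.ofReal (t ^ (2 : ℝ)) ≤
      A * (∫⁻ x, if t < |g x| then ‖g x‖ₑ ^ 2 else 0) +
      B * ∫⁻ x, if |g x| < 2 * t then ‖g x‖ₑ ^ 4 * ENNReal.ofReal (t ^ (-2 : ℝ)) else 0) :
    ∫⁻ x, ‖f x‖ₑ ^ 3 ≤ 3 * (A + 2 * B) * ∫⁻ x, ‖g x‖ₑ ^ 3 := by
  have key := lintegral_rpow_eq_lintegral_meas_lt_mul (volume : Measure E3) (f := fun x => |f x|)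
    (Eventually.of_forall fun x => abs_nonneg _) hf.norm.aemeasurable
    (p := 3) (by norm_num)
  have h3 : ∀ x, ENNReal.ofReal (|f x| ^ (3 : ℝ)) = ‖f x‖ₑ ^ 3 := fun x => by
    rw [Real.enorm_eq_ofReal_abs, ← ENNReal.ofReal_pow (abs_nonneg _)]; norm_cast
  simp only [h3] at key
  rw [key, ENNReal.ofReal_ofNat, mul_assoc]
  gcongr
  have hm1 : Measurable (fun p : ℝ × E3 => if p.1 < |g p.2| then ‖g p.2‖ₑ ^ 2 else 0) := by
    refine Measurable.ite ?_ (by fun_prop) measurable_const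
    exact measurableSet_lt measurable_fst (hg.comp measurable_snd).norm
  have hm2 : Measurable (fun p : ℝ × E3 => if |g p.2| < 2 * p.1 then
      ‖g p.2‖ₑ ^ 4 * ENNReal.ofReal (p.1 ^ (-2 : ℝ)) else 0) := by
    refine Measurable.ite ?_ (by fun_prop) measurable_const
    exact measurableSet_lt (hg.comp measurable_snd).norm (by fun_prop)
  calc _ ≤ ∫⁻ t in Set.Ioi (0 : ℝ), (A * (∫⁻ x, if t < |g x| then ‖g x‖ₑ ^ 2 else 0) +
      B * ∫⁻ x, if |g x| < 2 * t then ‖g x‖ₑ ^ 4 * ENNReal.ofReal (t ^ (-2 : ℝ)) else 0) := by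
        refine setLIntegral_mono' measurableSet_Ioi fun t ht => ?_
        convert h t ht using 4
        norm_num
    _ = A * (∫⁻ t in Set.Ioi (0 : ℝ), ∫⁻ x, if t < |g x| then ‖g x‖ₑ ^ 2 else 0) +
      B * ∫⁻ t in Set.Ioi (0 : ℝ), ∫⁻ x, if |g x| < 2 * t then
        ‖g x‖ₑ ^ 4 * ENNReal.ofReal (t ^ (-2 : ℝ)) else 0 := by
        rw [lintegral_add_left, lintegral_const_mul' _ _ hA, lintegral_const_mul' _ _ hB]
        exact (hm1.lintegral_prod_right').const_mul _
    _ = A * (∫⁻ x, ∫⁻ t in Set.Ioi (0 : ℝ), if t < |g x| then ‖g x‖ₑ ^ 2 else 0) +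
      B * ∫⁻ x, ∫⁻ t in Set.Ioi (0 : ℝ), if |g x| < 2 * t then
        ‖g x‖ₑ ^ 4 * ENNReal.ofReal (t ^ (-2 : ℝ)) else 0 := by
        congr 2
        · exact lintegral_lintegral_swap hm1.aemeasurable
        · exact lintegral_lintegral_swap hm2.aemeasurable
    _ ≤ A * (∫⁻ x, ‖g x‖ₑ ^ 3) + B * ∫⁻ x, 2 * ‖g x‖ₑ ^ 3 := by
        gcongr with x x
        · rw [lintegral_Ioi_indicator_lt, ← Real.enorm_eq_ofReal_abs, ← pow_succ]
        · exact lintegral_Ioi_tail _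
    _ = _ := by
        rw [lintegral_const_mul' _ _ (by norm_num)]; ring

/-- Smoothness of a scalar field. -/
abbrev Sm (f : E3 → ℝ) : Prop := ContDiff ℝ (⊤ : ℕ∞) f

/-- Smooth compactly supported test functions. -/
structure TestFn (g : E3 → ℝ) : Prop where
  smooth : Sm g
  supp : HasCompactSupport g

/-- A test function as a complex Schwartz function. -/
def TestFn.toSchwartz {g : E3 → ℝ} (hg : TestFn g) : SchwartzMap E3 ℂ :=
  (hg.supp.comp_left (g := ((↑) : ℝ → ℂ)) Complex.ofReal_zero).toSchwartzMap
    (Complex.ofRealCLM.contDiff.comp hg.smooth)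

theorem TestFn.toSchwartz_coe {g : E3 → ℝ} (hg : TestFn g) :
    (hg.toSchwartz : E3 → ℂ) = fun x => (g x : ℂ) := rfl

theorem TestFn.hermNice {g : E3 → ℝ} (hg : TestFn g) : HermNice (𝓕 (fun x => (g x : ℂ))) := by
  rw [← hg.toSchwartz_coe, ← SchwartzMap.fourier_coe]
  refine ⟨SchwartzMap.integrable _, SchwartzMap.memLp _ 2 _, fun ξ => ?_⟩
  rw [SchwartzMap.fourier_coe, hg.toSchwartz_coe, Real.fourier_eq, Real.fourier_eq,
    ← integral_conj]
  congr 1; ext x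
  simp [Circle.smul_def, ← Circle.coe_inv_eq_conj, ← AddChar.map_neg_eq_inv]

theorem TestFn.continuous_fourier {g : E3 → ℝ} (hg : TestFn g) :
    Continuous (𝓕 (fun x => (g x : ℂ))) := by
  rw [← hg.toSchwartz_coe, ← SchwartzMap.fourier_coe]; exact SchwartzMap.continuous _

theorem TestFn.fourierInv_fourier {g : E3 → ℝ} (hg : TestFn g) :
    𝓕⁻ (𝓕 (fun x => (g x : ℂ))) = fun x => (g x : ℂ) := by
  rw [← hg.toSchwartz_coe, ← SchwartzMap.fourier_coe, ← SchwartzMap.fourierInv_coe,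
    FourierTransform.fourierInv_fourier_eq]

theorem TestFn.add {g h : E3 → ℝ} (hg : TestFn g) (hh : TestFn h) : TestFn (fun x => g x + h x) :=
  ⟨hg.smooth.add hh.smooth, hg.supp.add hh.supp⟩

theorem TestFn.sub {g h : E3 → ℝ} (hg : TestFn g) (hh : TestFn h) : TestFn (fun x => g x - h x) :=
  ⟨hg.smooth.sub hh.smooth, hg.supp.sub hh.supp⟩

theorem TestFn.integrable {g : E3 → ℝ} (hg : TestFn g) : Integrable g :=
  hg.smooth.continuous.integrable_of_hasCompactSupport hg.supp

/-- The double Riesz transform of a test function. -/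
def riesz (i k : Fin 3) (g : E3 → ℝ) : E3 → ℂ :=
  𝓕⁻ (fun ξ => (rieszSymbol i k ξ : ℂ) * 𝓕 (fun x => (g x : ℂ)) ξ)

theorem riesz_add (i k : Fin 3) {g h : E3 → ℝ} (hg : TestFn g) (hh : TestFn h) (x : E3) :
    riesz i k (fun x => g x + h x) x = riesz i k g x + riesz i k h x := by
  have e : ∀ ξ, 𝓕 (fun x => ((g x + h x : ℝ) : ℂ)) ξ =
      𝓕 (fun x => (g x : ℂ)) ξ + 𝓕 (fun x => (h x : ℂ)) ξ := fun ξ => by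
    rw [Real.fourier_eq, Real.fourier_eq, Real.fourier_eq, ← integral_add]
    · simp only [Complex.ofReal_add, smul_add]
    · exact (Real.fourierIntegral_convergent_iff ξ).2 hg.integrable.ofReal
    · exact (Real.fourierIntegral_convergent_iff ξ).2 hh.integrable.ofReal
  simp only [riesz, e, mul_add, Real.fourierInv_eq]
  rw [← integral_add]
  · simp only [smul_add]
  · exact integrable_char_mul (hg.hermNice.riesz i k).int x
  · exact integrable_char_mul (hh.hermNice.riesz i k).int x

theorem lintegral_riesz_sq (i k : Fin 3) {g : E3 → ℝ} (hg : TestFn g) :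
    ∫⁻ x, ‖riesz i k g x‖ₑ ^ 2 ≤ ∫⁻ x, ‖g x‖ₑ ^ 2 := by
  have hR := hg.hermNice.riesz i k
  have e1 : eLpNorm (riesz i k g) 2 ≤ eLpNorm (fun x => (g x : ℂ)) 2 := by
    rw [riesz, eLpNorm_fourierInv hR.int hR.sq, ← hg.fourierInv_fourier,
      eLpNorm_fourierInv hg.hermNice.int hg.hermNice.sq, hg.fourierInv_fourier]
    refine eLpNorm_mono fun ξ => ?_
    rw [norm_mul, Complex.norm_real]
    exact mul_le_of_le_one_left (norm_nonneg _) (abs_rieszSymbol_le i k ξ)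
  have hk : ∀ F : E3 → ℂ, ∫⁻ x, ‖F x‖ₑ ^ 2 = eLpNorm F 2 ^ 2 := fun F => by
    rw [eLpNorm_eq_lintegral_rpow_enorm_toReal (by norm_num) (by norm_num), ← ENNReal.rpow_natCast,
      ← ENNReal.rpow_mul]
    norm_num
  have hgC : ∀ x, ‖g x‖ₑ = ‖(g x : ℂ)‖ₑ := fun x => by
    rw [← ofReal_norm, ← ofReal_norm, Complex.norm_real]
  simp only [hgC, hk]
  gcongr

theorem exists_lintegral_riesz_four : ∃ C : ℝ≥0, ∀ (i k : Fin 3) (g : E3 → ℝ), TestFn g →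
    ∫⁻ x, ‖riesz i k g x‖ₑ ^ 4 ≤ C * ∫⁻ x, ‖g x‖ₑ ^ 4 := by
  obtain ⟨C, hC⟩ := exists_riesz_four
  refine ⟨C, fun i k g hg => ?_⟩
  have hgC : ∀ x, ‖g x‖ₑ = ‖(g x : ℂ)‖ₑ := fun x => by
    rw [← ofReal_norm, ← ofReal_norm, Complex.norm_real]
  have := hC i k _ hg.hermNice hg.continuous_fourier
  rw [hg.fourierInv_fourier] at this
  simpa only [hgC, riesz] using this

theorem TestFn.mul_left {b g : E3 → ℝ} (hg : TestFn g) (hb : ContDiff ℝ (⊤ : ℕ∞) b) :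
    TestFn (fun x => b x * g x) :=
  ⟨hb.mul hg.smooth, hg.supp.mul_left⟩

theorem meas_lt_le_of_pow {h : E3 → ℂ} (hh : Measurable h) {t : ℝ} (ht : 0 < t) (n : ℕ) :
    volume {x | t < ‖h x‖} * ENNReal.ofReal (t ^ n) ≤ ∫⁻ x, ‖h x‖ₑ ^ n := by
  refine le_trans ?_ (mul_meas_ge_le_lintegral (hh.enorm.pow_const n) (ENNReal.ofReal (t ^ n)))
  rw [mul_comm]
  gcongr
  intro hx
  rw [← ofReal_norm, ENNReal.ofReal_pow ht.le]
  gcongr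

theorem continuous_riesz (i k : Fin 3) {g : E3 → ℝ} (hg : TestFn g) : Continuous (riesz i k g) :=
  continuous_fourierInv (hg.hermNice.riesz i k).int

theorem riesz_re (i k : Fin 3) {g : E3 → ℝ} (hg : TestFn g) (x : E3) :
    ((riesz i k g x).re : ℂ) = riesz i k g x := (hg.hermNice.riesz i k).real x

theorem riesz_weak {i k : Fin 3} {C : ℝ≥0} (hC : ∀ (g : E3 → ℝ), TestFn g →
    ∫⁻ x, ‖riesz i k g x‖ₑ ^ 4 ≤ C * ∫⁻ x, ‖g x‖ₑ ^ 4) {g : E3 → ℝ} (hg : TestFn g)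
    {t : ℝ} (ht : 0 < t) :
    volume {x | t < ‖riesz i k g x‖} * ENNReal.ofReal (t ^ (2 : ℝ)) ≤
      4 * (∫⁻ x, if t < |g x| then ‖g x‖ₑ ^ 2 else 0) +
      (16 * C) * ∫⁻ x, if |g x| < 2 * t then ‖g x‖ₑ ^ 4 * ENNReal.ofReal (t ^ (-2 : ℝ)) else 0 := by
  let b : ContDiffBump (0 : ℝ) := ⟨1, 2, one_pos, one_lt_two⟩
  have hbs : ContDiff ℝ (⊤ : ℕ∞) (fun x => b (g x / t)) := b.contDiff.comp (hg.smooth.div_const t)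
  have h2 : TestFn (fun x => b (g x / t) * g x) := hg.mul_left hbs
  have h1 : TestFn (fun x => (1 - b (g x / t)) * g x) := hg.mul_left (contDiff_const.sub hbs)
  set g1 := fun x => (1 - b (g x / t)) * g x with hg1
  set g2 := fun x => b (g x / t) * g x with hg2
  have hsum : g = fun x => g1 x + g2 x := by ext x; simp only [hg1, hg2]; ring
  have hsub : {x | t < ‖riesz i k g x‖} ⊆
      {x | t / 2 < ‖riesz i k g1 x‖} ∪ {x | t / 2 < ‖riesz i k g2 x‖} := by
    intro x hx
    by_contra hcon
    simp only [Set.mem_union, Set.mem_ofPred_eq, not_or, not_lt] at hx hcon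
    have e := riesz_add i k h1 h2 x
    rw [← hsum] at e
    rw [e] at hx
    linarith [norm_add_le (riesz i k g1 x) (riesz i k g2 x)]
  have hm1 := meas_lt_le_of_pow (continuous_riesz i k h1).measurable (half_pos ht) 2
  have hm2 := meas_lt_le_of_pow (continuous_riesz i k h2).measurable (half_pos ht) 4
  have b1 : ∫⁻ x, ‖g1 x‖ₑ ^ 2 ≤ ∫⁻ x, if t < |g x| then ‖g x‖ₑ ^ 2 else 0 := by
    refine lintegral_mono fun x => ?_
    split_ifs with hx
    · gcongr
      rw [enorm_le_iff_norm_le, hg1]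
      simp only [norm_mul, Real.norm_eq_abs]
      refine mul_le_of_le_one_left (abs_nonneg _) ?_
      rw [abs_le]; constructor <;> linarith [b.nonneg (x := g x / t), b.le_one (x := g x / t)]
    · have : b (g x / t) = 1 := by
        apply b.one_of_mem_closedBall
        rw [mem_closedBall_zero_iff, Real.norm_eq_abs, abs_div, abs_of_pos ht, div_le_iff₀ ht]
        simpa [b] using not_lt.1 hx
      simp [hg1, this]
  have b2 : ∫⁻ x, ‖g2 x‖ₑ ^ 4 ≤ ∫⁻ x, if |g x| < 2 * t then ‖g x‖ₑ ^ 4 else 0 := by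
    refine lintegral_mono fun x => ?_
    split_ifs with hx
    · gcongr
      rw [enorm_le_iff_norm_le, hg2]
      simp only [norm_mul, Real.norm_eq_abs]
      refine mul_le_of_le_one_left (abs_nonneg _) ?_
      rw [abs_of_nonneg b.nonneg]; exact b.le_one
    · have : b (g x / t) = 0 := by
        apply b.zero_of_le_dist
        rw [dist_zero_right, Real.norm_eq_abs, abs_div, abs_of_pos ht, le_div_iff₀ ht]
        simpa [b] using not_lt.1 hx
      simp [hg2, this]
  have e1 : ENNReal.ofReal (t ^ (2 : ℝ)) = 4 * ENNReal.ofReal ((t / 2) ^ 2) := by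
    rw [show (4 : ℝ≥0∞) = ENNReal.ofReal 4 by simp, ← ENNReal.ofReal_mul (by norm_num)]
    congr 1; norm_cast; ring
  have e2 : ENNReal.ofReal (t ^ (2 : ℝ)) =
      16 * ENNReal.ofReal ((t / 2) ^ 4) * ENNReal.ofReal (t ^ (-2 : ℝ)) := by
    rw [show (16 : ℝ≥0∞) = ENNReal.ofReal 16 by simp, ← ENNReal.ofReal_mul (by norm_num),
      ← ENNReal.ofReal_mul (by positivity)]
    congr 1
    rw [Real.rpow_neg ht.le]
    norm_cast
    field_simp
    norm_num
  calc _ ≤ (volume {x | t / 2 < ‖riesz i k g1 x‖} + volume {x | t / 2 < ‖riesz i k g2 x‖}) *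
        ENNReal.ofReal (t ^ (2 : ℝ)) := by
        gcongr; exact (measure_mono hsub).trans (measure_union_le _ _)
    _ = 4 * (volume {x | t / 2 < ‖riesz i k g1 x‖} * ENNReal.ofReal ((t / 2) ^ 2)) +
        16 * (volume {x | t / 2 < ‖riesz i k g2 x‖} * ENNReal.ofReal ((t / 2) ^ 4)) *
          ENNReal.ofReal (t ^ (-2 : ℝ)) := by
        rw [add_mul]; nth_rw 1 [e1]; rw [e2]; ring
    _ ≤ 4 * (∫⁻ x, if t < |g x| then ‖g x‖ₑ ^ 2 else 0) +
        16 * (C * ∫⁻ x, if |g x| < 2 * t then ‖g x‖ₑ ^ 4 else 0) *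
          ENNReal.ofReal (t ^ (-2 : ℝ)) := by
        refine add_le_add ?_ ?_
        · gcongr
          exact hm1.trans ((lintegral_riesz_sq i k h1).trans b1)
        · have := hm2.trans ((hC _ h2).trans (mul_le_mul_right b2 (C : ℝ≥0∞)))
          gcongr 16 * ?_ * _
    _ = _ := by
        congr 1
        rw [mul_assoc, mul_assoc, mul_assoc, ← lintegral_mul_const' _ _ ENNReal.ofReal_ne_top]
        simp only [ite_mul, zero_mul]

/-- `L³` bound for double Riesz transforms of test functions. -/
theorem exists_lintegral_riesz_cube : ∃ C : ℝ≥0, ∀ (i k : Fin 3) (g : E3 → ℝ), TestFn g →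
    ∫⁻ x, ‖riesz i k g x‖ₑ ^ 3 ≤ C * ∫⁻ x, ‖g x‖ₑ ^ 3 := by
  obtain ⟨C, hC⟩ := exists_lintegral_riesz_four
  refine ⟨3 * (4 + 2 * (16 * C)), fun i k g hg => ?_⟩
  have hn : ∀ x, ‖riesz i k g x‖ = |(riesz i k g x).re| := fun x => by
    rw [← Real.norm_eq_abs, ← Complex.norm_real, riesz_re i k hg]
  have := lintegral_cube_le_of_weak (f := fun x => (riesz i k g x).re) (g := g)
    (Complex.measurable_re.comp (continuous_riesz i k hg).measurable) hg.smooth.continuous.measurable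
    4 (16 * C) (by norm_num) (by finiteness) (fun t ht => by
      have := riesz_weak (fun g hg => hC i k g hg) hg ht
      simpa only [hn] using this)
  have hn' : ∀ x, ‖riesz i k g x‖ₑ = ‖(riesz i k g x).re‖ₑ := fun x => by
    rw [← ofReal_norm, ← ofReal_norm, hn, Real.norm_eq_abs]
  simp only [hn']
  refine this.trans_eq ?_
  push_cast; rfl

theorem Sm.pd {f : E3 → ℝ} (hf : Sm f) (j : Fin 3) : Sm (pd j f) :=
  (hf.fderiv_right (m := (⊤ : ℕ∞)) (by norm_cast)).clm_apply contDiff_const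

theorem Sm.diff {f : E3 → ℝ} (hf : Sm f) : Differentiable ℝ f := hf.differentiable (by simp)

theorem Sm.lap {f : E3 → ℝ} (hf : Sm f) : Sm (lap f) :=
  ContDiff.sum fun j _ => (hf.pd j).pd j

theorem pd_const (j : Fin 3) (c : ℝ) (x : E3) : pd j (fun _ => c) x = 0 := by simp [pd]

theorem pd_add {f g : E3 → ℝ} (hf : Sm f) (hg : Sm g) (j : Fin 3) (x : E3) :
    pd j (fun y => f y + g y) x = pd j f x + pd j g x := by
  simp only [pd]; rw [fderiv_fun_add hf.diff.differentiableAt hg.diff.differentiableAt]; rfl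

theorem pd_mul {f g : E3 → ℝ} (hf : Sm f) (hg : Sm g) (j : Fin 3) (x : E3) :
    pd j (fun y => f y * g y) x = f x * pd j g x + g x * pd j f x := by
  simp only [pd]; rw [fderiv_fun_mul hf.diff.differentiableAt hg.diff.differentiableAt]; rfl

theorem pd_const_mul {f : E3 → ℝ} (hf : Sm f) (c : ℝ) (j : Fin 3) (x : E3) :
    pd j (fun y => c * f y) x = c * pd j f x := by
  rw [pd_mul contDiff_const hf, pd_const]; ring

theorem pd_sum {ι : Type*} (s : Finset ι) {f : ι → E3 → ℝ} (hf : ∀ a ∈ s, Sm (f a)) (j : Fin 3)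
    (x : E3) : pd j (fun y => ∑ a ∈ s, f a y) x = ∑ a ∈ s, pd j (f a) x := by
  simp only [pd]
  rw [fderiv_fun_sum fun a ha => (hf a ha).diff.differentiableAt]
  simp

theorem pd_comm {f : E3 → ℝ} (hf : Sm f) (i j : Fin 3) (x : E3) :
    pd i (pd j f) x = pd j (pd i f) x := by
  have hs : IsSymmSndFDerivAt ℝ f x :=
    hf.contDiffAt.isSymmSndFDerivAt (by simp; exact WithTop.coe_le_coe.2 le_top)
  have hd : DifferentiableAt ℝ (fderiv ℝ f) x :=
    (hf.fderiv_right (m := 1) (by norm_cast)).differentiable (by simp) x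
  have e : ∀ v w : E3, fderiv ℝ (fun y => fderiv ℝ f y v) x w = fderiv ℝ (fderiv ℝ f) x w v :=
    fun v w => by
      rw [fderiv_clm_apply hd (differentiableAt_const v)]; simp
  change fderiv ℝ (fun y => fderiv ℝ f y _) x _ = fderiv ℝ (fun y => fderiv ℝ f y _) x _
  rw [e, e]
  exact hs.eq _ _

theorem TestFn.pd {f : E3 → ℝ} (hf : TestFn f) (j : Fin 3) : TestFn (pd j f) :=
  ⟨hf.smooth.pd j, hf.supp.fderiv_apply (𝕜 := ℝ) _⟩

theorem TestFn.sum {ι : Type*} (s : Finset ι) {f : ι → E3 → ℝ} (hf : ∀ a ∈ s, TestFn (f a)) :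
    TestFn (fun y => ∑ a ∈ s, f a y) := by
  classical
  induction s using Finset.induction_on with
  | empty => simpa using ⟨contDiff_const, HasCompactSupport.zero⟩
  | insert a s ha ih =>
    simp only [Finset.sum_insert ha]
    exact (hf a (by simp)).add (ih fun b hb => hf b (by simp [hb]))

theorem TestFn.lap {f : E3 → ℝ} (hf : TestFn f) : TestFn (lap f) :=
  TestFn.sum _ fun j _ => (hf.pd j).pd j

theorem TestFn.mul_right {b g : E3 → ℝ} (hg : TestFn g) (hb : Sm b) :
    TestFn (fun x => g x * b x) :=
  ⟨hg.smooth.mul hb, hg.supp.mul_right⟩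

/-- Integration by parts against a test function. -/
theorem integral_mul_pd {f g : E3 → ℝ} (hf : Sm f) (hg : TestFn g) (j : Fin 3) :
    ∫ x, f x * pd j g x = - ∫ x, pd j f x * g x := by
  have h1 : TestFn (fun x => g x * f x) := hg.mul_right hf
  have h := integral_mul_fderiv_eq_neg_fderiv_mul_of_integrable (μ := (volume : Measure E3))
    (f := f) (g := g) (v := EuclideanSpace.single j 1)
    ((hg.mul_left (hf.pd j)).integrable) (((hg.pd j).mul_left hf).integrable)
    ((hg.mul_left hf).integrable) (fun x _ => hf.diff x) (fun x _ => hg.smooth.diff x)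
  exact h

open LineDeriv in
theorem fourier_pd {g : E3 → ℝ} (hg : TestFn g) (j : Fin 3) (ξ : E3) :
    𝓕 (fun x => (pd j g x : ℂ)) ξ = (2 * π * Complex.I * ξ j) * 𝓕 (fun x => (g x : ℂ)) ξ := by
  have e : (hg.pd j).toSchwartz = ∂_{(EuclideanSpace.single j 1 : E3)} hg.toSchwartz := by
    ext x
    rw [SchwartzMap.lineDerivOp_apply_eq_fderiv, TestFn.toSchwartz_coe, TestFn.toSchwartz_coe]
    have := (Complex.ofRealCLM.hasFDerivAt.comp x
      (hg.smooth.diff.differentiableAt (x := x)).hasFDerivAt).fderiv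
    change _ = fderiv ℝ (Complex.ofRealCLM ∘ g) x _
    rw [this]; rfl
  have h := SchwartzMap.fourier_lineDerivOp_eq hg.toSchwartz (EuclideanSpace.single j (1 : ℝ) : E3)
  rw [← e] at h
  have hg' : (fun x : E3 => inner ℝ x (EuclideanSpace.single j (1 : ℝ) : E3)).HasTemperateGrowth := by
    fun_prop
  have h2 := congrArg (fun F : SchwartzMap E3 ℂ => F ξ) h
  simp only [smul_apply, SchwartzMap.smulLeftCLM_apply_apply hg'] at h2
  rw [SchwartzMap.fourier_coe, SchwartzMap.fourier_coe, TestFn.toSchwartz_coe,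
    TestFn.toSchwartz_coe] at h2
  rw [h2]
  simp [EuclideanSpace.inner_single_right]
  ring

theorem fourier_sum {ι : Type*} (s : Finset ι) {f : ι → E3 → ℝ} (hf : ∀ a ∈ s, TestFn (f a))
    (ξ : E3) : 𝓕 (fun x => ((∑ a ∈ s, f a x : ℝ) : ℂ)) ξ =
      ∑ a ∈ s, 𝓕 (fun x => (f a x : ℂ)) ξ := by
  simp only [Real.fourier_eq]
  rw [← integral_finsetSum]
  · simp only [Complex.ofReal_sum, Finset.smul_sum]
  · exact fun a ha => (Real.fourierIntegral_convergent_iff ξ).2 (hf a ha).integrable.ofReal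

theorem pd_pd_eq_riesz {M : E3 → ℝ} (hM : TestFn M) (i k : Fin 3) (x : E3) :
    (pd i (pd k M) x : ℂ) = riesz i k (lap M) x := by
  have h1 := congrFun ((hM.pd k).pd i).fourierInv_fourier x
  rw [← h1, riesz]
  refine congrFun (congrArg _ (funext fun ξ => ?_)) x
  rw [fourier_pd (hM.pd k), fourier_pd hM]
  unfold lap
  rw [fourier_sum _ fun j _ => (hM.pd j).pd j]
  simp only [fourier_pd (hM.pd _), fourier_pd hM, rieszSymbol]
  rcases eq_or_ne ξ 0 with rfl | hξ
  · simp
  have hn : ((‖ξ‖ : ℝ) : ℂ) ≠ 0 := by exact_mod_cast norm_ne_zero_iff.2 hξ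
  have hs : ((‖ξ‖ : ℝ) : ℂ) ^ 2 = ∑ j, (ξ j : ℂ) ^ 2 := by
    rw [← Complex.ofReal_pow, EuclideanSpace.real_norm_sq_eq]; push_cast; rfl
  simp only [Fin.sum_univ_three] at hs ⊢
  push_cast
  field_simp
  rw [hs]

/-- Calderón–Zygmund estimate in `L³`. -/
theorem exists_lintegral_hessian_cube : ∃ C : ℝ≥0, ∀ (i k : Fin 3) (M : E3 → ℝ), TestFn M →
    ∫⁻ x, ‖pd i (pd k M) x‖ₑ ^ 3 ≤ C * ∫⁻ x, ‖lap M x‖ₑ ^ 3 := by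
  obtain ⟨C, hC⟩ := exists_lintegral_riesz_cube
  refine ⟨C, fun i k M hM => ?_⟩
  refine le_of_eq_of_le (lintegral_congr fun x => ?_) (hC i k _ hM.lap)
  rw [← pd_pd_eq_riesz hM, ← ofReal_norm, ← ofReal_norm, Complex.norm_real]

theorem TestFn.bdd {g : E3 → ℝ} (hg : TestFn g) : ∃ C, ∀ x, |g x| ≤ C := by
  simpa using hg.supp.exists_bound_of_continuous hg.smooth.continuous

theorem TestFn.bdd_fderiv {g : E3 → ℝ} (hg : TestFn g) : ∃ C, ∀ x, ‖fderiv ℝ g x‖ ≤ C :=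
  (hg.supp.fderiv (𝕜 := ℝ)).exists_bound_of_continuous
    (hg.smooth.continuous_fderiv (by simp))

theorem TestFn.dir {g : E3 → ℝ} (hg : TestFn g) (v : E3) : TestFn (fun x => fderiv ℝ g x v) :=
  ⟨(hg.smooth.fderiv_right (m := (⊤ : ℕ∞)) (by norm_cast)).clm_apply contDiff_const,
    hg.supp.fderiv_apply (𝕜 := ℝ) _⟩

section WAvg

variable {Ω : Type*} [MeasurableSpace Ω] {μ : Measure Ω} {w : Ω → ℝ} {a : Ω → E3}

/-- Weighted average of translates of `g`. -/
def wavg (μ : Measure Ω) (w : Ω → ℝ) (a : Ω → E3) (g : E3 → ℝ) (x : E3) : ℝ :=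
  ∫ ω, w ω * g (x - a ω) ∂μ

theorem integrable_wavg (hw : Integrable w μ) (ha : AEStronglyMeasurable a μ) {g : E3 → ℝ}
    (hg : TestFn g) (x : E3) : Integrable (fun ω => w ω * g (x - a ω)) μ := by
  obtain ⟨C, hC⟩ := hg.bdd
  refine hw.mul_bdd (c := C) ?_ (Eventually.of_forall fun ω => hC _)
  exact hg.smooth.continuous.comp_aestronglyMeasurable (aestronglyMeasurable_const.sub ha)

theorem hasFDerivAt_wavg (hw : Integrable w μ) (ha : AEStronglyMeasurable a μ) {g : E3 → ℝ}
    (hg : TestFn g) (x : E3) :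
    Integrable (fun ω => w ω • fderiv ℝ g (x - a ω)) μ ∧
    HasFDerivAt (wavg μ w a g) (∫ ω, w ω • fderiv ℝ g (x - a ω) ∂μ) x := by
  obtain ⟨C, hC⟩ := hg.bdd_fderiv
  have hm : AEStronglyMeasurable (fun ω => w ω • fderiv ℝ g (x - a ω)) μ :=
    hw.1.smul ((hg.smooth.continuous_fderiv (by simp)).comp_aestronglyMeasurable
      (aestronglyMeasurable_const.sub ha))
  have hb : ∀ ω y, ‖w ω • fderiv ℝ g (y - a ω)‖ ≤ ‖w ω‖ * C := fun ω y => by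
    rw [norm_smul]; gcongr; exact hC _
  refine ⟨(hw.norm.mul_const C).mono' hm (Eventually.of_forall fun ω => hb ω x), ?_⟩
  refine hasFDerivAt_integral_of_dominated_of_fderiv_le (F' := fun y ω => w ω • fderiv ℝ g (y - a ω))
    (bound := fun ω => ‖w ω‖ * C) (s := Set.univ) univ_mem ?_ (integrable_wavg hw ha hg x) hm
    (Eventually.of_forall fun ω y _ => hb ω y) (hw.norm.mul_const C) ?_
  · exact Eventually.of_forall fun y => (integrable_wavg hw ha hg y).1
  · refine Eventually.of_forall fun ω y _ => ?_
    have h1 : HasFDerivAt (fun z => g (z - a ω)) (fderiv ℝ g (y - a ω)) y := by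
      simpa [Function.comp_def] using (hg.smooth.diff.differentiableAt (x := y - a ω)).hasFDerivAt.comp y
        ((hasFDerivAt_id y).sub_const (a ω))
    exact h1.const_mul (w ω)

theorem fderiv_wavg (hw : Integrable w μ) (ha : AEStronglyMeasurable a μ) {g : E3 → ℝ}
    (hg : TestFn g) (x v : E3) :
    fderiv ℝ (wavg μ w a g) x v = wavg μ w a (fun y => fderiv ℝ g y v) x := by
  obtain ⟨h1, h2⟩ := hasFDerivAt_wavg hw ha hg x
  rw [h2.fderiv, ContinuousLinearMap.integral_apply h1]
  rfl

theorem pd_wavg (hw : Integrable w μ) (ha : AEStronglyMeasurable a μ) {g : E3 → ℝ}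
    (hg : TestFn g) (j : Fin 3) (x : E3) :
    pd j (wavg μ w a g) x = wavg μ w a (pd j g) x := fderiv_wavg hw ha hg x _

theorem contDiff_wavg (hw : Integrable w μ) (ha : AEStronglyMeasurable a μ) {g : E3 → ℝ}
    (hg : TestFn g) : Sm (wavg μ w a g) := by
  rw [Sm, contDiff_infty]
  intro n
  induction n generalizing g with
  | zero =>
    rw [Nat.cast_zero, contDiff_zero, continuous_iff_continuousAt]
    exact fun x => (hasFDerivAt_wavg hw ha hg x).2.continuousAt
  | succ n ih =>
    rw [Nat.cast_succ, contDiff_succ_iff_fderiv_apply]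
    refine ⟨fun x => (hasFDerivAt_wavg hw ha hg x).2.differentiableAt, by simp, fun v => ?_⟩
    simp only [fderiv_wavg hw ha hg]
    exact ih (hg.dir v)

theorem wavg_eq_zero {R r : ℝ} (hr : ∀ ω, w ω ≠ 0 → ‖a ω‖ ≤ r) {g : E3 → ℝ}
    (hgR : ∀ x, R ≤ ‖x‖ → g x = 0) {x : E3} (hx : R + r ≤ ‖x‖) : wavg μ w a g x = 0 := by
  refine integral_eq_zero_of_ae (Eventually.of_forall fun ω => ?_)
  by_cases h : w ω = 0
  · simp [h]
  · have h1 := hr ω h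
    have h2 := norm_sub_norm_le x (a ω)
    simp [hgR (x - a ω) (by linarith)]

theorem hasCompactSupport_of_eq_zero {g : E3 → ℝ} {R : ℝ} (hgR : ∀ x, R ≤ ‖x‖ → g x = 0) :
    HasCompactSupport g := by
  refine HasCompactSupport.intro (isCompact_closedBall (0 : E3) R) fun x hx => hgR x ?_
  simp only [mem_closedBall_zero_iff, not_le] at hx
  exact hx.le

theorem testFn_wavg (hw : Integrable w μ) (ha : AEStronglyMeasurable a μ) {R r : ℝ}
    (hr : ∀ ω, w ω ≠ 0 → ‖a ω‖ ≤ r) {g : E3 → ℝ} (hg : TestFn g)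
    (hgR : ∀ x, R ≤ ‖x‖ → g x = 0) : TestFn (wavg μ w a g) :=
  ⟨contDiff_wavg hw ha hg, hasCompactSupport_of_eq_zero fun _ hx => wavg_eq_zero hr hgR hx⟩

theorem lap_wavg (hw : Integrable w μ) (ha : AEStronglyMeasurable a μ) {g : E3 → ℝ}
    (hg : TestFn g) (x : E3) : lap (wavg μ w a g) x = wavg μ w a (lap g) x := by
  have h1 : ∀ j, pd j (wavg μ w a g) = wavg μ w a (pd j g) := fun j =>
    funext fun y => pd_wavg hw ha hg j y
  rw [lap]
  simp only [h1, pd_wavg hw ha (hg.pd _)]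
  simp only [wavg, lap, Finset.mul_sum]
  rw [integral_finsetSum]
  exact fun j _ => integrable_wavg hw ha ((hg.pd j).pd j) x

end WAvg

/-- A nonnegative bump on the line supported in `[0,1]`. -/
def lineBump : ContDiffBump (1 / 2 : ℝ) := ⟨1 / 4, 1 / 2, by norm_num, by norm_num⟩

/-- Radial nonnegative kernel. -/
def psiK (y : E3) : ℝ := lineBump (‖y‖ ^ 2)

/-- Radial potential of `y ψ(y)`. -/
def phiK (y : E3) : ℝ := ((∫ t in (0 : ℝ)..‖y‖ ^ 2, lineBump t) - ∫ t in (0 : ℝ)..1, lineBump t) / 2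

theorem lineBump_eq_zero {t : ℝ} (ht : 1 ≤ t) : lineBump t = 0 := by
  apply lineBump.zero_of_le_dist
  rw [Real.dist_eq, abs_of_nonneg (by linarith)]
  simp only [lineBump]; linarith

theorem psiK_eq_zero {y : E3} (hy : 1 ≤ ‖y‖) : psiK y = 0 := lineBump_eq_zero (by nlinarith)

theorem psiK_nonneg (y : E3) : 0 ≤ psiK y := lineBump.nonneg

theorem testFn_psiK : TestFn psiK :=
  ⟨lineBump.contDiff.comp (contDiff_norm_sq ℝ), hasCompactSupport_of_eq_zero fun _ => psiK_eq_zero⟩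

theorem phiK_eq_zero {y : E3} (hy : 1 ≤ ‖y‖) : phiK y = 0 := by
  have h1 : ∫ t in (1 : ℝ)..‖y‖ ^ 2, lineBump t = 0 := by
    rw [intervalIntegral.integral_congr (g := fun _ => 0), intervalIntegral.integral_zero]
    intro t ht
    rw [Set.uIcc_of_le (by nlinarith)] at ht
    exact lineBump_eq_zero ht.1
  have h2 := intervalIntegral.integral_add_adjacent_intervals
    (lineBump.continuous.intervalIntegrable (μ := volume) 0 1)
    (lineBump.continuous.intervalIntegrable (μ := volume) 1 (‖y‖ ^ 2))
  rw [phiK, ← h2, h1]; ring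

theorem hasDerivAt_integral_lineBump (t : ℝ) :
    HasDerivAt (fun t => ∫ s in (0 : ℝ)..t, lineBump s) (lineBump t) t :=
  intervalIntegral.integral_hasDerivAt_right (lineBump.continuous.intervalIntegrable _ _)
    (lineBump.continuous.stronglyMeasurableAtFilter _ _) lineBump.continuous.continuousAt

theorem testFn_phiK : TestFn phiK := by
  refine ⟨?_, hasCompactSupport_of_eq_zero fun _ => phiK_eq_zero⟩
  have h1 : ContDiff ℝ (⊤ : ℕ∞) (fun t => ∫ s in (0 : ℝ)..t, lineBump s) := by
    rw [contDiff_infty_iff_deriv]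
    refine ⟨fun t => (hasDerivAt_integral_lineBump t).differentiableAt, ?_⟩
    rw [show deriv (fun t => ∫ s in (0 : ℝ)..t, lineBump s) = lineBump from
      funext fun t => (hasDerivAt_integral_lineBump t).deriv]
    exact lineBump.contDiff
  exact ((h1.comp (contDiff_norm_sq ℝ)).sub contDiff_const).div_const 2

theorem pd_phiK (j : Fin 3) (y : E3) : pd j phiK y = y j * psiK y := by
  have h1 : HasFDerivAt phiK _ y :=
    ((((hasDerivAt_integral_lineBump (‖y‖ ^ 2)).comp_hasFDerivAt y
      (hasStrictFDerivAt_norm_sq y).hasFDerivAt).sub_const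
      (∫ t in (0 : ℝ)..1, lineBump t)).mul_const (2⁻¹ : ℝ))
  rw [pd, h1.fderiv]
  simp [psiK, EuclideanSpace.inner_single_right]
  ring

theorem integral_psiK_pos : 0 < ∫ y, psiK y := by
  obtain ⟨y, hy⟩ := NormedSpace.exists_lt_norm ℝ E3 0
  refine testFn_psiK.smooth.continuous.integral_pos_of_hasCompactSupport_nonneg_nonzero
    testFn_psiK.supp psiK_nonneg (x := (Real.sqrt (1 / 2) * ‖y‖⁻¹) • y) ?_
  rw [psiK, norm_smul, norm_mul, norm_inv, norm_norm, mul_assoc, inv_mul_cancel₀ hy.ne', mul_one,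
    Real.norm_eq_abs, sq_abs, Real.sq_sqrt (by norm_num)]
  rw [lineBump.one_of_mem_closedBall (by simp [lineBump])]
  norm_num

/-- Average of `h` at scale `R` with kernel `χ`. -/
def avg (χ : E3 → ℝ) (R : ℝ) (h : E3 → ℝ) : E3 → ℝ :=
  wavg volume χ (fun y => R • y) h

theorem aesm_smul (R : ℝ) : AEStronglyMeasurable (fun y : E3 => R • y) volume :=
  (continuous_const_smul R).aestronglyMeasurable

theorem pd_avg {χ h : E3 → ℝ} (hχ : TestFn χ) (hh : TestFn h) (R : ℝ) (k : Fin 3) (x : E3) :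
    pd k (avg χ R h) x = avg χ R (pd k h) x := pd_wavg hχ.integrable (aesm_smul R) hh k x

theorem fderiv_comp_sub_smul {f : E3 → ℝ} (hf : Sm f) (R : ℝ) (x y : E3) :
    HasFDerivAt (fun y => f (x - R • y)) (-(R • fderiv ℝ f (x - R • y))) y := by
  have := (hf.diff.differentiableAt (x := x - R • y)).hasFDerivAt.comp y
    (((hasFDerivAt_id y).const_smul R).const_sub x)
  refine this.congr_fderiv ?_
  ext v; simp

theorem sm_comp_sub_smul {f : E3 → ℝ} (hf : Sm f) (R : ℝ) (x : E3) :
    Sm (fun y => f (x - R • y)) :=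
  hf.comp (contDiff_const.sub (contDiff_id.const_smul R))

theorem pd_comp_sub_smul {f : E3 → ℝ} (hf : Sm f) (R : ℝ) (x : E3) (j : Fin 3) (y : E3) :
    pd j (fun y => f (x - R • y)) y = -R * pd j f (x - R • y) := by
  rw [pd, (fderiv_comp_sub_smul hf R x y).fderiv]; simp [pd]

theorem pd_avg_kernel {χ h : E3 → ℝ} (hχ : TestFn χ) (hh : TestFn h) {R : ℝ} (hR : R ≠ 0)
    (k : Fin 3) (x : E3) : pd k (avg χ R h) x = R⁻¹ * avg (pd k χ) R h x := by
  rw [pd_avg hχ hh]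
  have h1 := integral_mul_pd (sm_comp_sub_smul hh.smooth R x) hχ k
  simp only [pd_comp_sub_smul hh.smooth] at h1
  have e1 : avg (pd k χ) R h x = ∫ y, h (x - R • y) * pd k χ y :=
    integral_congr_ae (Eventually.of_forall fun y => mul_comm _ _)
  have e2 : avg χ R (pd k h) x = ∫ y, pd k h (x - R • y) * χ y :=
    integral_congr_ae (Eventually.of_forall fun y => mul_comm _ _)
  rw [e1, h1, e2, ← integral_neg, ← integral_const_mul]
  congr 1; ext y; field_simp

theorem integral_comp_sub_smul (f : E3 → ℝ) {R : ℝ} (hR : 0 < R) (x : E3) :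
    ∫ y, f (x - R • y) = (R ^ 3)⁻¹ * ∫ y, f y := by
  have h1 := Measure.integral_comp_smul (volume : Measure E3) (fun z => f (x - z)) R
  rw [h1, integral_sub_left_eq_self f volume x]
  simp [abs_of_pos hR]

theorem abs_avg_le {χ h : E3 → ℝ} {C : ℝ} (hC : ∀ x, |χ x| ≤ C) (hh : TestFn h) {R : ℝ}
    (hR : 0 < R) (x : E3) : |avg χ R h x| ≤ C * ((R ^ 3)⁻¹ * ∫ y, |h y|) := by
  rw [← integral_comp_sub_smul _ hR x, ← integral_const_mul]
  refine norm_integral_le_of_norm_le (f := fun y => χ y * h (x - R • y)) ?_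
    (Eventually.of_forall fun y => ?_)
  · have h1 : TestFn (fun y => h (x - R • y)) := by
      refine ⟨sm_comp_sub_smul hh.smooth R x, ?_⟩
      exact hh.supp.comp_homeomorph ((Homeomorph.smulOfNeZero R hR.ne').trans (Homeomorph.subLeft x))
    exact h1.integrable.norm.const_mul C
  · rw [norm_mul]; exact mul_le_mul_of_nonneg_right (hC y) (abs_nonneg _)

theorem avg_eq_zero {χ h : E3 → ℝ} (hχ : ∀ y, 1 ≤ ‖y‖ → χ y = 0) {R : ℝ} (hR : 0 < R)
    (hh : ∀ x, R ≤ ‖x‖ → h x = 0) {x : E3} (hx : 2 * R ≤ ‖x‖) : avg χ R h x = 0 := by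
  refine wavg_eq_zero (r := R) (fun y hy => ?_) hh (by linarith)
  rw [norm_smul, Real.norm_of_nonneg hR.le]
  by_contra hcon
  exact hy (hχ y (by nlinarith))

theorem testFn_avg {χ h : E3 → ℝ} (hχ : TestFn χ) (hχ1 : ∀ y, 1 ≤ ‖y‖ → χ y = 0) (hh : TestFn h)
    {R : ℝ} (hR : 0 < R) (hhR : ∀ x, R ≤ ‖x‖ → h x = 0) : TestFn (avg χ R h) :=
  ⟨contDiff_wavg hχ.integrable (aesm_smul R) hh,
    hasCompactSupport_of_eq_zero fun _ hx => avg_eq_zero hχ1 hR hhR hx⟩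

theorem lintegral_pow_three_le {α : Type*} [MeasurableSpace α] (μ : Measure α) {f : α → ℝ≥0∞}
    (hf : AEMeasurable f μ) :
    (∫⁻ a, f a ∂μ) ^ 3 ≤ μ Set.univ ^ 2 * ∫⁻ a, f a ^ 3 ∂μ := by
  have h := ENNReal.lintegral_mul_le_Lp_mul_Lq μ (p := 3) (q := 3 / 2)
    (by constructor <;> norm_num) hf (aemeasurable_const (b := (1 : ℝ≥0∞)))
  simp only [Pi.mul_apply, mul_one, ENNReal.one_rpow, lintegral_const, one_mul] at h
  have h4 := pow_le_pow_left₀ bot_le h 3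
  refine h4.trans_eq ?_
  rw [mul_pow, mul_comm]
  congr 1
  · rw [← ENNReal.rpow_natCast, ← ENNReal.rpow_mul, ← ENNReal.rpow_natCast]; norm_num
  · rw [← ENNReal.rpow_natCast, ← ENNReal.rpow_mul]; norm_num

theorem lintegral_avg_cube {χ h : E3 → ℝ} (hχ : TestFn χ) (hh : TestFn h) (R : ℝ) :
    ∫⁻ x, ‖avg χ R h x‖ₑ ^ 3 ≤ (∫⁻ y, ‖χ y‖ₑ) ^ 3 * ∫⁻ x, ‖h x‖ₑ ^ 3 := by
  have hχm : Measurable (fun y => ‖χ y‖ₑ) := hχ.smooth.continuous.measurable.enorm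
  have hhm : Measurable (fun y => ‖h y‖ₑ) := hh.smooth.continuous.measurable.enorm
  set ν := (volume : Measure E3).withDensity (fun y => ‖χ y‖ₑ) with hν
  have hνu : ν Set.univ = ∫⁻ y, ‖χ y‖ₑ := by
    rw [hν, withDensity_apply _ MeasurableSet.univ, Measure.restrict_univ]
  have hfin : IsFiniteMeasure ν := ⟨by rw [hνu]; exact hχ.integrable.2⟩
  have hjoint : Measurable (fun p : E3 × E3 => ‖h (p.1 - R • p.2)‖ₑ ^ 3) :=
    (hhm.comp (by fun_prop)).pow_const 3
  calc ∫⁻ x, ‖avg χ R h x‖ₑ ^ 3 ≤ ∫⁻ x, ν Set.univ ^ 2 * ∫⁻ y, ‖h (x - R • y)‖ₑ ^ 3 ∂ν := by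
        refine lintegral_mono fun x => ?_
        refine le_trans ?_ (lintegral_pow_three_le ν (hhm.comp (by fun_prop)).aemeasurable)
        gcongr
        refine (enorm_integral_le_lintegral_enorm _).trans_eq ?_
        rw [hν, lintegral_withDensity_eq_lintegral_mul _ hχm
          (g := fun y => ‖h (x - R • y)‖ₑ) (hhm.comp (by fun_prop))]
        simp only [enorm_mul, Pi.mul_apply]
    _ = ν Set.univ ^ 2 * ∫⁻ y, ∫⁻ x, ‖h (x - R • y)‖ₑ ^ 3 ∂volume ∂ν := by
        rw [lintegral_const_mul' _ _ (ENNReal.pow_ne_top (measure_ne_top _ _))]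
        congr 1
        exact lintegral_lintegral_swap hjoint.aemeasurable
    _ = ν Set.univ ^ 2 * ∫⁻ y, ∫⁻ x, ‖h x‖ₑ ^ 3 ∂volume ∂ν := by
        congr 2; ext y
        exact lintegral_sub_right_eq_self (fun x => ‖h x‖ₑ ^ 3) (R • y)
    _ = _ := by rw [lintegral_const, hνu]; ring

theorem clm_apply_eq_sum (L : E3 →L[ℝ] ℝ) (y : E3) :
    L y = ∑ j, y j * L (EuclideanSpace.single j 1) := by
  conv_lhs => rw [← (EuclideanSpace.basisFun (Fin 3) ℝ).sum_repr y]
  simp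

theorem hasDerivAt_avg_psiK {g : E3 → ℝ} (hg : TestFn g) (x : E3) (s : ℝ) :
    HasDerivAt (fun s => avg psiK s g x) (-(s * ∫ y, phiK y * lap g (x - s • y))) s := by
  obtain ⟨C, hC⟩ := hg.bdd_fderiv
  have hcd : Continuous (fderiv ℝ g) := hg.smooth.continuous_fderiv (by simp)
  have hF' : ∀ s : ℝ, Continuous (fun y : E3 => psiK y * -(fderiv ℝ g (x - s • y) y)) := fun s => by
    have := testFn_psiK.smooth.continuous
    have h2 : Continuous (fun y : E3 => fderiv ℝ g (x - s • y) y) :=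
      (hcd.comp (by fun_prop)).clm_apply continuous_id
    fun_prop
  have hbi : Integrable (fun y : E3 => psiK y * (C * ‖y‖)) := by
    refine Continuous.integrable_of_hasCompactSupport ?_ testFn_psiK.supp.mul_right
    have := testFn_psiK.smooth.continuous
    fun_prop
  have key := hasDerivAt_integral_of_dominated_loc_of_deriv_le (μ := (volume : Measure E3))
    (F := fun s y => psiK y * g (x - s • y)) (x₀ := s)
    (F' := fun s y => psiK y * -(fderiv ℝ g (x - s • y) y))
    (bound := fun y => psiK y * (C * ‖y‖)) (s := Set.univ) univ_mem
    (Eventually.of_forall fun s =>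
      (integrable_wavg testFn_psiK.integrable (aesm_smul s) hg x).1)
    (integrable_wavg testFn_psiK.integrable (aesm_smul s) hg x)
    (hF' s).aestronglyMeasurable
    (Eventually.of_forall fun y s _ => by
      rw [norm_mul, norm_neg, Real.norm_of_nonneg (psiK_nonneg y)]
      exact mul_le_mul_of_nonneg_left (((fderiv ℝ g _).le_opNorm y).trans (by gcongr; exact hC _))
        (psiK_nonneg y))
    hbi
    (Eventually.of_forall fun y s _ => by
      have h1 : HasDerivAt (fun s : ℝ => x - s • y) (-y) s := by
        simpa using ((hasDerivAt_id s).smul_const y).const_sub x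
      have h2 := (hg.smooth.diff.differentiableAt (x := x - s • y)).hasFDerivAt.comp_hasDerivAt s h1
      rw [map_neg] at h2
      exact h2.const_mul (psiK y))
  refine key.2.congr_deriv ?_
  have e1 : ∀ y : E3, psiK y * -(fderiv ℝ g (x - s • y) y) =
      ∑ j, -(pd j g (x - s • y) * pd j phiK y) := fun y => by
    have : fderiv ℝ g (x - s • y) y = ∑ j, y j * pd j g (x - s • y) :=
      clm_apply_eq_sum _ y
    rw [this, Finset.sum_neg_distrib, mul_neg, Finset.mul_sum]
    congr 1
    exact Finset.sum_congr rfl fun j _ => by rw [pd_phiK]; ring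
  have hI : ∀ f : E3 → ℝ, Sm f → ∀ w : E3 → ℝ, TestFn w →
      Integrable (fun y => f (x - s • y) * w y) := fun f hf w hw =>
    (hw.mul_left (sm_comp_sub_smul hf s x)).integrable
  simp only [e1]
  rw [integral_finsetSum _ (f := fun j y => -(pd j g (x - s • y) * pd j phiK y))
    fun j _ => (hI _ (hg.smooth.pd j) _ (testFn_phiK.pd j)).neg]
  have e2 : ∀ j, ∫ y, -(pd j g (x - s • y) * pd j phiK y) =
      - s * ∫ y, pd j (pd j g) (x - s • y) * phiK y := fun j => by
    rw [integral_neg, integral_mul_pd (sm_comp_sub_smul (hg.smooth.pd j) s x) testFn_phiK j]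
    simp only [pd_comp_sub_smul (hg.smooth.pd j)]
    rw [neg_neg, ← integral_const_mul]
    congr 1; ext y; ring
  simp only [e2]
  rw [← Finset.mul_sum, ← integral_finsetSum _ fun j _ => hI _ ((hg.smooth.pd j).pd j) _ testFn_phiK]
  rw [neg_mul]
  congr 3; ext y
  rw [lap, ← Finset.sum_mul, mul_comm]

/-- Weight of the averaging representation of the potential. -/
def potW (R : ℝ) (ω : ℝ × E3) : ℝ := (Set.Ioo 0 R).indicator id ω.1 * phiK ω.2

/-- Localized potential: `Δ (pot R g) = c g - avg psiK R g`. -/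
def pot (R : ℝ) (g : E3 → ℝ) : E3 → ℝ := wavg volume (potW R) (fun ω => ω.1 • ω.2) g

theorem integrable_potW (R : ℝ) : Integrable (potW R) := by
  have h1 : Integrable ((Set.Ioo 0 R).indicator (id : ℝ → ℝ)) :=
    (integrable_indicator_iff measurableSet_Ioo).2
      ((continuous_id.integrableOn_Icc (a := 0) (b := R)).mono_set Set.Ioo_subset_Icc_self)
  exact h1.mul_prod testFn_phiK.integrable

theorem aesm_pot : AEStronglyMeasurable (fun ω : ℝ × E3 => ω.1 • ω.2) volume :=
  (continuous_fst.smul continuous_snd).aestronglyMeasurable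

theorem potW_ne_zero {R : ℝ} {ω : ℝ × E3} (h : potW R ω ≠ 0) : ‖ω.1 • ω.2‖ ≤ R := by
  obtain ⟨h1, h2⟩ := mul_ne_zero_iff.1 h
  have h3 := Set.mem_of_indicator_ne_zero h1
  have h4 : ‖ω.2‖ ≤ 1 := by
    by_contra hc
    exact h2 (phiK_eq_zero (not_le.1 hc).le)
  rw [norm_smul, Real.norm_of_nonneg h3.1.le]
  nlinarith [h3.1, h3.2, norm_nonneg ω.2]

theorem testFn_pot {R : ℝ} {g : E3 → ℝ} (hg : TestFn g) (hgR : ∀ x, R ≤ ‖x‖ → g x = 0) :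
    TestFn (pot R g) :=
  testFn_wavg (integrable_potW R) aesm_pot (fun _ => potW_ne_zero) hg hgR

theorem pot_eq_zero {R : ℝ} {g : E3 → ℝ} (hgR : ∀ x, R ≤ ‖x‖ → g x = 0) {x : E3}
    (hx : 2 * R ≤ ‖x‖) : pot R g x = 0 :=
  wavg_eq_zero (r := R) (fun _ => potW_ne_zero) hgR (by linarith)

theorem lap_pot {R : ℝ} (hR : 0 < R) {g : E3 → ℝ} (hg : TestFn g) (x : E3) :
    (∫ y, psiK y) * g x = avg psiK R g x + lap (pot R g) x := by
  have hint := integrable_wavg (integrable_potW R) aesm_pot hg.lap x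
  have e1 : ∀ s : ℝ, ∫ y, potW R (s, y) * lap g (x - s • y) =
      (Set.Ioo 0 R).indicator (fun s => s * ∫ y, phiK y * lap g (x - s • y)) s := fun s => by
    by_cases hs : s ∈ Set.Ioo 0 R
    · simp only [potW, Set.indicator_of_mem hs, id, mul_assoc, integral_const_mul]
    · simp [potW, Set.indicator_of_notMem hs]
  have h1 : lap (pot R g) x = ∫ s in Set.Ioo 0 R, s * ∫ y, phiK y * lap g (x - s • y) := by
    rw [pot, lap_wavg (integrable_potW R) aesm_pot hg, wavg, Measure.volume_eq_prod,
      integral_prod _ hint]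
    simp only [e1]
    rw [integral_indicator measurableSet_Ioo]
  have h2 : IntervalIntegrable (fun s => -(s * ∫ y, phiK y * lap g (x - s • y))) volume 0 R := by
    rw [intervalIntegrable_iff_integrableOn_Ioo_of_le hR.le]
    have := hint.integral_prod_left
    simp only [e1] at this
    exact ((integrable_indicator_iff measurableSet_Ioo).1 this).neg
  have h3 := intervalIntegral.integral_eq_sub_of_hasDerivAt
    (fun s _ => hasDerivAt_avg_psiK hg x s) h2
  rw [intervalIntegral.integral_of_le hR.le, integral_Ioc_eq_integral_Ioo, integral_neg, ← h1] at h3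
  have h4 : avg psiK 0 g x = (∫ y, psiK y) * g x := by
    simp [avg, wavg, integral_mul_const]
  linarith

theorem exists_pot_hessian : ∃ C : ℝ≥0, ∀ R : ℝ, 0 < R → ∀ g : E3 → ℝ, TestFn g →
    (∀ x, R ≤ ‖x‖ → g x = 0) → ∀ i k : Fin 3,
    ∫⁻ x, ‖pd i (pd k (pot R g)) x‖ₑ ^ 3 ≤ C * ∫⁻ x, ‖g x‖ₑ ^ 3 := by
  obtain ⟨C, hC⟩ := exists_lintegral_hessian_cube
  set c : ℝ≥0∞ := ∫⁻ y, ‖psiK y‖ₑ with hc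
  have hct : c ≠ ∞ := testFn_psiK.integrable.2.ne
  have hce : ‖∫ y, psiK y‖ₑ ≤ c := enorm_integral_le_lintegral_enorm _
  refine ⟨C * (8 * (c ^ 3).toNNReal), fun R hR g hg hgR i k => ?_⟩
  refine (hC i k _ (testFn_pot hg hgR)).trans ?_
  push_cast
  rw [mul_assoc, ENNReal.coe_toNNReal (ENNReal.pow_ne_top hct)]
  gcongr
  have h1 : ∀ x, ‖lap (pot R g) x‖ₑ ^ 3 ≤
      4 * (c ^ 3 * ‖g x‖ₑ ^ 3 + ‖avg psiK R g x‖ₑ ^ 3) := fun x => by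
    have e : lap (pot R g) x = (∫ y, psiK y) * g x - avg psiK R g x := by
      rw [lap_pot hR hg]; ring
    have h2 : ‖lap (pot R g) x‖ₑ ≤ c * ‖g x‖ₑ + ‖avg psiK R g x‖ₑ := by
      rw [e]
      refine enorm_sub_le.trans ?_
      rw [enorm_mul]; gcongr
    refine (pow_le_pow_left₀ bot_le h2 3).trans ?_
    have := ENNReal.rpow_add_le_mul_rpow_add_rpow (c * ‖g x‖ₑ) ‖avg psiK R g x‖ₑ
      (p := 3) (by norm_num)
    norm_num at this
    rw [mul_pow] at this
    exact_mod_cast this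
  have hgm : Measurable (fun y => ‖g y‖ₑ) := hg.smooth.continuous.measurable.enorm
  calc ∫⁻ x, ‖lap (pot R g) x‖ₑ ^ 3
      ≤ ∫⁻ x, 4 * (c ^ 3 * ‖g x‖ₑ ^ 3 + ‖avg psiK R g x‖ₑ ^ 3) := lintegral_mono h1
    _ = 4 * (c ^ 3 * (∫⁻ x, ‖g x‖ₑ ^ 3) + ∫⁻ x, ‖avg psiK R g x‖ₑ ^ 3) := by
        rw [lintegral_const_mul' _ _ (by norm_num), lintegral_add_left ((hgm.pow_const 3).const_mul _),
          lintegral_const_mul' _ _ (ENNReal.pow_ne_top hct)]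
    _ ≤ 4 * (c ^ 3 * (∫⁻ x, ‖g x‖ₑ ^ 3) + c ^ 3 * ∫⁻ x, ‖g x‖ₑ ^ 3) := by
        gcongr; exact lintegral_avg_cube testFn_psiK hg R
    _ = _ := by ring

theorem pd_eq_zero_of_isLocalExtr {f : E3 → ℝ} {x : E3} (h : IsLocalExtr f x) (j : Fin 3) :
    pd j f x = 0 := by simp [pd, h.fderiv_eq_zero]

def unitBump : ContDiffBump (0 : E3) := ⟨1 / 2, 1, by norm_num, by norm_num⟩

theorem testFn_unitBump : TestFn unitBump := ⟨unitBump.contDiff, unitBump.hasCompactSupport⟩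

/-- The cutoff equal to `1` on the ball of radius `R / 2` and vanishing outside that of radius
`R`. -/
def cut (R : ℝ) (x : E3) : ℝ := unitBump (R⁻¹ • x)

theorem cut_nonneg (R : ℝ) (x : E3) : 0 ≤ cut R x := unitBump.nonneg

theorem cut_le_one (R : ℝ) (x : E3) : cut R x ≤ 1 := unitBump.le_one

theorem norm_inv_smul {R : ℝ} (hR : 0 < R) (x : E3) : ‖R⁻¹ • x‖ = ‖x‖ / R := by
  rw [norm_smul, norm_inv, Real.norm_of_nonneg hR.le]; field_simp

theorem cut_eq_one {R : ℝ} (hR : 0 < R) {x : E3} (hx : ‖x‖ ≤ R / 2) : cut R x = 1 := by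
  refine unitBump.one_of_mem_closedBall ?_
  rw [mem_closedBall_zero_iff, norm_inv_smul hR, div_le_iff₀ hR]
  simpa [unitBump, div_eq_inv_mul] using hx

theorem cut_eq_zero {R : ℝ} (hR : 0 < R) {x : E3} (hx : R ≤ ‖x‖) : cut R x = 0 := by
  refine unitBump.zero_of_le_dist ?_
  rw [dist_zero_right, norm_inv_smul hR, le_div_iff₀ hR]
  simpa [unitBump] using hx

theorem testFn_cut {R : ℝ} (hR : 0 < R) : TestFn (cut R) :=
  ⟨unitBump.contDiff.comp (contDiff_const_smul _),
    hasCompactSupport_of_eq_zero fun _ hx => cut_eq_zero hR hx⟩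

theorem pd_comp_inv_smul {f : E3 → ℝ} (hf : Sm f) (R : ℝ) (j : Fin 3) (x : E3) :
    pd j (fun y => f (R⁻¹ • y)) x = R⁻¹ * pd j f (R⁻¹ • x) := by
  have h := (hf.diff (R⁻¹ • x)).hasFDerivAt.comp x
    ((ContinuousLinearMap.id ℝ E3).hasFDerivAt.const_smul R⁻¹ (x := x))
  simp only [pd]
  have h2 := h.fderiv
  simp only [Function.comp_def] at h2
  have h3 : (fun y => f (R⁻¹ • y)) = fun y => f ((R⁻¹ • fun y => y) y) := rfl
  rw [h3]
  erw [h2]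
  simp

theorem pd_cut (R : ℝ) (j : Fin 3) (x : E3) :
    pd j (cut R) x = R⁻¹ * pd j unitBump (R⁻¹ • x) :=
  pd_comp_inv_smul testFn_unitBump.smooth R j x

theorem pd_cut_eq_zero {R : ℝ} (hR : 0 < R) (j : Fin 3) {x : E3} (hx : x ∉ ann R) :
    pd j (cut R) x = 0 := by
  apply pd_eq_zero_of_isLocalExtr
  rcases le_or_gt ‖x‖ (R / 2) with h | h
  · refine Or.inr (Eventually.of_forall fun y => ?_)
    rw [cut_eq_one hR h]; exact cut_le_one R y
  · have h2 : R ≤ ‖x‖ := by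
      by_contra h3; exact hx ⟨h, not_le.1 h3⟩
    refine Or.inl (Eventually.of_forall fun y => ?_)
    rw [cut_eq_zero hR h2]; exact cut_nonneg R y

theorem pd_cut_eq_zero_of_le {R : ℝ} (hR : 0 < R) (j : Fin 3) {x : E3} (hx : R ≤ ‖x‖) :
    pd j (cut R) x = 0 := pd_cut_eq_zero hR j fun h => absurd h.2 (not_lt.2 hx)

theorem exists_cut_bounds : ∃ K : ℝ, 0 < K ∧ ∀ R : ℝ, 0 < R → ∀ x,
    (∀ j, |pd j (cut R) x| ≤ K / R) ∧ |lap (cut R) x| ≤ K / R ^ 2 := by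
  have h1 := fun j => (testFn_unitBump.pd j).bdd
  choose A hA using h1
  obtain ⟨B, hB⟩ := testFn_unitBump.lap.bdd
  refine ⟨∑ j, |A j| + |B| + 1, by positivity, fun R hR x => ⟨fun j => ?_, ?_⟩⟩
  · rw [pd_cut, abs_mul, abs_of_pos (inv_pos.2 hR), div_eq_inv_mul]
    refine mul_le_mul_of_nonneg_left ?_ (inv_pos.2 hR).le
    have := Finset.single_le_sum (f := fun j => |A j|) (fun i _ => abs_nonneg _) (Finset.mem_univ j)
    have h3 := (hA j (R⁻¹ • x)).trans (le_abs_self _)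
    have := abs_nonneg B
    linarith
  · have e : lap (cut R) x = R⁻¹ ^ 2 * lap unitBump (R⁻¹ • x) := by
      simp only [lap, Finset.mul_sum]
      refine Finset.sum_congr rfl fun j _ => ?_
      have : pd j (cut R) = fun y => R⁻¹ * pd j unitBump (R⁻¹ • y) := funext (pd_cut R j)
      rw [this, pd_const_mul (f := fun y => pd j unitBump (R⁻¹ • y))
        ((testFn_unitBump.smooth.pd j).comp (contDiff_const_smul _)),
        pd_comp_inv_smul (testFn_unitBump.smooth.pd j)]
      ring
    rw [e, abs_mul, abs_of_pos (by positivity), div_eq_inv_mul, inv_pow]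
    refine mul_le_mul_of_nonneg_left ?_ (by positivity)
    have h3 := (hB (R⁻¹ • x)).trans (le_abs_self _)
    have : 0 ≤ ∑ j, |A j| := Finset.sum_nonneg fun _ _ => abs_nonneg _
    linarith

theorem integrableOn_ball {G : E3 → ℝ} (hG : Continuous G) (R : ℝ) : IntegrableOn G (ball 0 R) :=
  (hG.continuousOn.integrableOn_compact (isCompact_closedBall 0 R)).mono_set ball_subset_closedBall

theorem integral_eq_ball {f : E3 → ℝ} {R : ℝ} (h0 : ∀ x, R ≤ ‖x‖ → f x = 0) :
    ∫ x, f x = ∫ x in ball 0 R, f x := by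
  refine (setIntegral_eq_integral_of_forall_compl_eq_zero fun x hx => h0 x ?_).symm
  simpa using hx

theorem abs_integral_le_ball {f G : E3 → ℝ} {R : ℝ} (hG : Continuous G)
    (h0 : ∀ x, R ≤ ‖x‖ → f x = 0) (hle : ∀ x, ‖x‖ < R → |f x| ≤ G x) :
    |∫ x, f x| ≤ ∫ x in ball 0 R, G x := by
  rw [integral_eq_ball h0]
  refine norm_integral_le_of_norm_le (f := f) (integrableOn_ball hG R) ?_
  filter_upwards [ae_restrict_mem measurableSet_ball] with x hx
  exact hle x (by simpa using hx)

theorem measurableSet_ann (R : ℝ) : MeasurableSet (ann R) :=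
  (measurableSet_lt measurable_const measurable_norm).inter
    (measurableSet_lt measurable_norm measurable_const)

theorem ann_subset_ball (R : ℝ) : ann R ⊆ ball 0 R := fun x hx => by simpa using hx.2

theorem abs_integral_le_ann {f G : E3 → ℝ} {R : ℝ} (hG : Continuous G)
    (h0 : ∀ x, x ∉ ann R → f x = 0) (hle : ∀ x, x ∈ ann R → |f x| ≤ G x) :
    |∫ x, f x| ≤ ∫ x in ann R, G x := by
  rw [← setIntegral_eq_integral_of_forall_compl_eq_zero h0]
  refine norm_integral_le_of_norm_le (f := f)
    ((integrableOn_ball hG R).mono_set (ann_subset_ball R)) ?_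
  filter_upwards [ae_restrict_mem (measurableSet_ann R)] with x hx
  exact hle x hx

theorem setIntegral_ball_mono {f : E3 → ℝ} (hf : Continuous f) (h0 : ∀ x, 0 ≤ f x) {R S : ℝ}
    (h : R ≤ S) : ∫ x in ball 0 R, f x ≤ ∫ x in ball 0 S, f x :=
  setIntegral_mono_set (integrableOn_ball hf S) (Eventually.of_forall h0)
    (ball_subset_ball h).eventuallyLE

theorem setIntegral_ball_eq_ann_add {f : E3 → ℝ} (hf : Continuous f) {R : ℝ}
    (hR : 0 < R) : ∫ x in ball 0 R, f x = (∫ x in ann R, f x) + ∫ x in ball 0 (R / 2), f x := by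
  have hd : Disjoint (ann R) (ball (0 : E3) (R / 2)) := by
    rw [Set.disjoint_left]; intro x hx hx2
    exact absurd hx.1 (not_lt.2 (by simpa using (mem_ball_zero_iff.1 hx2).le))
  rw [← setIntegral_union hd measurableSet_ball
    ((integrableOn_ball hf R).mono_set (ann_subset_ball R)) (integrableOn_ball hf _)]
  refine setIntegral_congr_set ?_
  have hs : volume (sphere (0 : E3) (R / 2)) = 0 := Measure.addHaar_sphere _ _ _
  rw [eventuallyEq_set]
  filter_upwards [compl_mem_ae_iff.2 hs] with x hx
  have hx' : ‖x‖ ≠ R / 2 := by simpa using hx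
  simp only [Set.mem_union, mem_ball_zero_iff, ann, Set.mem_ofPred_eq]
  constructor
  · intro h
    rcases lt_or_gt_of_ne hx' with h2 | h2
    · exact Or.inr h2
    · exact Or.inl ⟨h2, h⟩
  · rintro (h | h)
    · exact h.2
    · linarith

theorem eq_zero_of_setIntegral_ball {f : E3 → ℝ} (hf : Continuous f) (h0 : ∀ x, 0 ≤ f x)
    (h : ∀ R : ℝ, ∫ x in ball 0 R, f x ≤ 0) (x : E3) : f x = 0 := by
  have h1 : f =ᵐ[volume.restrict (ball 0 (‖x‖ + 1))] 0 := by
    rw [← setIntegral_eq_zero_iff_of_nonneg_ae (Eventually.of_forall h0) (integrableOn_ball hf _)]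
    exact le_antisymm (h _) (integral_nonneg h0)
  have h2 : Set.EqOn f 0 (ball 0 (‖x‖ + 1)) :=
    Measure.eqOn_open_of_ae_eq h1 isOpen_ball hf.continuousOn continuousOn_const
  exact h2 (by simp)

/-- A nonnegative function whose integrals over balls grow subcritically must vanish. -/
theorem eq_zero_of_ball_le_ann {f : E3 → ℝ} (hf : Continuous f) (h0 : ∀ x, 0 ≤ f x) {K C : ℝ}
    (hK : 0 ≤ K) (hle : ∀ R : ℝ, 1 ≤ R → ∫ x in ball 0 (R / 2), f x ≤ K * ∫ x in ann R, f x)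
    (hC : ∀ R : ℝ, 1 ≤ R → ∫ x in ann R, f x ≤ C) (x : E3) : f x = 0 := by
  have hmono : Monotone fun R : ℝ => ∫ x in ball (0 : E3) R, f x :=
    fun R S h => setIntegral_ball_mono hf h0 h
  have hbdd : BddAbove (Set.range fun R : ℝ => ∫ x in ball (0 : E3) R, f x) := by
    refine ⟨K * C, ?_⟩
    rintro _ ⟨R, rfl⟩
    have h1 : (1 : ℝ) ≤ 2 * max R 1 := by linarith [le_max_right R 1]
    have h2 := hle _ h1
    rw [mul_div_cancel_left₀ _ two_ne_zero] at h2
    exact (hmono (le_max_left R 1)).trans (h2.trans (mul_le_mul_of_nonneg_left (hC _ h1) hK))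
  have ht := tendsto_atTop_ciSup hmono hbdd
  set L := ⨆ R : ℝ, ∫ x in ball (0 : E3) R, f x
  have ht2 : Tendsto (fun R : ℝ => ∫ x in ball (0 : E3) (R / 2), f x) atTop (nhds L) :=
    ht.comp (tendsto_id.atTop_div_const two_pos)
  have hL : L ≤ K * (L - L) := by
    refine le_of_tendsto_of_tendsto ht2 ((ht.sub ht2).const_mul K) ?_
    filter_upwards [eventually_ge_atTop 1] with R hR
    have := hle R hR
    have h3 := setIntegral_ball_eq_ann_add hf (R := R) (by linarith)
    rw [h3]; simpa using this
  refine eq_zero_of_setIntegral_ball hf h0 (fun R => ?_) x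
  have := le_ciSup hbdd R
  simp only [sub_self, mul_zero] at hL
  exact this.trans hL

/-- Smooth solutions of the system with values of `v` on the sphere, in componentwise form. -/
structure SmoothSol (u : E3 → Fin 3 → ℝ) (P : E3 → ℝ) (v : E3 → Fin 3 → ℝ) : Prop where
  su : ∀ i, Sm fun y => u y i
  sP : Sm P
  sv : ∀ i, Sm fun y => v y i
  unit : ∀ x, ∑ i, (v x i) ^ 2 = 1
  sol : StatEL u P v

/-- Entries of `∇v ⊙ ∇v`. -/
def elas (v : E3 → Fin 3 → ℝ) (i j : Fin 3) (x : E3) : ℝ :=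
  ∑ k, pd i (fun z => v z k) x * pd j (fun z => v z k) x

/-- Entries of `u ⊗ u + ∇v ⊙ ∇v`. -/
def flux (u v : E3 → Fin 3 → ℝ) (i j : Fin 3) (x : E3) : ℝ := u x i * u x j + elas v i j x

variable {u v : E3 → Fin 3 → ℝ} {P : E3 → ℝ} {B r ε : ℝ}

theorem sm_elas (hv : ∀ i, Sm fun y => v y i) (i j : Fin 3) : Sm (elas v i j) :=
  ContDiff.sum fun k _ => ((hv k).pd i).mul ((hv k).pd j)

theorem sm_gradSq (hv : ∀ i, Sm fun y => v y i) : Sm (gradSq v) :=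
  ContDiff.sum fun i _ => ContDiff.sum fun k _ => ((hv k).pd i).pow 2

theorem SmoothSol.sm_flux (h : SmoothSol u P v) (i j : Fin 3) : Sm (flux u v i j) :=
  ((h.su i).mul (h.su j)).add (sm_elas h.sv i j)

theorem pd_sq {f : E3 → ℝ} (hf : Sm f) (j : Fin 3) (x : E3) :
    pd j (fun y => f y ^ 2) x = 2 * f x * pd j f x := by
  have : (fun y => f y ^ 2) = fun y => f y * f y := funext fun y => by ring
  rw [this, pd_mul hf hf]; ring

theorem SmoothSol.orth (h : SmoothSol u P v) (i : Fin 3) (x : E3) :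
    ∑ k, v x k * pd i (fun z => v z k) x = 0 := by
  have h1 : pd i (fun y => ∑ k, v y k ^ 2) x = 0 := by
    simp only [h.unit, pd_const]
  rw [pd_sum _ fun k _ => (h.sv k).pow 2] at h1
  simp only [pd_sq (h.sv _)] at h1
  have h2 : 2 * ∑ k, v x k * pd i (fun z => v z k) x = 0 := by
    rw [← h1, Finset.mul_sum]; exact Finset.sum_congr rfl fun k _ => by ring
  linarith

theorem div_elas (hv : ∀ i, Sm fun y => v y i) (i : Fin 3) (x : E3) :
    ∑ j, pd j (elas v i j) x =
      pd i (fun y => gradSq v y / 2) x + ∑ k, pd i (fun z => v z k) x * lap (fun z => v z k) x := by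
  have e1 : ∀ j, pd j (elas v i j) x = ∑ k, (pd i (fun z => v z k) x * pd j (pd j fun z => v z k) x
      + pd j (fun z => v z k) x * pd i (pd j fun z => v z k) x) := fun j => by
    unfold elas
    rw [pd_sum _ fun k _ => ((hv k).pd i).mul ((hv k).pd j)]
    refine Finset.sum_congr rfl fun k _ => ?_
    rw [pd_mul ((hv k).pd i) ((hv k).pd j), pd_comm (hv k) j i]
  have e2 : pd i (fun y => gradSq v y / 2) x =
      ∑ j, ∑ k, pd j (fun z => v z k) x * pd i (pd j fun z => v z k) x := by
    have : (fun y => gradSq v y / 2) = fun y => 2⁻¹ * gradSq v y := funext fun y => by ring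
    rw [this, pd_const_mul (sm_gradSq hv)]
    unfold gradSq
    rw [pd_sum _ fun j _ => ContDiff.sum fun k _ => ((hv k).pd j).pow 2, Finset.mul_sum]
    refine Finset.sum_congr rfl fun j _ => ?_
    rw [pd_sum _ fun k _ => ((hv k).pd j).pow 2, Finset.mul_sum]
    refine Finset.sum_congr rfl fun k _ => ?_
    rw [pd_sq ((hv k).pd j)]; ring
  rw [e2]
  simp only [e1, lap, Finset.mul_sum, Finset.sum_add_distrib]
  rw [add_comm, Finset.sum_comm (f := fun k j => pd i (fun z => v z k) x * pd j (pd j fun z => v z k) x)]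

theorem SmoothSol.grad_mul_lap (h : SmoothSol u P v) (i : Fin 3) (x : E3) :
    ∑ k, pd i (fun z => v z k) x * lap (fun z => v z k) x = ∑ j, u x j * elas v i j x := by
  have e : ∀ k, lap (fun z => v z k) x = (∑ j, u x j * pd j (fun y => v y k) x)
      - gradSq v x * v x k := fun k => by linarith [h.sol.2.1 x k]
  have o := h.orth i x
  simp only [e, elas, Fin.sum_univ_three] at o ⊢
  linear_combination (-gradSq v x) * o

theorem SmoothSol.div_elas (h : SmoothSol u P v) (i : Fin 3) (x : E3) :
    ∑ j, pd j (elas v i j) x = pd i (fun y => gradSq v y / 2) x + ∑ j, u x j * elas v i j x := by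
  rw [_root_.div_elas h.sv, h.grad_mul_lap]

theorem SmoothSol.momentum (h : SmoothSol u P v) (i : Fin 3) (x : E3) :
    pd i P x = lap (fun y => u y i) x - (∑ j, u x j * pd j (fun y => u y i) x)
      - ∑ j, pd j (elas v i j) x := by
  have e : ∀ j, pd j (elas v i j) x =
      ∑ k, pd j (fun y => pd i (fun z => v z k) y * pd j (fun z => v z k) y) x := fun j => by
    unfold elas
    rw [pd_sum _ fun k _ => ((h.sv k).pd i).mul ((h.sv k).pd j)]
  simp only [e]
  linarith [h.sol.1 x i]

theorem SmoothSol.momentum_flux (h : SmoothSol u P v) (i : Fin 3) (x : E3) :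
    pd i P x = lap (fun y => u y i) x - ∑ j, pd j (flux u v i j) x := by
  have e : ∀ j, pd j (flux u v i j) x = u x i * pd j (fun y => u y j) x
      + u x j * pd j (fun y => u y i) x + pd j (elas v i j) x := fun j => by
    unfold flux
    rw [pd_add ((h.su i).mul (h.su j)) (sm_elas h.sv i j), pd_mul (h.su i) (h.su j)]
  simp only [e, h.momentum, Finset.sum_add_distrib, ← Finset.mul_sum, h.sol.2.2 x]
  ring

/-- Integration by parts twice. -/
theorem integral_lap_mul {f g : E3 → ℝ} (hf : Sm f) (hg : TestFn g) :
    ∫ x, lap f x * g x = ∫ x, f x * lap g x := by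
  simp only [lap, Finset.sum_mul, Finset.mul_sum]
  rw [integral_finsetSum _ fun j _ => (hg.mul_left ((hf.pd j).pd j)).integrable,
    integral_finsetSum _ fun j _ => (((hg.pd j).pd j).mul_left hf).integrable]
  refine Finset.sum_congr rfl fun j _ => ?_
  rw [integral_mul_pd hf (hg.pd j), integral_mul_pd (hf.pd j) hg]; ring

/-- The pressure tested against the divergence of a test vector field. -/
theorem SmoothSol.integral_pressure_div (h : SmoothSol u P v) {ψ : Fin 3 → E3 → ℝ}
    (hψ : ∀ i, TestFn (ψ i)) :
    ∫ x, P x * ∑ i, pd i (ψ i) x = - (∑ i, ∫ x, u x i * lap (ψ i) x)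
      - ∑ i, ∑ j, ∫ x, flux u v i j x * pd j (ψ i) x := by
  simp only [Finset.mul_sum]
  rw [integral_finsetSum _ fun j _ => (((hψ j).pd j).mul_left h.sP).integrable,
    ← Finset.sum_neg_distrib, ← Finset.sum_sub_distrib]
  refine Finset.sum_congr rfl fun i _ => ?_
  rw [integral_mul_pd h.sP (hψ i), ← integral_lap_mul (h.su i) (hψ i)]
  have e : ∀ x, pd i P x * ψ i x = lap (fun y => u y i) x * ψ i x
      - ∑ j, pd j (flux u v i j) x * ψ i x := fun x => by
    rw [h.momentum_flux, sub_mul, Finset.sum_mul]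
  simp only [e]
  rw [integral_sub ((hψ i).mul_left (h.su i).lap).integrable
    (TestFn.sum _ fun j _ => (hψ i).mul_left ((h.sm_flux i j).pd j)).integrable,
    integral_finsetSum _ fun j _ => ((hψ i).mul_left ((h.sm_flux i j).pd j)).integrable]
  simp only [integral_mul_pd (h.sm_flux i _) (hψ i), Finset.sum_neg_distrib]
  ring

/-- Divergence-free fields are orthogonal to gradients. -/
theorem SmoothSol.integral_vel_grad (h : SmoothSol u P v) {φ f : E3 → ℝ} (hφ : TestFn φ)
    (hf : Sm f) : ∫ x, φ x * ∑ i, u x i * pd i f x = - ∫ x, f x * ∑ i, u x i * pd i φ x := by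
  have e : ∀ i, ∫ x, f x * pd i (fun y => φ y * u y i) x = - ∫ x, pd i f x * (φ x * u x i) :=
    fun i => integral_mul_pd hf (hφ.mul_right (h.su i)) i
  have e2 : ∀ x, f x * ∑ i, u x i * pd i φ x = ∑ i, f x * pd i (fun y => φ y * u y i) x :=
    fun x => by
      have hd := h.sol.2.2 x
      simp only [pd_mul hφ.smooth (h.su _), Fin.sum_univ_three] at hd ⊢
      linear_combination (- f x * φ x) * hd
  have e3 : ∀ x, φ x * ∑ i, u x i * pd i f x = ∑ i, pd i f x * (φ x * u x i) := fun x => by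
    rw [Finset.mul_sum]; exact Finset.sum_congr rfl fun i _ => by ring
  simp only [e2, e3]
  rw [integral_finsetSum _ fun i _ => ((hφ.mul_right (h.su i)).mul_left (hf.pd i)).integrable,
    integral_finsetSum _ fun i _ => (((hφ.mul_right (h.su i)).pd i).mul_left hf).integrable]
  simp only [e, Finset.sum_neg_distrib, neg_neg]

/-- `|u|²`. -/
def sqSum (u : E3 → Fin 3 → ℝ) (x : E3) : ℝ := ∑ i, u x i ^ 2

theorem sm_sqSum (hu : ∀ i, Sm fun y => u y i) : Sm (sqSum u) :=
  ContDiff.sum fun i _ => (hu i).pow 2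

theorem lap_sqSum (hu : ∀ i, Sm fun y => u y i) (x : E3) :
    lap (sqSum u) x = 2 * gradSq u x + 2 * ∑ i, u x i * lap (fun y => u y i) x := by
  have e1 : ∀ j, pd j (sqSum u) = fun y => ∑ i, 2 * (u y i * pd j (fun z => u z i) y) :=
    fun j => funext fun y => by
      unfold sqSum
      rw [pd_sum _ fun i _ => (hu i).pow 2]
      exact Finset.sum_congr rfl fun i _ => by rw [pd_sq (hu i)]; ring
  have e2 : ∀ j, pd j (pd j (sqSum u)) x = ∑ i, 2 * (u x i * pd j (pd j fun z => u z i) x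
      + pd j (fun z => u z i) x * pd j (fun z => u z i) x) := fun j => by
    rw [e1 j, pd_sum _ fun i _ => contDiff_const.mul ((hu i).mul ((hu i).pd j))]
    refine Finset.sum_congr rfl fun i _ => ?_
    rw [pd_const_mul ((hu i).mul ((hu i).pd j)), pd_mul (hu i) ((hu i).pd j)]
  simp only [lap, e2, gradSq, Fin.sum_univ_three]
  ring

theorem SmoothSol.energy_pointwise (h : SmoothSol u P v) (x : E3) :
    gradSq u x + ∑ k, (∑ i, u x i * pd i (fun y => v y k) x) ^ 2 =
      lap (sqSum u) x / 2 - ∑ i, u x i * pd i (fun y => sqSum u y / 2 + gradSq v y / 2 + P y) x := by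
  have e : ∀ i, pd i (fun y => sqSum u y / 2 + gradSq v y / 2 + P y) x =
      (∑ k, u x k * pd i (fun y => u y k) x) + pd i (fun y => gradSq v y / 2) x + pd i P x :=
    fun i => by
      rw [pd_add (((sm_sqSum h.su).div_const 2).add ((sm_gradSq h.sv).div_const 2)) h.sP,
        pd_add ((sm_sqSum h.su).div_const 2) ((sm_gradSq h.sv).div_const 2)]
      congr 2
      have : (fun y => sqSum u y / 2) = fun y => 2⁻¹ * sqSum u y := funext fun y => by ring
      rw [this, pd_const_mul (sm_sqSum h.su)]
      unfold sqSum
      rw [pd_sum _ fun i _ => (h.su i).pow 2, Finset.mul_sum]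
      exact Finset.sum_congr rfl fun i _ => by rw [pd_sq (h.su i)]; ring
  have m : ∀ i, pd i P x = lap (fun y => u y i) x - (∑ j, u x j * pd j (fun y => u y i) x)
      - (pd i (fun y => gradSq v y / 2) x + ∑ j, u x j * elas v i j x) := fun i => by
    rw [h.momentum, h.div_elas]
  simp only [e, m, lap_sqSum h.su, elas, Fin.sum_univ_three]
  ring

theorem SmoothSol.energy (h : SmoothSol u P v) {φ : E3 → ℝ} (hφ : TestFn φ) (hφ0 : ∀ x, 0 ≤ φ x) :
    ∫ x, φ x * gradSq u x ≤ (∫ x, sqSum u x / 2 * lap φ x)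
      + (∫ x, (sqSum u x / 2 + gradSq v x / 2) * ∑ i, u x i * pd i φ x)
      + ∫ x, P x * ∑ i, u x i * pd i φ x := by
  have su : Sm (fun x => sqSum u x / 2) := (sm_sqSum h.su).div_const 2
  have sv : Sm (fun x => gradSq v x / 2) := (sm_gradSq h.sv).div_const 2
  have sQ : Sm (fun x => sqSum u x / 2 + gradSq v x / 2 + P x) := (su.add sv).add h.sP
  have g1 : TestFn (fun x => ∑ i, u x i * pd i φ x) :=
    TestFn.sum _ fun i _ => (hφ.pd i).mul_left (h.su i)
  have s1 : Sm (fun x => ∑ i, u x i * pd i (fun y => sqSum u y / 2 + gradSq v y / 2 + P y) x) :=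
    ContDiff.sum fun i _ => (h.su i).mul (sQ.pd i)
  have e1 : ∫ x, φ x * (lap (sqSum u) x / 2) = ∫ x, sqSum u x / 2 * lap φ x := by
    have : ∀ x, sqSum u x / 2 * lap φ x = 2⁻¹ * (sqSum u x * lap φ x) := fun x => by ring
    simp only [this]
    rw [integral_const_mul, ← integral_lap_mul (sm_sqSum h.su) hφ, ← integral_const_mul]
    exact integral_congr_ae (Eventually.of_forall fun x => by simp only; ring)
  have e2 := h.integral_vel_grad hφ sQ
  rw [← e1, add_assoc, ← integral_add ((g1.mul_left (su.add sv)).integrable)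
    (g1.mul_left h.sP).integrable]
  simp only [← add_mul]
  rw [eq_neg_iff_add_eq_zero, add_comm, ← eq_neg_iff_add_eq_zero] at e2
  rw [e2, ← sub_eq_add_neg, ← integral_sub (hφ.mul_right (sm_sqSum h.su).lap |>.mul_right
    (contDiff_const (c := (2 : ℝ)⁻¹)) |>.integrable.congr (Eventually.of_forall fun x => by
      simp only; ring)) (hφ.mul_right s1).integrable]
  refine integral_mono (hφ.mul_right (sm_gradSq h.su)).integrable ?_ fun x => ?_
  · exact (hφ.mul_right (((sm_sqSum h.su).lap.div_const 2).sub s1)).integrable.congr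
      (Eventually.of_forall fun x => by simp only; ring)
  · simp only
    rw [← mul_sub, ← h.energy_pointwise]
    exact mul_le_mul_of_nonneg_left (le_add_of_nonneg_right
      (Finset.sum_nonneg fun k _ => sq_nonneg _)) (hφ0 x)

theorem gradSq_nonneg (v : E3 → Fin 3 → ℝ) (x : E3) : 0 ≤ gradSq v x :=
  Finset.sum_nonneg fun _ _ => Finset.sum_nonneg fun _ _ => sq_nonneg _

theorem sqSum_nonneg (u : E3 → Fin 3 → ℝ) (x : E3) : 0 ≤ sqSum u x :=
  Finset.sum_nonneg fun _ _ => sq_nonneg _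

theorem abs_elas_le (v : E3 → Fin 3 → ℝ) (i j : Fin 3) (x : E3) : |elas v i j x| ≤ gradSq v x := by
  have hs : ∀ i, ∑ k, pd i (fun z => v z k) x ^ 2 ≤ gradSq v x := fun i =>
    Finset.single_le_sum (f := fun i => ∑ k, pd i (fun z => v z k) x ^ 2)
      (fun _ _ => Finset.sum_nonneg fun _ _ => sq_nonneg _) (Finset.mem_univ i)
  have h1 := hs i
  have h2 := hs j
  refine (Finset.abs_sum_le_sum_abs _ _).trans ?_
  have h3 : ∑ k, |pd i (fun z => v z k) x * pd j (fun z => v z k) x| ≤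
      ∑ k, (pd i (fun z => v z k) x ^ 2 + pd j (fun z => v z k) x ^ 2) / 2 :=
    Finset.sum_le_sum fun k _ => by
      rw [abs_le]
      constructor <;> nlinarith [sq_nonneg (pd i (fun z => v z k) x + pd j (fun z => v z k) x),
        sq_nonneg (pd i (fun z => v z k) x - pd j (fun z => v z k) x)]
  rw [← Finset.sum_div, Finset.sum_add_distrib] at h3
  linarith

theorem abs_vel_mul_le (u : E3 → Fin 3 → ℝ) (i j : Fin 3) (x : E3) :
    |u x i * u x j| ≤ sqSum u x := by
  have hs : ∀ i, u x i ^ 2 ≤ sqSum u x := fun i =>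
    Finset.single_le_sum (f := fun i => u x i ^ 2) (fun _ _ => sq_nonneg _) (Finset.mem_univ i)
  have h1 := hs i
  have h2 := hs j
  rw [abs_le]
  constructor <;> nlinarith [sq_nonneg (u x i + u x j), sq_nonneg (u x i - u x j)]

theorem abs_flux_le (u v : E3 → Fin 3 → ℝ) (i j : Fin 3) (x : E3) :
    |flux u v i j x| ≤ sqSum u x + gradSq v x :=
  (abs_add_le _ _).trans (add_le_add (abs_vel_mul_le u i j x) (abs_elas_le v i j x))

theorem sm_coord (i : Fin 3) : Sm fun y : E3 => y i :=
  (EuclideanSpace.proj (𝕜 := ℝ) i).contDiff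

theorem pd_coord (i j : Fin 3) (x : E3) : pd j (fun y : E3 => y i) x = if i = j then 1 else 0 := by
  have : fderiv ℝ (fun y : E3 => y i) x = EuclideanSpace.proj (𝕜 := ℝ) i :=
    (EuclideanSpace.proj (𝕜 := ℝ) i).fderiv
  simp [pd, this]

/-- Pohozaev-type identity for the harmonic map equation. -/
theorem SmoothSol.pohozaev (h : SmoothSol u P v) (hu : ∀ x i, u x i = 0) {φ : E3 → ℝ}
    (hφ : TestFn φ) :
    ∫ x, φ x * gradSq v x = ∫ x, ∑ i, ∑ j, (2 * elas v i j x * (x i * pd j φ x)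
      - if i = j then gradSq v x * (x i * pd j φ x) else 0) := by
  have sg := sm_gradSq h.sv
  have hψ : ∀ i, TestFn fun y => φ y * y i := fun i => hφ.mul_right (sm_coord i)
  have e1 : ∀ i, ∑ j, ∫ x, elas v i j x * pd j (fun y => φ y * y i) x =
      ∫ x, gradSq v x / 2 * pd i (fun y => φ y * y i) x := fun i => by
    rw [integral_mul_pd (sg.div_const 2) (hψ i)]
    simp only [integral_mul_pd (sm_elas h.sv i _) (hψ i), Finset.sum_neg_distrib]
    rw [← integral_finsetSum _ fun j _ => ((hψ i).mul_left ((sm_elas h.sv i j).pd j)).integrable]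
    refine congrArg _ (integral_congr_ae (Eventually.of_forall fun x => ?_))
    have := h.div_elas i x
    simp only [hu, zero_mul, Finset.sum_const_zero, add_zero] at this
    simp only [← Finset.sum_mul, this]
  have t1 : ∀ i j, TestFn fun x => elas v i j x * pd j (fun y => φ y * y i) x :=
    fun i j => ((hψ i).pd j).mul_left (sm_elas h.sv i j)
  have t2 : ∀ i, TestFn fun x => gradSq v x / 2 * pd i (fun y => φ y * y i) x :=
    fun i => ((hψ i).pd i).mul_left (sg.div_const 2)
  have e2 : ∫ x, ∑ i, ((∑ j, elas v i j x * pd j (fun y => φ y * y i) x)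
      - gradSq v x / 2 * pd i (fun y => φ y * y i) x) = 0 := by
    rw [integral_finsetSum _ fun i _ => ((TestFn.sum _ fun j _ => t1 i j).sub (t2 i)).integrable]
    refine Finset.sum_eq_zero fun i _ => ?_
    rw [integral_sub (TestFn.sum _ fun j _ => t1 i j).integrable (t2 i).integrable,
      integral_finsetSum _ fun j _ => (t1 i j).integrable, e1, sub_self]
  have t3 : TestFn fun x => ∑ i, ((∑ j, elas v i j x * pd j (fun y => φ y * y i) x)
      - gradSq v x / 2 * pd i (fun y => φ y * y i) x) :=
    TestFn.sum _ fun i _ => (TestFn.sum _ fun j _ => t1 i j).sub (t2 i)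
  have t4 : TestFn fun x => ∑ i, ∑ j, (2 * elas v i j x * (x i * pd j φ x)
      - if i = j then gradSq v x * (x i * pd j φ x) else 0) := by
    refine TestFn.sum _ fun i _ => TestFn.sum _ fun j _ =>
      (((hφ.pd j).mul_left (sm_coord i)).mul_left (contDiff_const.mul (sm_elas h.sv i j))).sub ?_
    split_ifs
    · exact ((hφ.pd j).mul_left (sm_coord i)).mul_left sg
    · exact ⟨contDiff_const, HasCompactSupport.zero⟩
  have e3 : ∀ x, φ x * gradSq v x = (∑ i, ∑ j, (2 * elas v i j x * (x i * pd j φ x)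
      - if i = j then gradSq v x * (x i * pd j φ x) else 0)) + (-2) * ∑ i,
        ((∑ j, elas v i j x * pd j (fun y => φ y * y i) x)
        - gradSq v x / 2 * pd i (fun y => φ y * y i) x) := fun x => by
    simp only [pd_mul hφ.smooth (sm_coord _), pd_coord, elas, gradSq, Fin.sum_univ_three]
    simp
    ring
  simp only [e3]
  rw [integral_add t4.integrable (t3.integrable.const_mul _), integral_const_mul, e2, mul_zero,
    add_zero]

theorem SmoothSol.gradSq_eq_zero (h : SmoothSol u P v) (hu : ∀ x i, u x i = 0) {C : ℝ}
    (hC : ∀ R : ℝ, 1 ≤ R → ∫ x in ann R, gradSq v x ≤ C) (x : E3) : gradSq v x = 0 := by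
  obtain ⟨K, hK, hb⟩ := exists_cut_bounds
  have sg := sm_gradSq h.sv
  refine eq_zero_of_ball_le_ann sg.continuous (gradSq_nonneg v) (K := 27 * K) (by positivity)
    (fun R hR => ?_) hC x
  have hR0 : 0 < R := by linarith
  have h1 := h.pohozaev hu (testFn_cut hR0)
  have h2 : ∫ x in ball 0 (R / 2), gradSq v x ≤ ∫ x, cut R x * gradSq v x := by
    rw [← setIntegral_congr_fun measurableSet_ball (f := fun x => cut R x * gradSq v x)
      (fun x hx => by
        simp only
        rw [cut_eq_one hR0 (mem_ball_zero_iff.1 hx).le, one_mul])]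
    exact setIntegral_le_integral ((testFn_cut hR0).mul_right sg).integrable
      (Eventually.of_forall fun x => mul_nonneg (cut_nonneg R x) (gradSq_nonneg v x))
  refine h2.trans ?_
  rw [h1, ← integral_const_mul]
  refine (le_abs_self _).trans (abs_integral_le_ann (continuous_const.mul sg.continuous)
    (fun x hx => ?_) fun x hx => ?_)
  · simp [pd_cut_eq_zero hR0 _ hx]
  · have hx1 : ∀ i j, |x i * pd j (cut R) x| ≤ K := fun i j => by
      rw [abs_mul]
      refine (mul_le_mul ((abs_coord_le x i).trans hx.2.le) ((hb R hR0 x).1 j) (abs_nonneg _)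
        hR0.le).trans_eq (by field_simp)
    have h3 : ∀ i j, |2 * elas v i j x * (x i * pd j (cut R) x)
      - if i = j then gradSq v x * (x i * pd j (cut R) x) else 0| ≤ 3 * K * gradSq v x := fun i j => by
      have a1 : |2 * elas v i j x * (x i * pd j (cut R) x)| ≤ 2 * gradSq v x * K := by
        rw [abs_mul, abs_mul, abs_two]
        exact mul_le_mul (mul_le_mul_of_nonneg_left (abs_elas_le v i j x) two_pos.le) (hx1 i j)
          (abs_nonneg _) (mul_nonneg two_pos.le (gradSq_nonneg v x))
      have a2 : |if i = j then gradSq v x * (x i * pd j (cut R) x) else 0| ≤ gradSq v x * K := by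
        split_ifs
        · rw [abs_mul, abs_of_nonneg (gradSq_nonneg v x)]
          exact mul_le_mul_of_nonneg_left (hx1 i j) (gradSq_nonneg v x)
        · simpa using mul_nonneg (gradSq_nonneg v x) hK.le
      refine (abs_sub _ _).trans ?_
      linarith
    refine (Finset.abs_sum_le_sum_abs _ _).trans ?_
    refine (Finset.sum_le_sum fun i _ => (Finset.abs_sum_le_sum_abs _ _).trans
      (Finset.sum_le_sum fun j _ => h3 i j)).trans_eq ?_
    simp
    ring

theorem pd_eq_zero_of_vanish {f : E3 → ℝ} (hf : Sm f) {ρ : ℝ} (hρ : 0 < ρ)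
    (h0 : ∀ x, ρ ≤ ‖x‖ → f x = 0) (j : Fin 3) (x : E3) (hx : ρ ≤ ‖x‖) : pd j f x = 0 := by
  have hc : IsClosed {x | pd j f x = 0} :=
    isClosed_eq (hf.pd j).continuous continuous_const
  have hs : (closedBall (0 : E3) ρ)ᶜ ⊆ {x | pd j f x = 0} := fun y hy => by
    have hev : f =ᶠ[nhds y] fun _ => 0 := by
      filter_upwards [isClosed_closedBall.isOpen_compl.mem_nhds hy] with z hz
      exact h0 z (by simpa using (not_le.1 fun h => hz (by simpa using h)).le)
    change fderiv ℝ f y _ = 0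
    rw [hev.fderiv_eq]; simp
  have h2 := closure_minimal hs hc
  rw [closure_compl, interior_closedBall _ hρ.ne'] at h2
  exact h2 (by simpa using hx)

/-- `|∇v|`. -/
def gradNorm (v : E3 → Fin 3 → ℝ) (x : E3) : ℝ := √(gradSq v x)

theorem gradNorm_nonneg (v : E3 → Fin 3 → ℝ) (x : E3) : 0 ≤ gradNorm v x := Real.sqrt_nonneg _

theorem vecNorm_nonneg (v : E3 → Fin 3 → ℝ) (x : E3) : 0 ≤ vecNorm v x := Real.sqrt_nonneg _

theorem gradNorm_sq (v : E3 → Fin 3 → ℝ) (x : E3) : gradNorm v x ^ 2 = gradSq v x :=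
  Real.sq_sqrt (gradSq_nonneg v x)

theorem vecNorm_sq (u : E3 → Fin 3 → ℝ) (x : E3) : vecNorm u x ^ 2 = sqSum u x :=
  Real.sq_sqrt (sqSum_nonneg u x)

theorem abs_vel_le (u : E3 → Fin 3 → ℝ) (x : E3) (i : Fin 3) : |u x i| ≤ vecNorm u x :=
  Real.abs_le_sqrt (Finset.single_le_sum (f := fun i => u x i ^ 2) (fun _ _ => sq_nonneg _)
    (Finset.mem_univ i))

theorem SmoothSol.cont_vecNorm (h : SmoothSol u P v) : Continuous (vecNorm u) :=
  (sm_sqSum h.su).continuous.sqrt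

theorem SmoothSol.cont_gradNorm (h : SmoothSol u P v) : Continuous (gradNorm v) :=
  (sm_gradSq h.sv).continuous.sqrt

theorem le_add_cube_div {a δ : ℝ} (ha : 0 ≤ a) (hδ : 0 < δ) : a ≤ δ + a ^ 3 / δ ^ 2 := by
  rcases le_total a δ with h | h
  · exact h.trans (le_add_of_nonneg_right (by positivity))
  · refine le_add_of_nonneg_of_le hδ.le ?_
    rw [le_div_iff₀ (by positivity)]
    have : δ ^ 2 ≤ a ^ 2 := by gcongr
    nlinarith

theorem sq_le_add_cube_div {a δ : ℝ} (ha : 0 ≤ a) (hδ : 0 < δ) : a ^ 2 ≤ δ ^ 2 + a ^ 3 / δ := by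
  rcases le_total a δ with h | h
  · exact le_add_of_le_of_nonneg (by gcongr) (by positivity)
  · refine le_add_of_nonneg_of_le (by positivity) ?_
    rw [le_div_iff₀ (by positivity)]
    nlinarith [sq_nonneg a]

theorem sq_mul_le_young {a b t : ℝ} (ha : 0 ≤ a) (hb : 0 ≤ b) (ht : 0 < t) :
    b ^ 2 * a ≤ t * b ^ 3 + a ^ 3 / t ^ 2 := by
  rcases le_total a (t * b) with h | h
  · refine le_add_of_le_of_nonneg ?_ (by positivity)
    nlinarith [mul_le_mul_of_nonneg_left h (sq_nonneg b)]
  · refine le_add_of_nonneg_of_le (by positivity) ?_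
    rw [le_div_iff₀ (by positivity)]
    have : (t * b) ^ 2 ≤ a ^ 2 := by gcongr
    nlinarith [mul_le_mul_of_nonneg_right this ha]

/-- Volume of the unit ball. -/
def ballVol : ℝ := volume.real (ball (0 : E3) 1)

theorem ballVol_nonneg : 0 ≤ ballVol := measureReal_nonneg

theorem volume_real_ball_E3 {R : ℝ} (hR : 0 ≤ R) :
    volume.real (ball (0 : E3) R) = ballVol * R ^ 3 := by
  rw [ballVol, measureReal_def, Measure.addHaar_ball _ _ hR, measureReal_def]
  simp [ENNReal.toReal_ofReal, hR, mul_comm]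

theorem integral_ball_le_of_pow {a : E3 → ℝ} (hc : Continuous a) (ha : ∀ x, 0 ≤ a x) {ρ δ : ℝ}
    (hρ : 0 ≤ ρ) (hδ : 0 < δ) :
    ∫ x in ball 0 ρ, a x ≤ δ * (ballVol * ρ ^ 3) + (∫ x in ball 0 ρ, a x ^ 3) / δ ^ 2 := by
  have h1 : ∫ x in ball 0 ρ, a x ≤ ∫ x in ball 0 ρ, (δ + a x ^ 3 / δ ^ 2) :=
    setIntegral_mono (integrableOn_ball hc ρ) (integrableOn_ball (by fun_prop) ρ)
      fun x => le_add_cube_div (ha x) hδ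
  rw [integral_add (integrableOn_ball continuous_const ρ) (integrableOn_ball (by fun_prop) ρ),
    integral_div, setIntegral_const, volume_real_ball_E3 hρ, smul_eq_mul, mul_comm _ δ] at h1
  exact h1

theorem integral_ball_sq_le_of_pow {a : E3 → ℝ} (hc : Continuous a) (ha : ∀ x, 0 ≤ a x) {ρ δ : ℝ}
    (hρ : 0 ≤ ρ) (hδ : 0 < δ) :
    ∫ x in ball 0 ρ, a x ^ 2 ≤ δ ^ 2 * (ballVol * ρ ^ 3) + (∫ x in ball 0 ρ, a x ^ 3) / δ := by
  have h1 : ∫ x in ball 0 ρ, a x ^ 2 ≤ ∫ x in ball 0 ρ, (δ ^ 2 + a x ^ 3 / δ) :=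
    setIntegral_mono (integrableOn_ball (by fun_prop) ρ) (integrableOn_ball (by fun_prop) ρ)
      fun x => sq_le_add_cube_div (ha x) hδ
  rw [integral_add (integrableOn_ball continuous_const ρ) (integrableOn_ball (by fun_prop) ρ),
    integral_div, setIntegral_const, volume_real_ball_E3 hρ, smul_eq_mul, mul_comm _ (δ ^ 2)] at h1
  exact h1

/-- Smallness of the velocity and boundedness of the director gradient, in `L³` of the ball of
radius `2 r³`. -/
structure SmallAt (u v : E3 → Fin 3 → ℝ) (B r ε : ℝ) : Prop where
  one_le : 1 ≤ r
  pos : 0 < ε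
  le_one : ε ≤ 1
  vel : ∫ x in ball 0 (2 * r ^ 3), vecNorm u x ^ 3 ≤ ε ^ 3 * r ^ 3
  dir : ∫ x in ball 0 (2 * r ^ 3), gradNorm v x ^ 3 ≤ B * r ^ 3

theorem SmallAt.r_pos (s : SmallAt u v B r ε) : 0 < r := by linarith [s.one_le]

theorem SmallAt.R_pos (s : SmallAt u v B r ε) : 0 < r ^ 3 := pow_pos s.r_pos 3

theorem SmallAt.integral_vel (s : SmallAt u v B r ε) (h : SmoothSol u P v) :
    ∫ x in ball 0 (2 * r ^ 3), vecNorm u x ≤ (8 * ballVol + 1) * ε * r ^ 7 := by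
  have hr := s.r_pos
  have hε := s.pos
  refine (integral_ball_le_of_pow h.cont_vecNorm (vecNorm_nonneg u) (δ := ε / r ^ 2)
    (by positivity) (by positivity)).trans ?_
  have h1 : (∫ x in ball 0 (2 * r ^ 3), vecNorm u x ^ 3) / (ε / r ^ 2) ^ 2 ≤
    (ε ^ 3 * r ^ 3) / (ε / r ^ 2) ^ 2 := by gcongr; exact s.vel
  refine (add_le_add_right h1 _).trans_eq ?_
  field_simp
  ring

theorem SmallAt.integral_vel_sq (s : SmallAt u v B r ε) (h : SmoothSol u P v) :
    ∫ x in ball 0 (2 * r ^ 3), sqSum u x ≤ (8 * ballVol + 1) * ε * r ^ 5 := by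
  have hr := s.r_pos
  have hε := s.pos
  simp only [← vecNorm_sq]
  refine (integral_ball_sq_le_of_pow h.cont_vecNorm (vecNorm_nonneg u) (δ := ε / r ^ 2)
    (by positivity) (by positivity)).trans ?_
  have h1 : (∫ x in ball 0 (2 * r ^ 3), vecNorm u x ^ 3) / (ε / r ^ 2) ≤
    (ε ^ 3 * r ^ 3) / (ε / r ^ 2) := by gcongr; exact s.vel
  refine (add_le_add_right h1 _).trans ?_
  have h2 : (8 * ballVol + 1) * ε * r ^ 5 - ((ε / r ^ 2) ^ 2 * (ballVol * (2 * r ^ 3) ^ 3)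
    + (ε ^ 3 * r ^ 3) / (ε / r ^ 2)) = (8 * ballVol + 1) * (ε * (1 - ε)) * r ^ 5 := by
    field_simp; ring
  have h3 : 0 ≤ (8 * ballVol + 1) * (ε * (1 - ε)) * r ^ 5 := by
    have := s.le_one
    have := ballVol_nonneg
    have : 0 ≤ 1 - ε := by linarith
    positivity
  linarith

theorem SmallAt.integral_grad_sq (s : SmallAt u v B r ε) (h : SmoothSol u P v) :
    ∫ x in ball 0 (2 * r ^ 3), gradSq v x ≤ (8 * ballVol + B) * r ^ 5 := by
  have hr := s.r_pos
  simp only [← gradNorm_sq]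
  refine (integral_ball_sq_le_of_pow h.cont_gradNorm (gradNorm_nonneg v) (δ := 1 / r ^ 2)
    (by positivity) (by positivity)).trans ?_
  have h1 : (∫ x in ball 0 (2 * r ^ 3), gradNorm v x ^ 3) / (1 / r ^ 2) ≤
    (B * r ^ 3) / (1 / r ^ 2) := by gcongr; exact s.dir
  refine (add_le_add_right h1 _).trans_eq ?_
  field_simp
  ring

theorem SmallAt.integral_flux (s : SmallAt u v B r ε) (h : SmoothSol u P v) :
    ∫ x in ball 0 (2 * r ^ 3), (sqSum u x + gradSq v x) ≤ (16 * ballVol + B + 1) * r ^ 5 := by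
  have hr := s.r_pos
  rw [integral_add (integrableOn_ball (sm_sqSum h.su).continuous _)
    (integrableOn_ball (sm_gradSq h.sv).continuous _)]
  have h1 : (8 * ballVol + 1) * ε * r ^ 5 ≤ (8 * ballVol + 1) * 1 * r ^ 5 := by
    have := ballVol_nonneg
    gcongr
    exact s.le_one
  linarith [s.integral_vel_sq h, s.integral_grad_sq h]

/-- `|u||∇v|²` and `|u|³` together. -/
theorem SmallAt.integral_young (s : SmallAt u v B r ε) (h : SmoothSol u P v) :
    ∫ x in ball 0 (2 * r ^ 3), (vecNorm u x ^ 3 + gradNorm v x ^ 2 * vecNorm u x) ≤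
      (B + 2) * ε * r ^ 3 := by
  have hr := s.r_pos
  have hε := s.pos
  have cu := h.cont_vecNorm
  have cv := h.cont_gradNorm
  have h1 : ∫ x in ball 0 (2 * r ^ 3), (vecNorm u x ^ 3 + gradNorm v x ^ 2 * vecNorm u x) ≤
      ∫ x in ball 0 (2 * r ^ 3), ((1 + (ε ^ 2)⁻¹) * vecNorm u x ^ 3 + ε * gradNorm v x ^ 3) := by
    refine setIntegral_mono (integrableOn_ball (by fun_prop) _) (integrableOn_ball (by fun_prop) _)
      fun x => ?_
    have := sq_mul_le_young (vecNorm_nonneg u x) (gradNorm_nonneg v x) hε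
    simp only
    rw [div_eq_inv_mul] at this
    linarith
  rw [integral_add (f := fun x => (1 + (ε ^ 2)⁻¹) * vecNorm u x ^ 3)
    (integrableOn_ball (by fun_prop) _) (integrableOn_ball (by fun_prop) _),
    integral_const_mul, integral_const_mul] at h1
  have h2 : (1 + (ε ^ 2)⁻¹) * ∫ x in ball 0 (2 * r ^ 3), vecNorm u x ^ 3 ≤
      (1 + (ε ^ 2)⁻¹) * (ε ^ 3 * r ^ 3) := mul_le_mul_of_nonneg_left s.vel (by positivity)
  have h3 := mul_le_mul_of_nonneg_left s.dir hε.le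
  have h4 : (1 + (ε ^ 2)⁻¹) * (ε ^ 3 * r ^ 3) = ε ^ 3 * r ^ 3 + ε * r ^ 3 := by field_simp
  have h5 : ε ^ 3 * r ^ 3 ≤ ε * r ^ 3 := by
    have : ε ^ 3 ≤ ε ^ 1 := pow_le_pow_of_le_one hε.le s.le_one (by norm_num)
    rw [pow_one] at this
    gcongr
  linarith

theorem SmallAt.ball_le (s : SmallAt u v B r ε) {f : E3 → ℝ} (hf : Continuous f)
    (h0 : ∀ x, 0 ≤ f x) : ∫ x in ball 0 (r ^ 3), f x ≤ ∫ x in ball 0 (2 * r ^ 3), f x :=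
  setIntegral_ball_mono hf h0 (by linarith [s.R_pos])

/-- The flux `u · ∇φ` of the cutoff at scale `R`. -/
def cutFlux (u : E3 → Fin 3 → ℝ) (R : ℝ) (x : E3) : ℝ := ∑ i, u x i * pd i (cut R) x

theorem SmoothSol.testFn_cutFlux (h : SmoothSol u P v) {R : ℝ} (hR : 0 < R) :
    TestFn (cutFlux u R) :=
  TestFn.sum _ fun i _ => ((testFn_cut hR).pd i).mul_left (h.su i)

theorem cutFlux_eq_zero (u : E3 → Fin 3 → ℝ) {R : ℝ} (hR : 0 < R) {x : E3} (hx : R ≤ ‖x‖) :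
    cutFlux u R x = 0 := by simp [cutFlux, pd_cut_eq_zero_of_le hR _ hx]

theorem SmoothSol.cutFlux_eq_div (h : SmoothSol u P v) {R : ℝ} (hR : 0 < R) (x : E3) :
    cutFlux u R x = ∑ i, pd i (fun y => u y i * cut R y) x := by
  have hd := h.sol.2.2 x
  simp only [cutFlux, pd_mul (h.su _) (testFn_cut hR).smooth, Fin.sum_univ_three] at hd ⊢
  linear_combination (- cut R x) * hd

theorem abs_cutFlux_le {K : ℝ} {R : ℝ} {x : E3} (hb : ∀ j, |pd j (cut R) x| ≤ K / R) :
    |cutFlux u R x| ≤ 3 * (K / R) * vecNorm u x := by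
  refine (Finset.abs_sum_le_sum_abs _ _).trans ?_
  refine (Finset.sum_le_sum (g := fun _ => vecNorm u x * (K / R)) fun i _ => ?_).trans_eq ?_
  · rw [abs_mul]
    exact mul_le_mul (abs_vel_le u x i) (hb i) (abs_nonneg _) (vecNorm_nonneg u x)
  · simp; ring

theorem avg_sum {ι : Type*} (s : Finset ι) {χ : E3 → ℝ} (hχ : TestFn χ) (R : ℝ) {f : ι → E3 → ℝ}
    (hf : ∀ i ∈ s, TestFn (f i)) (x : E3) :
    avg χ R (fun y => ∑ i ∈ s, f i y) x = ∑ i ∈ s, avg χ R (f i) x := by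
  simp only [avg, wavg, Finset.mul_sum]
  exact integral_finsetSum _ fun i hi => integrable_wavg hχ.integrable (aesm_smul R) (hf i hi) x

theorem exists_psiK_bounds : ∃ K : ℝ, 0 ≤ K ∧ ∀ j x,
    |pd j psiK x| ≤ K ∧ |pd j (pd j psiK) x| ≤ K := by
  have h1 := fun j => (testFn_psiK.pd j).bdd
  have h2 := fun j => ((testFn_psiK.pd j).pd j).bdd
  choose a ha using h1
  choose b hb using h2
  have sa : ∀ j, |a j| ≤ ∑ j, |a j| := fun j =>
    Finset.single_le_sum (f := fun j => |a j|) (fun _ _ => abs_nonneg _) (Finset.mem_univ j)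
  have sb : ∀ j, |b j| ≤ ∑ j, |b j| := fun j =>
    Finset.single_le_sum (f := fun j => |b j|) (fun _ _ => abs_nonneg _) (Finset.mem_univ j)
  have pa : 0 ≤ ∑ j, |a j| := Finset.sum_nonneg fun _ _ => abs_nonneg _
  have pb : 0 ≤ ∑ j, |b j| := Finset.sum_nonneg fun _ _ => abs_nonneg _
  refine ⟨(∑ j, |a j|) + ∑ j, |b j|, by positivity, fun j x => ⟨?_, ?_⟩⟩
  · linarith [ha j x, le_abs_self (a j), sa j]
  · linarith [hb j x, le_abs_self (b j), sb j]

theorem pd_pd_avg_kernel {χ h : E3 → ℝ} (hχ : TestFn χ) (hh : TestFn h) {R : ℝ} (hR : R ≠ 0)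
    (k : Fin 3) (x : E3) : pd k (pd k (avg χ R h)) x = R⁻¹ * (R⁻¹ * avg (pd k (pd k χ)) R h x) := by
  have e : pd k (avg χ R h) = fun y => R⁻¹ * avg (pd k χ) R h y :=
    funext fun y => pd_avg_kernel hχ hh hR k y
  rw [e, pd_const_mul (f := avg (pd k χ) R h) (contDiff_wavg (hχ.pd k).integrable (aesm_smul R) hh),
    pd_avg_kernel (hχ.pd k) hh hR]

theorem SmallAt.integral_abs_vel_cut (s : SmallAt u v B r ε) (h : SmoothSol u P v) (i : Fin 3) :
    ∫ x, |u x i * cut (r ^ 3) x| ≤ (8 * ballVol + 1) * ε * r ^ 7 := by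
  have h1 := abs_integral_le_ball (f := fun x => |u x i * cut (r ^ 3) x|) (R := r ^ 3)
    h.cont_vecNorm (fun x hx => by simp [cut_eq_zero s.R_pos hx]) fun x _ => by
      rw [abs_abs, abs_mul, abs_of_nonneg (cut_nonneg _ x)]
      exact (mul_le_of_le_one_right (abs_nonneg _) (cut_le_one _ x)).trans (abs_vel_le u x i)
  exact (le_abs_self _).trans (h1.trans ((s.ball_le h.cont_vecNorm (vecNorm_nonneg u)).trans
    (s.integral_vel h)))

/-- The low-frequency part of the pressure term. -/
theorem SmoothSol.exists_pressure_avg_le (h : SmoothSol u P v) (B : ℝ) :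
    ∃ C : ℝ, ∀ r ε, SmallAt u v B r ε →
      |∫ x, P x * avg psiK (r ^ 3) (cutFlux u (r ^ 3)) x| ≤ C * ε := by
  obtain ⟨K, hK, hb⟩ := exists_psiK_bounds
  set A := 8 * ballVol + 1 with hA
  have hA0 : 0 ≤ A := by have := ballVol_nonneg; positivity
  refine ⟨3 * (3 * K * A ^ 2) + 9 * (K * A * (16 * ballVol + B + 1)), fun r ε s => ?_⟩
  have hr := s.r_pos
  have hε := s.pos
  have hR := s.R_pos
  have hh : ∀ i, TestFn fun y => u y i * cut (r ^ 3) y := fun i => (testFn_cut hR).mul_left (h.su i)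
  have hh0 : ∀ i x, r ^ 3 ≤ ‖x‖ → u x i * cut (r ^ 3) x = 0 := fun i x hx => by
    simp [cut_eq_zero hR hx]
  have hψ : ∀ i, TestFn (avg psiK (r ^ 3) fun y => u y i * cut (r ^ 3) y) := fun i =>
    testFn_avg testFn_psiK (fun y => psiK_eq_zero) (hh i) hR (hh0 i)
  have hψ0 : ∀ i x, 2 * r ^ 3 ≤ ‖x‖ → avg psiK (r ^ 3) (fun y => u y i * cut (r ^ 3) y) x = 0 :=
    fun i x hx => avg_eq_zero (fun y => psiK_eq_zero) hR (hh0 i) hx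
  have hdiv : ∀ x, avg psiK (r ^ 3) (cutFlux u (r ^ 3)) x =
      ∑ i, pd i (avg psiK (r ^ 3) fun y => u y i * cut (r ^ 3) y) x := fun x => by
    rw [funext (h.cutFlux_eq_div hR), avg_sum _ testFn_psiK _ fun i _ => (hh i).pd i]
    exact Finset.sum_congr rfl fun i _ => (pd_avg testFn_psiK (hh i) _ i x).symm
  have hI := s.integral_abs_vel_cut h
  have b1 : ∀ i j x, |pd j (avg psiK (r ^ 3) fun y => u y i * cut (r ^ 3) y) x| ≤
      K * A * ε / r ^ 5 := fun i j x => by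
    rw [pd_avg_kernel testFn_psiK (hh i) hR.ne', abs_mul, abs_of_pos (inv_pos.2 hR)]
    have h1 := abs_avg_le (fun x => (hb j x).1) (hh i) hR x
    have h2 : K * (((r ^ 3) ^ 3)⁻¹ * ∫ y, |u y i * cut (r ^ 3) y|) ≤
      K * (((r ^ 3) ^ 3)⁻¹ * (A * ε * r ^ 7)) := by gcongr; exact hI i
    refine (mul_le_mul_of_nonneg_left (h1.trans h2) (inv_pos.2 hR).le).trans_eq ?_
    field_simp
  have b2 : ∀ i x, |lap (avg psiK (r ^ 3) fun y => u y i * cut (r ^ 3) y) x| ≤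
      3 * K * A * ε / r ^ 8 := fun i x => by
    refine (Finset.abs_sum_le_sum_abs _ _).trans ?_
    refine (Finset.sum_le_sum (g := fun _ => K * A * ε / r ^ 8) fun j _ => ?_).trans_eq
      (by simp; ring)
    rw [pd_pd_avg_kernel testFn_psiK (hh i) hR.ne', abs_mul, abs_mul, abs_of_pos (inv_pos.2 hR)]
    have h1 := abs_avg_le (fun x => (hb j x).2) (hh i) hR x
    have h2 : K * (((r ^ 3) ^ 3)⁻¹ * ∫ y, |u y i * cut (r ^ 3) y|) ≤
      K * (((r ^ 3) ^ 3)⁻¹ * (A * ε * r ^ 7)) := by gcongr; exact hI i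
    refine (mul_le_mul_of_nonneg_left (mul_le_mul_of_nonneg_left (h1.trans h2) (inv_pos.2 hR).le)
      (inv_pos.2 hR).le).trans_eq ?_
    field_simp
  have hR2 : 0 < 2 * r ^ 3 := by positivity
  have t1 : ∀ i, |∫ x, u x i * lap (avg psiK (r ^ 3) fun y => u y i * cut (r ^ 3) y) x| ≤
      3 * K * A ^ 2 * ε := fun i => by
    have h1 := abs_integral_le_ball
      (f := fun x => u x i * lap (avg psiK (r ^ 3) fun y => u y i * cut (r ^ 3) y) x)
      (G := fun x => 3 * K * A * ε / r ^ 8 * vecNorm u x) (R := 2 * r ^ 3)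
      (continuous_const.mul h.cont_vecNorm) (fun x hx => by
        have : lap (avg psiK (r ^ 3) fun y => u y i * cut (r ^ 3) y) x = 0 :=
          Finset.sum_eq_zero fun j _ => pd_eq_zero_of_vanish ((hψ i).smooth.pd j) hR2
            (pd_eq_zero_of_vanish (hψ i).smooth hR2 (hψ0 i) j) j x hx
        rw [this, mul_zero]) fun x _ => by
        rw [abs_mul, mul_comm]
        exact mul_le_mul (b2 i x) (abs_vel_le u x i) (abs_nonneg _) (by positivity)
    rw [integral_const_mul] at h1
    refine h1.trans ((mul_le_mul_of_nonneg_left (s.integral_vel h) (by positivity)).trans ?_)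
    rw [← hA]
    have e : 3 * K * A * ε / r ^ 8 * (A * ε * r ^ 7) = 3 * K * A ^ 2 * ε * (ε / r) := by
      field_simp
    rw [e]
    exact mul_le_of_le_one_right (by positivity)
      ((div_le_one hr).2 (s.le_one.trans s.one_le))
  have t2 : ∀ i j, |∫ x, flux u v i j x * pd j (avg psiK (r ^ 3) fun y => u y i * cut (r ^ 3) y) x| ≤
      K * A * (16 * ballVol + B + 1) * ε := fun i j => by
    have h1 := abs_integral_le_ball
      (f := fun x => flux u v i j x * pd j (avg psiK (r ^ 3) fun y => u y i * cut (r ^ 3) y) x)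
      (G := fun x => K * A * ε / r ^ 5 * (sqSum u x + gradSq v x)) (R := 2 * r ^ 3)
      (continuous_const.mul ((sm_sqSum h.su).continuous.add (sm_gradSq h.sv).continuous))
      (fun x hx => by
        rw [pd_eq_zero_of_vanish (hψ i).smooth hR2 (hψ0 i) j x hx, mul_zero]) fun x _ => by
        rw [abs_mul, mul_comm]
        exact mul_le_mul (b1 i j x) (abs_flux_le u v i j x) (abs_nonneg _) (by positivity)
    rw [integral_const_mul] at h1
    refine h1.trans ((mul_le_mul_of_nonneg_left (s.integral_flux h) (by positivity)).trans_eq ?_)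
    field_simp
  simp only [hdiv]
  rw [h.integral_pressure_div hψ]
  refine (abs_sub _ _).trans ?_
  rw [abs_neg]
  have s1 := (Finset.abs_sum_le_sum_abs _ _).trans (Finset.sum_le_sum fun i (_ : i ∈ Finset.univ) => t1 i)
  have s2 := (Finset.abs_sum_le_sum_abs _ _).trans (Finset.sum_le_sum fun i (_ : i ∈ Finset.univ) =>
    (Finset.abs_sum_le_sum_abs _ _).trans (Finset.sum_le_sum fun j (_ : j ∈ Finset.univ) => t2 i j))
  simp only [Finset.sum_const, Finset.card_univ, Fintype.card_fin, nsmul_eq_mul] at s1 s2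
  push_cast at s1 s2
  linarith

theorem lap_pd {f : E3 → ℝ} (hf : Sm f) (i : Fin 3) (x : E3) : lap (pd i f) x = pd i (lap f) x := by
  unfold lap
  rw [pd_sum _ fun j _ => (hf.pd j).pd j]
  refine Finset.sum_congr rfl fun j _ => ?_
  rw [pd_comm (hf.pd j) i j]
  congr 1
  exact funext fun y => pd_comm hf j i y

theorem SmoothSol.sum_integral_vel_pd (h : SmoothSol u P v) {g : E3 → ℝ} (hg : TestFn g) :
    ∑ i, ∫ x, u x i * pd i g x = 0 := by
  simp only [integral_mul_pd (h.su _) hg, Finset.sum_neg_distrib]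
  rw [← integral_finsetSum _ fun i _ => (hg.mul_left ((h.su i).pd i)).integrable]
  simp [← Finset.sum_mul, h.sol.2.2]

theorem SmoothSol.integral_pressure_lap (h : SmoothSol u P v) {M : E3 → ℝ} (hM : TestFn M) :
    ∫ x, P x * lap M x = - ∑ i, ∑ j, ∫ x, flux u v i j x * pd j (pd i M) x := by
  have h1 := h.integral_pressure_div fun i => hM.pd i
  simp only [lap_pd hM.smooth, h.sum_integral_vel_pd hM.lap, neg_zero, zero_sub] at h1
  exact h1

theorem TestFn.lintegral_enorm_cube {f : E3 → ℝ} (hf : TestFn f) :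
    Integrable (fun x => |f x| ^ 3) ∧ ∫⁻ x, ‖f x‖ₑ ^ 3 = ENNReal.ofReal (∫ x, |f x| ^ 3) := by
  have hi : Integrable (fun x => |f x| ^ 3) := by
    refine Continuous.integrable_of_hasCompactSupport (by have := hf.smooth.continuous; fun_prop) ?_
    exact hf.supp.comp_left (g := fun t => |t| ^ 3) (by simp)
  refine ⟨hi, ?_⟩
  rw [ofReal_integral_eq_lintegral_ofReal hi (Eventually.of_forall fun x => by positivity)]
  refine lintegral_congr fun x => ?_
  rw [Real.enorm_eq_ofReal_abs, ENNReal.ofReal_pow (abs_nonneg _)]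

theorem exists_integral_pot_hessian : ∃ C : ℝ, 0 ≤ C ∧ ∀ R : ℝ, 0 < R → ∀ g : E3 → ℝ, TestFn g →
    (∀ x, R ≤ ‖x‖ → g x = 0) → ∀ i k : Fin 3,
    ∫ x, |pd i (pd k (pot R g)) x| ^ 3 ≤ C * ∫ x, |g x| ^ 3 := by
  obtain ⟨C, hC⟩ := exists_pot_hessian
  refine ⟨C, C.coe_nonneg, fun R hR g hg hgR i k => ?_⟩
  have h1 := hC R hR g hg hgR i k
  rw [(((testFn_pot hg hgR).pd k).pd i).lintegral_enorm_cube.2, hg.lintegral_enorm_cube.2,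
    ← ENNReal.ofReal_coe_nnreal, ← ENNReal.ofReal_mul C.coe_nonneg, ENNReal.ofReal_le_ofReal_iff] at h1
  · exact h1
  · exact mul_nonneg C.coe_nonneg (integral_nonneg fun x => by positivity)

/-- The high-frequency part of the pressure term. -/
theorem SmoothSol.exists_pressure_pot_le (h : SmoothSol u P v) (B : ℝ) :
    ∃ C : ℝ, ∀ r ε, SmallAt u v B r ε →
      |∫ x, P x * lap (pot (r ^ 3) (cutFlux u (r ^ 3))) x| ≤ C * ε := by
  obtain ⟨K, hK, hb⟩ := exists_cut_bounds
  obtain ⟨D, hD, hpot⟩ := exists_integral_pot_hessian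
  refine ⟨9 * (1 + B + 54 * D * K ^ 3), fun r ε s => ?_⟩
  have hr := s.r_pos
  have hε := s.pos
  have hR := s.R_pos
  have cu := h.cont_vecNorm
  have cv := h.cont_gradNorm
  have hg := h.testFn_cutFlux hR
  have hg0 : ∀ x, r ^ 3 ≤ ‖x‖ → cutFlux u (r ^ 3) x = 0 := fun x => cutFlux_eq_zero u hR
  have hM := testFn_pot hg hg0
  have hM0 : ∀ x, 2 * r ^ 3 ≤ ‖x‖ → pot (r ^ 3) (cutFlux u (r ^ 3)) x = 0 := fun x =>
    pot_eq_zero hg0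
  have hR2 : 0 < 2 * r ^ 3 := by positivity
  have hgI : ∫ x, |cutFlux u (r ^ 3) x| ^ 3 ≤ 27 * K ^ 3 * ε ^ 3 / r ^ 6 := by
    have h1 := abs_integral_le_ball (f := fun x => |cutFlux u (r ^ 3) x| ^ 3) (R := 2 * r ^ 3)
      (G := fun x => 27 * K ^ 3 / r ^ 9 * vecNorm u x ^ 3) (by fun_prop)
      (fun x hx => by simp [hg0 x (by linarith)]) fun x _ => by
        rw [abs_of_nonneg (by positivity)]
        refine (pow_le_pow_left₀ (abs_nonneg _) (abs_cutFlux_le (hb _ hR x).1) 3).trans_eq ?_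
        field_simp
        ring
    rw [integral_const_mul] at h1
    refine (le_abs_self _).trans (h1.trans
      ((mul_le_mul_of_nonneg_left s.vel (by positivity)).trans_eq ?_))
    field_simp
  have t : ∀ i j, |∫ x, flux u v i j x * pd j (pd i (pot (r ^ 3) (cutFlux u (r ^ 3)))) x| ≤
      (1 + B + 54 * D * K ^ 3) * ε := fun i j => by
    have hm := (hM.pd i).pd j
    have cm := hm.smooth.continuous
    have h1 := abs_integral_le_ball
      (f := fun x => flux u v i j x * pd j (pd i (pot (r ^ 3) (cutFlux u (r ^ 3)))) x)
      (G := fun x => ε / r ^ 3 * vecNorm u x ^ 3 + ε / r ^ 3 * gradNorm v x ^ 3 +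
        2 / (ε / r ^ 3) ^ 2 * |pd j (pd i (pot (r ^ 3) (cutFlux u (r ^ 3)))) x| ^ 3)
      (R := 2 * r ^ 3) (by fun_prop)
      (fun x hx => by
        rw [pd_eq_zero_of_vanish (hM.pd i).smooth hR2
          (pd_eq_zero_of_vanish hM.smooth hR2 hM0 i) j x hx, mul_zero]) fun x _ => by
        have y1 := sq_mul_le_young (abs_nonneg (pd j (pd i (pot (r ^ 3) (cutFlux u (r ^ 3)))) x))
          (vecNorm_nonneg u x) (t := ε / r ^ 3) (by positivity)
        have y2 := sq_mul_le_young (abs_nonneg (pd j (pd i (pot (r ^ 3) (cutFlux u (r ^ 3)))) x))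
          (gradNorm_nonneg v x) (t := ε / r ^ 3) (by positivity)
        have y3 := mul_le_mul_of_nonneg_right (abs_flux_le u v i j x)
          (abs_nonneg (pd j (pd i (pot (r ^ 3) (cutFlux u (r ^ 3)))) x))
        rw [← vecNorm_sq, ← gradNorm_sq] at y3
        rw [abs_mul]
        refine y3.trans ?_
        rw [div_eq_mul_inv _ ((ε / r ^ 3) ^ 2)] at y1 y2 ⊢
        linarith
    rw [integral_add (f := fun x => ε / r ^ 3 * vecNorm u x ^ 3 + ε / r ^ 3 * gradNorm v x ^ 3)
      (integrableOn_ball (by fun_prop) _) (integrableOn_ball (by fun_prop) _),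
      integral_add (integrableOn_ball (by fun_prop) _) (integrableOn_ball (by fun_prop) _),
      integral_const_mul, integral_const_mul, integral_const_mul] at h1
    refine h1.trans ?_
    have z1 := mul_le_mul_of_nonneg_left s.vel (show 0 ≤ ε / r ^ 3 by positivity)
    have z2 := mul_le_mul_of_nonneg_left s.dir (show 0 ≤ ε / r ^ 3 by positivity)
    have z3 : ∫ x in ball 0 (2 * r ^ 3), |pd j (pd i (pot (r ^ 3) (cutFlux u (r ^ 3)))) x| ^ 3 ≤
        D * (27 * K ^ 3 * ε ^ 3 / r ^ 6) :=
      (setIntegral_le_integral hm.lintegral_enorm_cube.1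
        (Eventually.of_forall fun x => by positivity)).trans
        ((hpot _ hR _ hg hg0 j i).trans (mul_le_mul_of_nonneg_left hgI hD))
    have z4 := mul_le_mul_of_nonneg_left z3 (show 0 ≤ 2 / (ε / r ^ 3) ^ 2 by positivity)
    have e1 : ε / r ^ 3 * (ε ^ 3 * r ^ 3) = ε ^ 4 := by field_simp
    have e2 : ε / r ^ 3 * (B * r ^ 3) = B * ε := by field_simp
    have e3 : 2 / (ε / r ^ 3) ^ 2 * (D * (27 * K ^ 3 * ε ^ 3 / r ^ 6)) = 54 * D * K ^ 3 * ε := by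
      field_simp; ring
    have e4 : ε ^ 4 ≤ ε := by
      simpa using pow_le_pow_of_le_one hε.le s.le_one (show 1 ≤ 4 by norm_num)
    rw [e1] at z1
    rw [e2] at z2
    rw [e3] at z4
    linarith
  rw [h.integral_pressure_lap hM, abs_neg]
  have s2 := (Finset.abs_sum_le_sum_abs _ _).trans (Finset.sum_le_sum fun i (_ : i ∈ Finset.univ) =>
    (Finset.abs_sum_le_sum_abs _ _).trans (Finset.sum_le_sum fun j (_ : j ∈ Finset.univ) => t i j))
  simp only [Finset.sum_const, Finset.card_univ, Fintype.card_fin, nsmul_eq_mul] at s2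
  push_cast at s2
  linarith

theorem SmoothSol.exists_pressure_le (h : SmoothSol u P v) (B : ℝ) :
    ∃ C : ℝ, ∀ r ε, SmallAt u v B r ε → |∫ x, P x * cutFlux u (r ^ 3) x| ≤ C * ε := by
  obtain ⟨C₁, h1⟩ := h.exists_pressure_avg_le B
  obtain ⟨C₂, h2⟩ := h.exists_pressure_pot_le B
  have hc := integral_psiK_pos
  refine ⟨(C₁ + C₂) / ∫ y, psiK y, fun r ε s => ?_⟩
  have hR := s.R_pos
  have hg := h.testFn_cutFlux hR
  have hg0 : ∀ x, r ^ 3 ≤ ‖x‖ → cutFlux u (r ^ 3) x = 0 := fun x => cutFlux_eq_zero u hR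
  have e : (∫ y, psiK y) * ∫ x, P x * cutFlux u (r ^ 3) x =
      (∫ x, P x * avg psiK (r ^ 3) (cutFlux u (r ^ 3)) x) +
        ∫ x, P x * lap (pot (r ^ 3) (cutFlux u (r ^ 3))) x := by
    rw [← integral_add, ← integral_const_mul]
    · refine integral_congr_ae (Eventually.of_forall fun x => ?_)
      simp only
      rw [← mul_add, ← lap_pot hR hg]; ring
    · exact ((testFn_avg testFn_psiK (fun y => psiK_eq_zero) hg hR hg0).mul_left h.sP).integrable
    · exact ((testFn_pot hg hg0).lap.mul_left h.sP).integrable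
  have e2 := congrArg abs e
  rw [abs_mul, abs_of_pos hc] at e2
  rw [div_mul_eq_mul_div, le_div_iff₀ hc, mul_comm, e2]
  refine (abs_add_le _ _).trans ?_
  linarith [h1 r ε s, h2 r ε s]

theorem SmoothSol.exists_energy_le (h : SmoothSol u P v) (B : ℝ) :
    ∃ C : ℝ, ∀ r ε, SmallAt u v B r ε → ∫ x in ball 0 (r ^ 3 / 2), gradSq u x ≤ C * ε := by
  obtain ⟨C, hC⟩ := h.exists_pressure_le B
  obtain ⟨K, hK, hb⟩ := exists_cut_bounds
  refine ⟨K * (8 * ballVol + 1) + 3 * K * (B + 2) + C, fun r ε s => ?_⟩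
  have hr := s.r_pos
  have hε := s.pos
  have hR := s.R_pos
  have cu := h.cont_vecNorm
  have cv := h.cont_gradNorm
  have csu := (sm_sqSum h.su).continuous
  have csv := (sm_gradSq h.sv).continuous
  have h1 : ∫ x in ball 0 (r ^ 3 / 2), gradSq u x ≤ ∫ x, cut (r ^ 3) x * gradSq u x := by
    rw [← setIntegral_congr_fun measurableSet_ball (f := fun x => cut (r ^ 3) x * gradSq u x)
      (fun x hx => by
        simp only
        rw [cut_eq_one hR (mem_ball_zero_iff.1 hx).le, one_mul])]
    exact setIntegral_le_integral ((testFn_cut hR).mul_right (sm_gradSq h.su)).integrable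
      (Eventually.of_forall fun x => mul_nonneg (cut_nonneg _ x) (gradSq_nonneg u x))
  have h2 := h.energy (testFn_cut hR) (cut_nonneg _)
  have t1 := abs_integral_le_ball (f := fun x => sqSum u x / 2 * lap (cut (r ^ 3)) x)
    (G := fun x => K / r ^ 6 * sqSum u x) (R := 2 * r ^ 3) (by fun_prop) (fun x hx => by
      have : lap (cut (r ^ 3)) x = 0 :=
        Finset.sum_eq_zero fun j _ => pd_eq_zero_of_vanish ((testFn_cut hR).smooth.pd j) hR
          (fun y hy => pd_cut_eq_zero_of_le hR j hy) j x (by linarith)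
      rw [this, mul_zero]) fun x _ => by
      have h3 := (hb _ hR x).2
      have h4 := sqSum_nonneg u x
      have h5 : |lap (cut (r ^ 3)) x| ≤ K / r ^ 6 := h3.trans_eq (by rw [← pow_mul])
      rw [abs_mul, mul_comm, abs_of_nonneg (by positivity : (0 : ℝ) ≤ sqSum u x / 2)]
      exact mul_le_mul h5 (by linarith) (by positivity) (by positivity)
  rw [integral_const_mul] at t1
  have t1' := t1.trans (mul_le_mul_of_nonneg_left (s.integral_vel_sq h)
    (show 0 ≤ K / r ^ 6 by positivity))
  have e1 : K / r ^ 6 * ((8 * ballVol + 1) * ε * r ^ 5) ≤ K * (8 * ballVol + 1) * ε := by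
    have e : K / r ^ 6 * ((8 * ballVol + 1) * ε * r ^ 5) = K * (8 * ballVol + 1) * ε * (1 / r) := by
      field_simp
    have := ballVol_nonneg
    rw [e]
    exact mul_le_of_le_one_right (by positivity) ((div_le_one hr).2 s.one_le)
  have t2 := abs_integral_le_ball
    (f := fun x => (sqSum u x / 2 + gradSq v x / 2) * cutFlux u (r ^ 3) x)
    (G := fun x => 3 * (K / r ^ 3) * (vecNorm u x ^ 3 + gradNorm v x ^ 2 * vecNorm u x))
    (R := 2 * r ^ 3) (by fun_prop)
    (fun x hx => by rw [cutFlux_eq_zero u hR (by linarith), mul_zero]) fun x _ => by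
      have h3 := abs_cutFlux_le (u := u) (hb _ hR x).1
      have h4 : 0 ≤ vecNorm u x ^ 2 / 2 + gradNorm v x ^ 2 / 2 := by positivity
      have h5 := vecNorm_nonneg u x
      have h6 := gradNorm_nonneg v x
      rw [← vecNorm_sq, ← gradNorm_sq, abs_mul, abs_of_nonneg h4]
      refine (mul_le_mul_of_nonneg_left h3 h4).trans ?_
      have h7 : 0 ≤ 3 * (K / r ^ 3) * (vecNorm u x ^ 3 + gradNorm v x ^ 2 * vecNorm u x) := by
        positivity
      linarith
  rw [integral_const_mul] at t2
  have t2' := t2.trans (mul_le_mul_of_nonneg_left (s.integral_young h)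
    (show 0 ≤ 3 * (K / r ^ 3) by positivity))
  have e2 : 3 * (K / r ^ 3) * ((B + 2) * ε * r ^ 3) = 3 * K * (B + 2) * ε := by field_simp
  have t3 := hC r ε s
  have l1 := le_abs_self (∫ x, sqSum u x / 2 * lap (cut (r ^ 3)) x)
  have l2 := le_abs_self (∫ x, (sqSum u x / 2 + gradSq v x / 2) * cutFlux u (r ^ 3) x)
  have l3 := le_abs_self (∫ x, P x * cutFlux u (r ^ 3) x)
  simp only [cutFlux] at *
  linarith

theorem cube_le_rpow {a l p : ℝ} (ha : 0 ≤ a) (hl : 0 < l) (hp : 3 ≤ p) :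
    a ^ 3 ≤ l ^ (3 - p) * a ^ p + l ^ 3 := by
  rcases le_total a l with h | h
  · exact le_add_of_nonneg_of_le (by positivity) (by gcongr)
  · refine le_add_of_le_of_nonneg ?_ (by positivity)
    have ha' : 0 < a := hl.trans_le h
    have e : a ^ 3 = a ^ (3 - p) * a ^ p := by
      rw [← rpow_add ha', sub_add_cancel]; norm_cast
    rw [e]
    exact mul_le_mul_of_nonneg_right (rpow_le_rpow_of_nonpos hl h (by linarith)) (by positivity)

theorem setIntegral_cube_le_of_morrey {f : E3 → ℝ} (hf : Continuous f) {γ p ε R : ℝ}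
    (hp : 3 ≤ p) (hη : γ - 3 + 2 * p / 3 ≤ 0) (hε : 0 < ε) (hR : 1 ≤ R) {S : Set E3}
    (hS : S ⊆ ball 0 R) :
    ∫ x in S, |f x| ^ 3 ≤
      R * (ε ^ (3 - p) * (R ^ (-γ) * ∫ x in S, |f x| ^ p) + ballVol * ε ^ 3) := by
  have hR0 : 0 < R := by linarith
  have hl : 0 < ε * R ^ (-(2 / 3 : ℝ)) := by positivity
  have hfp : Continuous fun x => |f x| ^ p := hf.abs.rpow_const fun x => Or.inr (by linarith)
  have hi : ∀ {g : E3 → ℝ}, Continuous g → IntegrableOn g S := fun hg =>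
    (integrableOn_ball hg R).mono_set hS
  have h1 : ∫ x in S, |f x| ^ 3 ≤
      ∫ x in S, ((ε * R ^ (-(2 / 3 : ℝ))) ^ (3 - p) * |f x| ^ p + (ε * R ^ (-(2 / 3 : ℝ))) ^ 3) :=
    setIntegral_mono (hi (by fun_prop)) (hi (by fun_prop)) fun x =>
      cube_le_rpow (abs_nonneg _) hl hp
  rw [integral_add (hi (by fun_prop)) (hi continuous_const), integral_const_mul,
    setIntegral_const, smul_eq_mul] at h1
  have h2 : volume.real S ≤ ballVol * R ^ 3 := by
    rw [← volume_real_ball_E3 hR0.le]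
    exact measureReal_mono hS measure_ball_lt_top.ne
  have h3 : (ε * R ^ (-(2 / 3 : ℝ))) ^ 3 * R ^ 3 = ε ^ 3 * R := by
    have : (R ^ (-(2 / 3 : ℝ))) ^ 3 * R ^ 3 = R := by
      rw [← rpow_natCast, ← rpow_natCast, ← rpow_mul hR0.le, ← rpow_add hR0]
      norm_num
    rw [mul_pow, mul_assoc, this]
  have h4 : (ε * R ^ (-(2 / 3 : ℝ))) ^ (3 - p) ≤ ε ^ (3 - p) * (R * R ^ (-γ)) := by
    rw [mul_rpow hε.le (by positivity), ← rpow_mul hR0.le]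
    nth_rewrite 2 [← rpow_one R]
    rw [← rpow_add hR0]
    exact mul_le_mul_of_nonneg_left (rpow_le_rpow_of_exponent_le hR (by linarith)) (by positivity)
  have h5 : 0 ≤ ∫ x in S, |f x| ^ p := integral_nonneg fun x => by positivity
  have h6 := mul_le_mul_of_nonneg_right h4 h5
  have h7 := mul_le_mul_of_nonneg_right h2 (pow_pos hl 3).le
  linear_combination h1 + h6 + h7 + ballVol * h3

theorem MemMorrey.exists_cube_le {f : E3 → ℝ} {γ p : ℝ} (hm : MemMorrey p γ f) (hf : Continuous f)
    (hp : 3 ≤ p) (hη : γ - 3 + 2 * p / 3 ≤ 0) :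
    ∃ C, ∀ R, 1 ≤ R → ∫ x in ball 0 R, |f x| ^ 3 ≤ C * R := by
  obtain ⟨C, hC⟩ := hm.2
  refine ⟨C + ballVol, fun R hR => ?_⟩
  have h := setIntegral_cube_le_of_morrey hf hp hη one_pos hR (subset_refl (ball 0 R))
  rw [one_rpow, one_mul, one_pow, mul_one] at h
  rw [mul_comm]
  exact h.trans (mul_le_mul_of_nonneg_left (by linarith [hC R hR]) (by linarith))

theorem MemMorrey0.eventually_cube_ann_le {f : E3 → ℝ} {γ p : ℝ} (hm : MemMorrey0 p γ f)
    (hf : Continuous f) (hp : 3 ≤ p) (hη : γ - 3 + 2 * p / 3 ≤ 0) {δ : ℝ} (hδ : 0 < δ) :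
    ∀ᶠ R in atTop, ∫ x in ann R, |f x| ^ 3 ≤ δ * R := by
  have h1 : Tendsto (fun ε : ℝ => ballVol * ε ^ 3) (nhdsWithin 0 (Set.Ioi 0)) (nhds 0) := by
    have : ContinuousAt (fun ε : ℝ => ballVol * ε ^ 3) 0 := by fun_prop
    simpa [ContinuousAt] using this.tendsto.mono_left nhdsWithin_le_nhds
  obtain ⟨ε, h2, hε⟩ := ((h1.eventually_lt_const (half_pos hδ)).and self_mem_nhdsWithin).exists
  have h3 := (hm.2.const_mul (ε ^ (3 - p))).eventually_lt_const
    (u := δ / 2) (by simpa using half_pos hδ)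
  filter_upwards [h3, eventually_ge_atTop 1] with R h4 hR
  refine (setIntegral_cube_le_of_morrey hf hp hη hε hR (ann_subset_ball R)).trans ?_
  rw [mul_comm]
  exact mul_le_mul_of_nonneg_right (by linarith) (by linarith)

/-- A quantity of linear growth whose dyadic increments are sublinear is sublinear. -/
theorem eventually_le_of_dyadic {U : ℝ → ℝ} {C δ : ℝ} (hδ : 0 < δ) (hU : ∀ R, 1 ≤ R → U R ≤ C * R)
    (hd : ∀ᶠ R in atTop, U R ≤ U (R / 2) + δ * R) : ∀ᶠ R in atTop, U R ≤ 3 * δ * R := by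
  obtain ⟨R₀, h0⟩ := eventually_atTop.1 (hd.and (eventually_ge_atTop 1))
  have h1 : 1 ≤ R₀ := (h0 R₀ le_rfl).2
  have key : ∀ n : ℕ, ∀ R, 2 ^ n * R₀ ≤ R → U R ≤ (C / 2 ^ n + 2 * δ) * R := by
    intro n
    induction n with
    | zero =>
      intro R hR
      have hR' : R₀ ≤ R := by simpa using hR
      have := hU R (h1.trans hR')
      have : 0 ≤ δ * R := by have : 0 ≤ R := by linarith
                             positivity
      simp only [pow_zero, div_one]
      linarith
    | succ n ih =>
      intro R hR
      have h2 := ih (R / 2) (by rw [pow_succ] at hR; linarith)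
      have h3 : R₀ ≤ 2 ^ (n + 1) * R₀ :=
        le_mul_of_one_le_left (by linarith) (one_le_pow₀ one_le_two)
      have h4 := (h0 R (h3.trans hR)).1
      refine (h4.trans (add_le_add_left h2 _)).trans_eq ?_
      rw [pow_succ]
      field_simp
      ring
  obtain ⟨n, hn⟩ := ((tendsto_const_nhds (x := C)).div_atTop
    (tendsto_pow_atTop_atTop_of_one_lt (one_lt_two (α := ℝ)))).eventually_lt_const hδ |>.exists
  filter_upwards [eventually_ge_atTop (2 ^ n * R₀), eventually_ge_atTop 1] with R hR hR1
  exact (key n R hR).trans (mul_le_mul_of_nonneg_right (by linarith) (by linarith))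

theorem gradNorm_cube_le (v : E3 → Fin 3 → ℝ) (x : E3) :
    gradNorm v x ^ 3 ≤ 81 * ∑ q : Fin 3 × Fin 3, |pd q.1 (fun y => v y q.2) x| ^ 3 := by
  have h1 : gradNorm v x ≤ ∑ q : Fin 3 × Fin 3, |pd q.1 (fun y => v y q.2) x| := by
    refine Real.sqrt_le_iff.2 ⟨by positivity, ?_⟩
    rw [gradSq, ← Fintype.sum_prod_type' fun i k => (pd i (fun y => v y k) x) ^ 2]
    simp only [← sq_abs (pd _ _ _)]
    exact Finset.sum_sq_le_sq_sum_of_nonneg fun _ _ => abs_nonneg _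
  refine (pow_le_pow_left₀ (gradNorm_nonneg v x) h1 3).trans ?_
  have h2 := pow_sum_div_card_le_sum_pow (s := Finset.univ)
    (f := fun q : Fin 3 × Fin 3 => |pd q.1 (fun y => v y q.2) x|) (fun _ _ => abs_nonneg _) 2
  rw [div_le_iff₀ (by simp)] at h2
  refine h2.trans_eq ?_
  rw [mul_comm]
  simp
  norm_num

theorem SmoothSol.exists_gradNorm_cube_le (h : SmoothSol u P v) {γ p : ℝ}
    (hvm : ∀ i k : Fin 3, MemMorrey p γ (fun x => pd i (fun y => v y k) x))
    (hp : 3 ≤ p) (hη : γ - 3 + 2 * p / 3 ≤ 0) :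
    ∃ C, ∀ R, 1 ≤ R → ∫ x in ball 0 R, gradNorm v x ^ 3 ≤ C * R := by
  have hc : ∀ i k, Continuous (pd i fun y => v y k) := fun i k => ((h.sv k).pd i).continuous
  choose C hC using fun q : Fin 3 × Fin 3 => (hvm q.1 q.2).exists_cube_le (hc q.1 q.2) hp hη
  have cv := h.cont_gradNorm
  refine ⟨81 * ∑ q, C q, fun R hR => ?_⟩
  have hi : ∀ q : Fin 3 × Fin 3, IntegrableOn (fun x => |pd q.1 (fun y => v y q.2) x| ^ 3)
      (ball 0 R) := fun q => integrableOn_ball ((hc q.1 q.2).abs.pow 3) R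
  refine (setIntegral_mono (integrableOn_ball (by fun_prop) R)
    ((integrable_finsetSum _ fun q _ => hi q).const_mul 81)
    fun x => gradNorm_cube_le v x).trans ?_
  rw [integral_const_mul, integral_finsetSum _ fun q _ => hi q, mul_assoc, Finset.sum_mul]
  exact mul_le_mul_of_nonneg_left (Finset.sum_le_sum fun q _ => hC q R hR) (by norm_num)

theorem eventually_smallAt {V : ℝ} (hcu : Continuous (vecNorm u)) {C : ℝ}
    (hu : ∀ R, 1 ≤ R → ∫ x in ball 0 R, vecNorm u x ^ 3 ≤ C * R)
    (ha : ∀ δ : ℝ, 0 < δ → ∀ᶠ R in atTop, ∫ x in ann R, vecNorm u x ^ 3 ≤ δ * R)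
    (hv : ∀ R, 1 ≤ R → ∫ x in ball 0 R, gradNorm v x ^ 3 ≤ V * R) (hε : 0 < ε) (hε1 : ε ≤ 1) :
    ∀ᶠ r in atTop, SmallAt u v (2 * V) r ε := by
  have h1 : ∀ᶠ R in atTop, ∫ x in ball 0 R, vecNorm u x ^ 3 ≤ 3 * (ε ^ 3 / 6) * R := by
    refine eventually_le_of_dyadic (by positivity) hu ?_
    filter_upwards [ha (ε ^ 3 / 6) (by positivity), eventually_gt_atTop 0] with R hR hR0
    rw [setIntegral_ball_eq_ann_add (by fun_prop) hR0]
    linarith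
  have h2 : Tendsto (fun r : ℝ => 2 * r ^ 3) atTop atTop :=
    (tendsto_pow_atTop (by norm_num)).const_mul_atTop two_pos
  filter_upwards [h2.eventually h1, eventually_ge_atTop 1] with r hr hr1
  have h3 : 1 ≤ r ^ 3 := one_le_pow₀ hr1
  exact ⟨hr1, hε, hε1, by linarith, by linarith [hv (2 * r ^ 3) (by linarith)]⟩

theorem eq_const_of_pd_eq_zero {f : E3 → ℝ} (hf : Sm f) (h : ∀ x i, pd i f x = 0) (x y : E3) :
    f x = f y := by
  refine is_const_of_fderiv_eq_zero hf.diff (fun z => ?_) x y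
  ext w
  rw [clm_apply_eq_sum]
  exact Finset.sum_eq_zero fun j _ => mul_eq_zero_of_right _ (h z j)

theorem pd_eq_zero_of_gradSq {v : E3 → Fin 3 → ℝ} {x : E3} (h : gradSq v x = 0) (i k : Fin 3) :
    pd i (fun y => v y k) x = 0 := by
  have h1 := (Finset.sum_eq_zero_iff_of_nonneg fun i _ => Finset.sum_nonneg fun k _ =>
    sq_nonneg (pd i (fun y => v y k) x)).1 h i (Finset.mem_univ i)
  have h2 := (Finset.sum_eq_zero_iff_of_nonneg fun k _ =>
    sq_nonneg (pd i (fun y => v y k) x)).1 h1 k (Finset.mem_univ k)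
  exact pow_eq_zero_iff two_ne_zero |>.1 h2

theorem ballVol_pos : 0 < ballVol :=
  ENNReal.toReal_pos (measure_ball_pos _ _ one_pos).ne' measure_ball_lt_top.ne

theorem SmoothSol.gradSq_vel_eq_zero (h : SmoothSol u P v)
    (hs : ∀ ε : ℝ, 0 < ε → ε ≤ 1 → ∀ᶠ r in atTop, SmallAt u v B r ε) (x : E3) :
    gradSq u x = 0 := by
  have cu := (sm_gradSq h.su).continuous
  refine eq_zero_of_setIntegral_ball cu (gradSq_nonneg u) (fun R => ?_) x
  obtain ⟨C, hC⟩ := h.exists_energy_le B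
  have h1 : Tendsto (fun ε : ℝ => C * ε) (nhdsWithin 0 (Set.Ioi 0)) (nhds 0) := by
    have : ContinuousAt (fun ε : ℝ => C * ε) 0 := by fun_prop
    simpa [ContinuousAt] using this.tendsto.mono_left nhdsWithin_le_nhds
  have h2 : Tendsto (fun r : ℝ => r ^ 3 / 2) atTop atTop :=
    (tendsto_pow_atTop (by norm_num)).atTop_div_const two_pos
  refine ge_of_tendsto h1 ?_
  filter_upwards [Ioc_mem_nhdsGT one_pos] with ε hε
  obtain ⟨r, hr, hrR⟩ := ((hs ε hε.1 hε.2).and (h2.eventually_ge_atTop R)).exists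
  exact (setIntegral_ball_mono cu (gradSq_nonneg u) hrR).trans (hC r ε hr)

theorem vel_eq_zero_of_const {C : ℝ} (hc : ∀ x y i, u x i = u y i)
    (hu : ∀ R, 1 ≤ R → ∫ x in ball 0 R, vecNorm u x ^ 3 ≤ C * R) (x : E3) (i : Fin 3) :
    u x i = 0 := by
  have h1 : ∀ y, vecNorm u y = vecNorm u x := fun y => by
    unfold vecNorm
    simp only [hc y x]
  simp only [h1, setIntegral_const, smul_eq_mul] at hu
  have h2 : ∀ R, 1 ≤ R → ballVol * vecNorm u x ^ 3 * R ^ 2 ≤ C := fun R hR => by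
    have h := hu R hR
    rw [volume_real_ball_E3 (by linarith)] at h
    exact le_of_mul_le_mul_right (h.trans' (by ring_nf; rfl)) (by linarith : 0 < R)
  have h3 : vecNorm u x = 0 := by
    by_contra hne
    have h4 : 0 < ballVol * vecNorm u x ^ 3 :=
      mul_pos ballVol_pos (pow_pos ((vecNorm_nonneg u x).lt_of_ne' hne) 3)
    have h5 : Tendsto (fun R : ℝ => ballVol * vecNorm u x ^ 3 * R ^ 2) atTop atTop :=
      (tendsto_pow_atTop (by norm_num)).const_mul_atTop h4
    obtain ⟨R, hR, hR1⟩ := ((h5.eventually_gt_atTop C).and (eventually_ge_atTop 1)).exists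
    exact (h2 R hR1).not_gt hR
  have h6 := abs_vel_le u x i
  rw [h3] at h6
  exact abs_nonpos_iff.1 h6

theorem SmoothSol.pressure_const (h : SmoothSol u P v) (hu : ∀ x i, u x i = 0)
    (hv : ∀ x i k, pd i (fun y => v y k) x = 0) (x y : E3) : P x = P y := by
  refine eq_const_of_pd_eq_zero h.sP (fun z i => ?_) x y
  have e : ∀ j, elas v i j = fun _ => 0 := fun j => funext fun z => by simp [elas, hv]
  have e0 : ∀ j, (pd j fun _ => 0) = fun _ => 0 := fun j => funext fun z => by simp [pd]
  rw [h.momentum]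
  simp [hu, e, lap, e0]

end

theorem liouville_stationary_EL_eta_nonpos
    (u v : E3 → Fin 3 → ℝ) (P : E3 → ℝ) (γ p : ℝ)
    (hu : ContDiff ℝ (⊤ : ℕ∞) u) (hP : ContDiff ℝ (⊤ : ℕ∞) P)
    (hv : ContDiff ℝ (⊤ : ℕ∞) v)
    (hunit : ∀ x : E3, ∑ i, (v x i) ^ 2 = 1)
    (hsol : StatEL u P v)
    (hannv : ∃ C : ℝ, ∀ R : ℝ, 1 ≤ R → ∫ x in ann R, gradSq v x ≤ C)
    (hγ0 : 0 < γ) (hγ3 : γ < 3) (hp3 : 3 ≤ p)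
    (hη : γ / p - 3 / p + 2 / 3 ≤ 0)
    (hum : MemMorrey0 p γ (vecNorm u))
    (hvm : ∀ i k : Fin 3, MemMorrey p γ (fun x => pd i (fun y => v y k) x)) :
    (∀ x : E3, ∀ i : Fin 3, u x i = 0) ∧
    (∀ x : E3, ∀ i k : Fin 3, pd i (fun y => v y k) x = 0) ∧
    (∃ c : ℝ, ∀ x : E3, P x = c) := by
  have h : SmoothSol u P v := ⟨contDiff_pi.1 hu, hP, contDiff_pi.1 hv, hunit, hsol⟩
  have hp0 : 0 < p := by linarith
  have hη' : γ - 3 + 2 * p / 3 ≤ 0 := by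
    have h1 := mul_nonpos_of_nonpos_of_nonneg hη hp0.le
    have h2 : (γ / p - 3 / p + 2 / 3) * p = γ - 3 + 2 * p / 3 := by field_simp
    rwa [h2] at h1
  have cu := h.cont_vecNorm
  have habs : ∀ x, |vecNorm u x| = vecNorm u x := fun x => abs_of_nonneg (vecNorm_nonneg u x)
  obtain ⟨C, hC⟩ := hum.1.exists_cube_le cu hp3 hη'
  have ha := fun δ (hδ : (0 : ℝ) < δ) => hum.eventually_cube_ann_le cu hp3 hη' hδ
  simp only [habs] at hC ha
  obtain ⟨V, hV⟩ := h.exists_gradNorm_cube_le hvm hp3 hη'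
  have hgu := h.gradSq_vel_eq_zero fun ε hε hε1 => eventually_smallAt cu hC ha hV hε hε1
  have hu0 : ∀ x i, u x i = 0 := vel_eq_zero_of_const (fun x y i =>
    eq_const_of_pd_eq_zero (h.su i) (fun z j => pd_eq_zero_of_gradSq (hgu z) j i) x y) hC
  obtain ⟨D, hD⟩ := hannv
  have hv0 : ∀ x i k, pd i (fun y => v y k) x = 0 := fun x =>
    pd_eq_zero_of_gradSq (h.gradSq_eq_zero hu0 hD x)
  exact ⟨hu0, hv0, P 0, fun x => h.pressure_const hu0 hv0 x 0⟩
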